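/- For every n with 1 ≤ n ≤ 13, the complete multigraph K_{2n+1}^{(2τ(2n+1))} has a decomposition into 2n+1 copies of the family of all trees of order 2n+1: there exists a multiset M of spanning trees of the complete graph on 2n+1 vertices such that every isomorphism class of trees on 2n+1 vertices is represented by exactly 2n+1 members of M (counted with multiplicity), and every pair of distinct vertices is an edge of exactly 2τ(2n+1) members of M (counted with multiplicity), where τ(2n+1) is the number of isomorphism classes of trees on 2n+1 vertices. -/

import Mathlib

/-- Cyclic distance `dc_n(s,t)`. -/
def dc (n s t : ℕ) : ℕ := min (Nat.dist s t) (n - Nat.dist s t)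

/-- `dc` as a function on unordered pairs. -/
def dcSym2 (n : ℕ) : Sym2 ℕ → ℕ :=
  Sym2.lift ⟨dc n, fun s t => by simp [dc, Nat.dist_comm]⟩

/-- Multiset of induced edge labels `dc_n(lab u, lab v)` over the edges of `T`. -/
noncomputable def edgeLabels {V : Type*} [Finite V] (n : ℕ) (T : SimpleGraph V)
    (lab : V → ℕ) : Multiset ℕ :=
  (T.edgeSet.toFinite.toFinset).val.map (fun e => dcSym2 n (Sym2.map lab e))

/-- A graph on `2n+1` vertices is semigraceful if some bijective labeling by `1,…,2n+1`
induces the multiset `{1,1,2,2,…,n,n}` of cyclic-distance edge labels. -/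
def IsSemigraceful {V : Type*} [Finite V] (n : ℕ) (T : SimpleGraph V) : Prop :=
  ∃ ℓ : V ≃ Fin (2 * n + 1),
    edgeLabels (2 * n + 1) T (fun v => (ℓ v : ℕ) + 1) =
      Multiset.Icc 1 n + Multiset.Icc 1 n

/-- A graph on `p` vertices is graceful if some bijective labeling by `0,…,p-1` makes the
induced absolute-difference edge labels pairwise distinct. -/
def IsGraceful {V : Type*} [Finite V] (p : ℕ) (T : SimpleGraph V) : Prop :=
  ∃ ℓ : V ≃ Fin p,
    Set.InjOn
      (Sym2.lift ⟨fun u v => Nat.dist (ℓ u : ℕ) (ℓ v : ℕ), fun u v => Nat.dist_comm _ _⟩)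
      T.edgeSet

/-- Number of members of a multiset satisfying a (not necessarily decidable) predicate. -/
noncomputable def countP' {α : Type*} (p : α → Prop) (M : Multiset α) : ℕ :=
  @Multiset.countP α p (Classical.decPred p) M

/-- The number of isomorphism classes of trees on `m` vertices. -/
noncomputable def tau (m : ℕ) : ℕ :=
  Nat.card (Quot fun G H : { T : SimpleGraph (Fin m) // T.IsTree } => Nonempty (G.1 ≃g H.1))

open Finset in
/-- The number of oriented edges of `T` whose end labels differ by `d`. -/
noncomputable def diffCount {V A : Type*} [Fintype V] [AddCommGroup A] (T : SimpleGraph V)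
    (f : V ≃ A) (d : A) : ℕ :=
  open Classical in #{p : V × V | T.Adj p.1 p.2 ∧ f p.1 - f p.2 = d}

section DiffCount

variable {V A : Type*} [Fintype V] [AddCommGroup A]

open Finset

lemma diffCount_neg (T : SimpleGraph V) (f : V ≃ A) (d : A) :
    diffCount T f (-d) = diffCount T f d := by
  classical
  unfold diffCount
  refine card_bij' (fun p _ => p.swap) (fun p _ => p.swap) ?_ ?_ (by simp) (by simp)
  · rintro ⟨u, v⟩ h
    simp only [mem_filter, mem_univ, true_and, Prod.swap] at h ⊢
    exact ⟨h.1.symm, by rw [← neg_sub, h.2, neg_neg]⟩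
  · rintro ⟨u, v⟩ h
    simp only [mem_filter, mem_univ, true_and, Prod.swap] at h ⊢
    exact ⟨h.1.symm, by rw [← neg_sub, h.2]⟩

lemma diffCount_iso {T T' : SimpleGraph V} (φ : T ≃g T') (f : V ≃ A) (d : A) :
    diffCount T (φ.toEquiv.trans f) d = diffCount T' f d := by
  classical
  unfold diffCount
  refine card_equiv (φ.toEquiv.prodCongr φ.toEquiv) ?_
  rintro ⟨u, v⟩
  rw [mem_filter, mem_filter]
  simpa using fun _ => φ.map_adj_iff.symm

lemma card_adj_of_isTree {T : SimpleGraph V} (hT : T.IsTree) [DecidableRel T.Adj] :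
    #{p : V × V | T.Adj p.1 p.2} = 2 * (Fintype.card V - 1) := by
  classical
  have h := hT.card_edgeFinset
  have h2 := T.sum_degrees_eq_twice_card_edges
  have h3 : #{p : V × V | T.Adj p.1 p.2} = ∑ v, T.degree v := by
    rw [card_filter, Fintype.sum_prod_type]
    refine sum_congr rfl fun v _ => ?_
    rw [← card_filter, ← T.card_neighborFinset_eq_degree]
    congr 1
    ext u
    simp
  omega

/-- Rotating labelled representatives of all isomorphism classes of trees. -/
lemma exists_decomposition_of_labellings [Fintype A] (e : V ≃ A)
    {Q : Type*} [Fintype Q] (rep : Q → SimpleGraph V) (hrep : ∀ q, (rep q).IsTree)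
    (hex : ∀ T : SimpleGraph V, T.IsTree → ∃ q, Nonempty (rep q ≃g T))
    (hinj : ∀ q q', Nonempty (rep q ≃g rep q') → q = q')
    (F : Q → V ≃ A)
    (hF : ∀ d ≠ 0, ∑ q, diffCount (rep q) (F q) d = 2 * Fintype.card Q) :
    ∃ M : Multiset (SimpleGraph V), (∀ G ∈ M, G.IsTree) ∧
      (∀ T : SimpleGraph V, T.IsTree →
        countP' (fun G => Nonempty (G ≃g T)) M = Fintype.card A) ∧
      (∀ a b : V, a ≠ b → countP' (fun G => G.Adj a b) M = 2 * Fintype.card Q) := by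
  classical
  let σ : Q × A → V ≃ V := fun x => (e.trans (Equiv.subRight x.2)).trans (F x.1).symm
  let G : Q × A → SimpleGraph V := fun x => (rep x.1).comap (σ x)
  have iso : ∀ x, G x ≃g rep x.1 := fun x => SimpleGraph.Iso.comap (σ x) (rep x.1)
  have hcount : ∀ p : SimpleGraph V → Prop,
      countP' p ((univ : Finset (Q × A)).val.map G) = #{x : Q × A | p (G x)} := by
    intro p
    unfold countP'
    rw [Multiset.countP_map]
    rfl
  refine ⟨(univ : Finset (Q × A)).val.map G, ?_, ?_, ?_⟩
  · intro H hH
    obtain ⟨x, -, rfl⟩ := Multiset.mem_map.1 hH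
    exact (iso x).isTree_iff.2 (hrep x.1)
  · intro T hT
    rw [hcount]
    obtain ⟨q, ⟨φ⟩⟩ := hex T hT
    have : ({x : Q × A | Nonempty (G x ≃g T)} : Finset (Q × A)) = {q} ×ˢ univ := by
      ext x
      simp only [mem_filter, mem_univ, true_and, mem_product, mem_singleton, and_true]
      constructor
      · rintro ⟨ψ⟩
        exact hinj _ _ ⟨((iso x).symm.trans ψ).trans φ.symm⟩
      · rintro rfl
        exact ⟨(iso x).trans φ⟩
    rw [this, card_product]
    simp
  · intro a b hab
    rw [hcount, ← hF (e a - e b) (sub_ne_zero.2 (e.injective.ne hab)), card_filter,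
      Fintype.sum_prod_type]
    refine sum_congr rfl fun q _ => ?_
    refine (card_filter _ _).symm.trans ?_
    rw [diffCount]
    refine card_bij' (fun k _ => ((F q).symm (e a - k), (F q).symm (e b - k)))
      (fun p _ => e a - F q p.1) ?_ ?_ ?_ ?_
    · intro k hk
      simpa [G, σ] using hk
    · rintro ⟨u, v⟩ h
      simp only [mem_filter, mem_univ, true_and] at h
      have : e b - (e a - F q u) = F q v := by
        have := h.2
        rw [sub_eq_iff_eq_add] at this
        rw [this]; abel
      simpa [G, σ, this] using h.1
    · intro k _
      simp
    · rintro ⟨u, v⟩ h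
      simp only [mem_filter, mem_univ, true_and] at h
      have : e b - (e a - F q u) = F q v := by
        have := h.2
        rw [sub_eq_iff_eq_add] at this
        rw [this]; abel
      simp [this]

/-- The average of `diffCount T f d` over all labellings is two. -/
lemma sum_diffCount [Fintype A] [DecidableEq V] [DecidableEq A] (hV : 2 ≤ Fintype.card V)
    {T : SimpleGraph V} (hT : T.IsTree) (e : V ≃ A) {d : A} (hd : d ≠ 0) :
    ∑ f : V ≃ A, diffCount T f d = 2 * Fintype.card (V ≃ A) := by
  classical
  -- the number of labellings placing difference `x` on `(u, v)`
  let N : V → V → A → ℕ := fun u v x => #{f : V ≃ A | f u - f v = x}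
  have key : ∀ u v : V, u ≠ v → ∀ x y : A, x ≠ 0 → y ≠ 0 → N u v x = N u v y := by
    intro u v huv x y hx hy
    have aux : ∀ x y : A, x ≠ 0 → y ≠ 0 → ∀ f : V ≃ A, f u - f v = x →
        Equiv.swap (f v + x) (f v + y) (f u) = f v + y ∧
          Equiv.swap (f v + x) (f v + y) (f v) = f v := by
      intro x y hx hy f h
      refine ⟨?_, Equiv.swap_apply_of_ne_of_ne (by simpa using hx) (by simpa using hy)⟩
      rw [show f u = f v + x by rw [← h]; abel, Equiv.swap_apply_left]
    refine card_bij' (fun f _ => f.trans (Equiv.swap (f v + x) (f v + y)))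
      (fun f _ => f.trans (Equiv.swap (f v + y) (f v + x))) ?_ ?_ ?_ ?_
    · intro f hf
      have := aux x y hx hy f (by simpa using hf)
      simp [this.1, this.2]
    · intro f hf
      have := aux y x hy hx f (by simpa using hf)
      simp [this.1, this.2]
    · intro f hf
      have := aux x y hx hy f (by simpa using hf)
      ext w
      simp [this.2, Equiv.swap_comm (f v + y)]
    · intro f hf
      have := aux y x hy hx f (by simpa using hf)
      ext w
      rw [Equiv.swap_comm] at this
      simp [this.2, Equiv.swap_comm (f v + y)]
  have key2 : ∀ u v, u ≠ v → (Fintype.card V - 1) * N u v d = Fintype.card (V ≃ A) := by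
    intro u v huv
    have : ∑ x ∈ univ.erase (0 : A), N u v x = Fintype.card (V ≃ A) := by
      rw [← card_univ, card_eq_sum_card_fiberwise (f := fun f : V ≃ A => f u - f v)
        (t := univ.erase (0 : A))]
      intro f _
      simpa [sub_eq_zero] using huv
    rw [← this, sum_congr rfl fun x hx => key u v huv x d (ne_of_mem_erase hx) hd, sum_const,
      card_erase_of_mem (mem_univ _), card_univ, Fintype.card_congr e, smul_eq_mul]
  have : ∑ f : V ≃ A, diffCount T f d = ∑ p : V × V with T.Adj p.1 p.2, N p.1 p.2 d := by
    simp only [diffCount, N, card_filter, ite_and]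
    rw [sum_comm, sum_filter]
    refine sum_congr rfl fun p _ => ?_
    split_ifs
    · exact sum_congr rfl fun f _ => by congr
    · simp
  have h1 : (Fintype.card V - 1) * ∑ f : V ≃ A, diffCount T f d
      = (Fintype.card V - 1) * (2 * Fintype.card (V ≃ A)) := by
    rw [this, mul_sum, sum_congr rfl fun p hp => key2 p.1 p.2 (mem_filter.1 hp).2.ne, sum_const,
      card_adj_of_isTree hT, smul_eq_mul]
    ring
  exact Nat.eq_of_mul_eq_mul_left (by omega) h1

end DiffCount

section Rounding

open Finset

lemma sum_weight_norm_sub_mean_sq {κ E : Type*} [NormedAddCommGroup E] [InnerProductSpace ℝ E]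
    (t : Finset κ) (w : κ → ℝ) (v : κ → E) (h1 : ∑ k ∈ t, w k = 1) (S : E) :
    ∑ k ∈ t, w k * ‖S + (v k - ∑ l ∈ t, w l • v l)‖ ^ 2 =
      ‖S‖ ^ 2 + (∑ k ∈ t, ∑ l ∈ t, w k * w l * ‖v k - v l‖ ^ 2) / 2 := by
  set μ := ∑ l ∈ t, w l • v l with hμ
  have hin : ∀ x : E, ∑ k ∈ t, w k * inner ℝ x (v k) = inner ℝ x μ := by
    intro x
    rw [hμ, inner_sum]
    exact sum_congr rfl fun k _ => by rw [inner_smul_right]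
  have hL : ∀ k, ‖S + (v k - μ)‖ ^ 2 = ‖S‖ ^ 2 + ‖μ‖ ^ 2 - 2 * inner ℝ S μ
      + 2 * inner ℝ (S - μ) (v k) + ‖v k‖ ^ 2 := by
    intro k
    rw [norm_add_sq_real, norm_sub_sq_real, inner_sub_right, inner_sub_left,
      real_inner_comm μ (v k)]
    ring
  have hLsum : ∑ k ∈ t, w k * ‖S + (v k - μ)‖ ^ 2 =
      ‖S‖ ^ 2 + ∑ k ∈ t, w k * ‖v k‖ ^ 2 - ‖μ‖ ^ 2 := by
    have : ∀ k ∈ t, w k * ‖S + (v k - μ)‖ ^ 2 =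
        w k * (‖S‖ ^ 2 + ‖μ‖ ^ 2 - 2 * inner ℝ S μ) + 2 * (w k * inner ℝ (S - μ) (v k))
          + w k * ‖v k‖ ^ 2 := fun k _ => by rw [hL]; ring
    rw [sum_congr rfl this, sum_add_distrib, sum_add_distrib, ← sum_mul, h1, ← mul_sum, hin,
      inner_sub_left, real_inner_self_eq_norm_sq]
    ring
  have hR : ∀ k ∈ t, ∑ l ∈ t, w k * w l * ‖v k - v l‖ ^ 2 =
      w k * ‖v k‖ ^ 2 - 2 * (w k * inner ℝ μ (v k)) + w k * ∑ l ∈ t, w l * ‖v l‖ ^ 2 := by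
    intro k _
    have : ∀ l ∈ t, w k * w l * ‖v k - v l‖ ^ 2 = w l * (w k * ‖v k‖ ^ 2)
        - 2 * w k * (w l * inner ℝ (v k) (v l)) + w k * (w l * ‖v l‖ ^ 2) := fun l _ => by
      rw [norm_sub_sq_real]; ring
    rw [sum_congr rfl this, sum_add_distrib, sum_sub_distrib, ← sum_mul, h1, ← mul_sum, hin,
      ← mul_sum, real_inner_comm]
    ring
  rw [hLsum, sum_congr rfl hR, sum_add_distrib, sum_sub_distrib, ← sum_mul, h1, ← mul_sum, hin,
    real_inner_self_eq_norm_sq]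
  ring

lemma sum_weight_mul_norm_sub_sq_le {κ E : Type*} [NormedAddCommGroup E]
    (t : Finset κ) (w : κ → ℝ) (v : κ → E) (hw : ∀ k ∈ t, 0 < w k) (h1 : ∑ k ∈ t, w k = 1)
    {B : ℝ} (hB : ∀ k ∈ t, ∀ l ∈ t, ‖v k - v l‖ ^ 2 ≤ B) (h0 : 0 ≤ B) :
    ∑ k ∈ t, ∑ l ∈ t, w k * w l * ‖v k - v l‖ ^ 2 ≤ B / 2 * (#t - 1) := by
  classical
  have hb : ∀ k ∈ t, ∑ l ∈ t, w k * w l * ‖v k - v l‖ ^ 2 ≤ B * w k - B * w k ^ 2 := by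
    intro k hk
    have : ∑ l ∈ t.erase k, w k * w l * ‖v k - v l‖ ^ 2 ≤ ∑ l ∈ t.erase k, w k * w l * B :=
      sum_le_sum fun l hl => mul_le_mul_of_nonneg_left (hB k hk l (mem_of_mem_erase hl))
        (mul_pos (hw k hk) (hw l (mem_of_mem_erase hl))).le
    rw [← add_sum_erase t _ hk]
    rw [← sum_mul, ← mul_sum] at this
    have h2 := add_sum_erase t w hk
    rw [h1] at h2
    rw [show ∑ l ∈ t.erase k, w l = 1 - w k by linarith] at this
    simp only [sub_self, norm_zero]
    nlinarith
  have hs := sum_le_sum hb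
  rw [sum_sub_distrib, ← mul_sum, ← mul_sum, h1] at hs
  have hcs := sq_sum_le_card_mul_sum_sq (s := t) (f := w)
  rw [h1] at hcs
  refine hs.trans ?_
  have hne : t.Nonempty := by
    rw [nonempty_iff_ne_empty]; rintro rfl; simp at h1
  have hc : 1 ≤ #t := hne.card_pos
  rcases hc.eq_or_lt with h | h
  · rw [← h] at hcs ⊢
    norm_num at hcs ⊢
    nlinarith
  · have h2 : (2 : ℝ) ≤ #t := by exact_mod_cast h
    have h3 : 1 - ∑ k ∈ t, w k ^ 2 ≤ ((#t : ℝ) - 1) / 2 := by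
      have : 0 ≤ ∑ k ∈ t, w k ^ 2 := sum_nonneg fun _ _ => sq_nonneg _
      have : 1 / (#t : ℝ) ≤ ∑ k ∈ t, w k ^ 2 := by
        rw [div_le_iff₀ (by linarith)]; linarith
      have h4 : 1 - 1 / (#t : ℝ) ≤ ((#t : ℝ) - 1) / 2 := by
        rw [sub_le_iff_le_add, ← sub_le_iff_le_add', le_div_iff₀ (by linarith)]
        nlinarith
      linarith
    nlinarith

/-- Sequential rounding of convex combinations. -/
lemma exists_choice_norm_sq_le {ι κ E : Type*} [DecidableEq ι] [Fintype κ] [NormedAddCommGroup E]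
    [InnerProductSpace ℝ E] (π : κ → ι) (w : κ → ℝ) (hw : ∀ k, 0 < w k) (v : κ → E) {B : ℝ}
    (hB : ∀ k l, ‖v k - v l‖ ^ 2 ≤ B) (h0 : 0 ≤ B) (h1 : ∀ i, ∑ k with π k = i, w k = 1)
    (s : Finset ι) :
    ∃ F : ι → κ, (∀ i ∈ s, π (F i) = i) ∧
      ‖∑ i ∈ s, (v (F i) - ∑ k with π k = i, w k • v k)‖ ^ 2 ≤
        B / 4 * ∑ i ∈ s, ((#{k | π k = i} : ℝ) - 1) := by
  have hne : ∀ i, ({k | π k = i} : Finset κ).Nonempty := by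
    intro i
    rw [nonempty_iff_ne_empty]
    intro h
    simpa [h] using h1 i
  induction s using Finset.induction_on with
  | empty =>
    exact ⟨fun i => (hne i).choose, by simp, by simp⟩
  | insert i s hi ih =>
    obtain ⟨F, hF, hle⟩ := ih
    set S := ∑ i ∈ s, (v (F i) - ∑ k with π k = i, w k • v k) with hS
    have hm := sum_weight_norm_sub_mean_sq {k | π k = i} w v (h1 i) S
    have hv := sum_weight_mul_norm_sub_sq_le {k | π k = i} w v (fun k _ => hw k) (h1 i)
      (fun k _ l _ => hB k l) h0
    obtain ⟨k, hk, hkle⟩ : ∃ k ∈ ({k | π k = i} : Finset κ),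
        ‖S + (v k - ∑ k with π k = i, w k • v k)‖ ^ 2 ≤
          ‖S‖ ^ 2 + B / 4 * ((#{k | π k = i} : ℝ) - 1) := by
      by_contra! hcon
      have := sum_lt_sum_of_nonempty (hne i) fun k hk =>
        mul_lt_mul_of_pos_left (hcon k hk) (hw k)
      rw [hm, ← sum_mul, h1] at this
      linarith
    refine ⟨Function.update F i k, ?_, ?_⟩
    · intro j hj
      by_cases hji : j = i
      · subst hji
        simpa using hk
      · simpa [hji] using hF j ((mem_insert.1 hj).resolve_left hji)
    · have hS' : ∑ j ∈ s, (v (Function.update F i k j) - ∑ k with π k = j, w k • v k) = S :=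
        sum_congr rfl fun j hj => by rw [Function.update_of_ne (ne_of_mem_of_not_mem hj hi)]
      rw [sum_insert hi, sum_insert hi, Function.update_self, hS', add_comm]
      linarith

/-- A Shapley-Folkman type statement: vector families with mean zero in the hyperplane of
coordinate sum zero have representatives with a small sum. -/
lemma exists_small_sum {ι P : Type*} [Fintype ι] [Fintype P] [Nonempty P] {n : ℕ} (hn : 0 < n)
    (v : ι → P → EuclideanSpace ℝ (Fin n)) (hv : ∀ i p, ∑ j, v i p j = 0)
    (hmean : ∀ i, ∑ p, v i p = 0) {B : ℝ} (h0 : 0 ≤ B)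
    (hB : ∀ i p i' p', ‖v i p - v i' p'‖ ^ 2 ≤ B) :
    ∃ F : ι → P, ‖∑ i, v i (F i)‖ ^ 2 ≤ B / 4 * (n - 1) := by
  classical
  rcases isEmpty_or_nonempty ι with hι | hι
  · refine ⟨fun i => hι.elim i, ?_⟩
    have hn1 : (1 : ℝ) ≤ n := by exact_mod_cast hn
    simpa using mul_nonneg (by linarith : 0 ≤ B / 4) (sub_nonneg.2 hn1)
  obtain ⟨p₀⟩ := ‹Nonempty P›
  obtain ⟨i₀⟩ := hι
  let z : ι × P → EuclideanSpace ℝ (Fin n) × (ι → ℝ) := fun x => (v x.1 x.2, Pi.single x.1 1)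
  let c : ℝ := Fintype.card ι
  have hc : 0 < c := by simpa [c] using Fintype.card_pos_iff.2 ⟨i₀⟩
  have hmem : ((0, fun _ => c⁻¹) : EuclideanSpace ℝ (Fin n) × (ι → ℝ)) ∈
      convexHull ℝ (Set.range z) := by
    have hP : (0 : ℝ) < Fintype.card P := by exact_mod_cast Fintype.card_pos_iff.2 ⟨p₀⟩
    have hsum := (convex_convexHull ℝ (Set.range z)).sum_mem (t := univ)
      (w := fun _ => (c * Fintype.card P)⁻¹) (z := z) (fun _ _ => by positivity)
      (by
        rw [sum_const, card_univ, Fintype.card_prod, nsmul_eq_mul, Nat.cast_mul]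
        exact mul_inv_cancel₀ (mul_pos hc hP).ne')
      (fun x _ => subset_convexHull ℝ _ ⟨x, rfl⟩)
    convert hsum using 1
    ext1
    · simp only [Prod.fst_sum, Prod.smul_fst, z, ← smul_sum, Fintype.sum_prod_type, hmean,
        sum_const_zero, smul_zero]
    · ext i
      simp [Prod.snd_sum, z, Fintype.sum_prod_type, Finset.sum_apply, Pi.single_apply]
      field_simp
  obtain ⟨κ, _, y, w, hy, haff, hw, hw1, hyw⟩ := eq_pos_convex_span_of_mem_convexHull hmem
  choose x hx using fun k => hy (Set.mem_range_self k)
  have hcard : (Fintype.card κ : ℝ) ≤ (n - 1) + c := by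
    let φ : (EuclideanSpace ℝ (Fin n) × (ι → ℝ)) →ₗ[ℝ] ℝ × ℝ :=
      { toFun := fun a => (∑ j, a.1 j, ∑ i, a.2 i)
        map_add' := fun a b => by simp [sum_add_distrib]
        map_smul' := fun r a => by simp [mul_sum] }
    have hle : vectorSpan ℝ (Set.range y) ≤ LinearMap.ker φ := by
      refine Submodule.span_le.2 ?_
      rintro _ ⟨_, ⟨k, rfl⟩, _, ⟨l, rfl⟩, rfl⟩
      simp [φ, ← hx, z, hv]
    have hsurj : LinearMap.range φ = ⊤ := by
      refine LinearMap.range_eq_top.2 fun ⟨a, b⟩ =>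
        ⟨(EuclideanSpace.single ⟨0, hn⟩ a, Pi.single i₀ b), ?_⟩
      simp [φ]
    have h1 := haff.card_le_finrank_succ
    have h2 := Submodule.finrank_mono hle
    have h3 := LinearMap.finrank_range_add_finrank_ker φ
    rw [hsurj, finrank_top] at h3
    simp only [Module.finrank_prod, Module.finrank_self, finrank_euclideanSpace, Fintype.card_fin,
      Module.finrank_fintype_fun_eq_card] at h3
    have h4 : Fintype.card κ + 1 ≤ n + Fintype.card ι := by omega
    have : (Fintype.card κ : ℝ) + 1 ≤ n + Fintype.card ι := by exact_mod_cast h4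
    linarith
  have hfst : ∑ k, w k • v (x k).1 (x k).2 = 0 := by
    have := congrArg Prod.fst hyw
    simpa [Prod.fst_sum, ← hx, z] using this
  have hsnd : ∀ i, ∑ k with (x k).1 = i, w k = c⁻¹ := by
    intro i
    have := congrFun (congrArg Prod.snd hyw) i
    simpa [Prod.snd_sum, ← hx, z, Finset.sum_apply, Pi.single_apply, sum_filter, eq_comm] using this
  obtain ⟨F, hF, hle⟩ := exists_choice_norm_sq_le (fun k => (x k).1) (fun k => c * w k)
    (fun k => mul_pos hc (hw k)) (fun k => v (x k).1 (x k).2) (fun k l => hB _ _ _ _) h0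
    (fun i => by rw [← mul_sum, hsnd, mul_inv_cancel₀ hc.ne']) univ
  refine ⟨fun i => (x (F i)).2, ?_⟩
  have e1 : ∑ i, (v (x (F i)).1 (x (F i)).2 - ∑ k with (x k).1 = i,
      (c * w k) • v (x k).1 (x k).2) = ∑ i, v i (x (F i)).2 := by
    rw [sum_sub_distrib, sum_fiberwise univ (fun k => (x k).1)]
    simp only [mul_smul]
    rw [← smul_sum, hfst, smul_zero, sub_zero]
    exact sum_congr rfl fun i _ => by rw [hF i (mem_univ i)]
  rw [e1] at hle
  refine hle.trans (mul_le_mul_of_nonneg_left ?_ (by linarith))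
  have e2 : ∑ i, (#{k | (x k).1 = i} : ℝ) = Fintype.card κ := by
    rw [← Nat.cast_sum, ← card_eq_sum_card_fiberwise (f := fun k => (x k).1) (by simp),
      card_univ]
  rw [sum_sub_distrib, e2]
  simp only [sum_const, card_univ, nsmul_eq_mul, mul_one]
  linarith

end Rounding

section Absorption

open Finset

/-- An integer vector of sum zero is cancelled by transfers of single units. -/
lemma exists_transfers {n : ℕ} (hn : 0 < n) (K : ℕ) (D : Fin n → ℤ) (h0 : ∑ j, D j = 0)
    (hK : ∑ j, (D j).toNat ≤ K) :
    ∃ a b : Fin K → Fin n, ∀ j,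
      D j + ∑ i, ((if j = b i then 1 else 0) - (if j = a i then 1 else 0)) = 0 := by
  classical
  induction K generalizing D with
  | zero =>
    have hD : ∀ j, D j ≤ 0 := by
      intro j
      have := (sum_eq_zero_iff.1 (Nat.le_zero.1 hK)) j (mem_univ j)
      omega
    have := (sum_eq_zero_iff_of_nonpos fun j _ => hD j).1 h0
    exact ⟨Fin.elim0, Fin.elim0, fun j => by simpa using this j (mem_univ j)⟩
  | succ K ih =>
    by_cases hD : ∃ p, 0 < D p
    · obtain ⟨p, hp⟩ := hD
      obtain ⟨q, -, hq⟩ : ∃ q ∈ univ, D q < 0 := by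
        by_contra! h
        have := (sum_eq_zero_iff_of_nonneg h).1 h0 p (mem_univ p)
        omega
      have hpq : p ≠ q := by rintro rfl; omega
      obtain ⟨a, b, hab⟩ := ih
        (fun j => D j + ((if j = q then 1 else 0) - (if j = p then 1 else 0)))
        (by simp [sum_add_distrib, h0]) (by
          have : ∑ j, ((D j + ((if j = q then 1 else 0) - (if j = p then 1 else 0))).toNat
              + if j = p then 1 else 0) ≤ ∑ j, (D j).toNat := by
            refine sum_le_sum fun j _ => ?_
            split_ifs <;> subst_vars <;> omega
          rw [sum_add_distrib, sum_ite_eq' univ p, if_pos (mem_univ p)] at this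
          omega)
      refine ⟨Fin.cons p a, Fin.cons q b, fun j => ?_⟩
      rw [Fin.sum_univ_succ]
      simpa [add_assoc] using hab j
    · push Not at hD
      have := (sum_eq_zero_iff_of_nonpos fun j _ => hD j).1 h0
      exact ⟨fun _ => ⟨0, hn⟩, fun _ => ⟨0, hn⟩, fun j => by simpa using this j (mem_univ j)⟩

lemma sum_toNat_le {n K : ℕ} (D : Fin n → ℤ) (h0 : ∑ j, D j = 0)
    (hD : ((∑ j, D j ^ 2 : ℤ) : ℝ) ≤ 2 * n ^ 2 * (n - 1))
    (hK : (n : ℤ) ^ 3 * (n - 1) < 2 * (K + 1) ^ 2) : ∑ j, (D j).toNat ≤ K := by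
  have hD' : ∑ j, D j ^ 2 ≤ 2 * (n : ℤ) ^ 2 * (n - 1) := by exact_mod_cast hD
  have habs : ∑ j, |D j| = 2 * ((∑ j, (D j).toNat : ℕ) : ℤ) := by
    have : ∀ j ∈ univ, |D j| = 2 * ((D j).toNat : ℤ) - D j := fun j _ => by
      rcases abs_cases (D j) with h | h <;> omega
    rw [sum_congr rfl this, sum_sub_distrib, h0, ← mul_sum]
    push_cast
    ring
  have hcs := sq_sum_le_card_mul_sum_sq (s := univ) (f := fun j => |D j|)
  simp only [sq_abs, card_univ, Fintype.card_fin] at hcs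
  rw [habs] at hcs
  set k := ∑ j, (D j).toNat
  by_contra! h
  have h1 : (K : ℤ) + 1 ≤ k := by exact_mod_cast h
  have h2 : ((K : ℤ) + 1) ^ 2 ≤ (k : ℤ) ^ 2 := by
    have : (0 : ℤ) ≤ K := by positivity
    gcongr
  have h3 : (n : ℤ) * ∑ j, D j ^ 2 ≤ n * (2 * (n : ℤ) ^ 2 * (n - 1)) :=
    mul_le_mul_of_nonneg_left hD' (by positivity)
  nlinarith

lemma ZMod.exists_eq_or_eq_neg_of_ne_zero {n : ℕ} {d : ZMod (2 * n + 1)} (hd : d ≠ 0) :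
    ∃ j : Fin n, d = ((j + 1 : ℕ) : ZMod (2 * n + 1)) ∨ d = -((j + 1 : ℕ) : ZMod (2 * n + 1)) := by
  have h1 : d.val ≠ 0 := by simpa using hd
  have h2 := d.val_lt
  by_cases h : d.val ≤ n
  · refine ⟨⟨d.val - 1, by omega⟩, Or.inl ?_⟩
    rw [show d.val - 1 + 1 = d.val by omega, ZMod.natCast_zmod_val]
  · refine ⟨⟨2 * n - d.val, by omega⟩, Or.inr ?_⟩
    rw [eq_neg_iff_add_eq_zero]
    nth_rw 1 [← ZMod.natCast_zmod_val d]
    rw [← Nat.cast_add, show d.val + (2 * n - d.val + 1) = 2 * n + 1 by omega, ZMod.natCast_self]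

lemma sum_diffCount_succ {n : ℕ} {T : SimpleGraph (Fin (2 * n + 1))} (hT : T.IsTree)
    (f : Fin (2 * n + 1) ≃ ZMod (2 * n + 1)) :
    ∑ j : Fin n, diffCount T f ((j + 1 : ℕ) : ZMod (2 * n + 1)) = 2 * n := by
  classical
  let g : ZMod (2 * n + 1) → ℕ := diffCount T f
  have h0 : g 0 = 0 := by
    simp only [g, diffCount, card_eq_zero, filter_eq_empty_iff]
    rintro ⟨u, v⟩ - ⟨h, h'⟩
    exact h.ne (f.injective (sub_eq_zero.1 h'))
  have htot : ∑ d, g d = 4 * n := by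
    have : ∑ d, g d = #{p : Fin (2 * n + 1) × Fin (2 * n + 1) | T.Adj p.1 p.2} := by
      rw [card_eq_sum_card_fiberwise (f := fun p => f p.1 - f p.2) (t := univ) (by simp)]
      refine sum_congr rfl fun d _ => ?_
      rw [filter_filter]
      simp only [g, diffCount]
      congr
    rw [this, card_adj_of_isTree hT, Fintype.card_fin]
    omega
  have hrange : ∑ d, g d = ∑ i ∈ range (2 * n + 1), g (i : ℕ) :=
    sum_nbij' ZMod.val (fun i => (i : ZMod (2 * n + 1))) (fun d _ => mem_range.2 d.val_lt)
      (fun _ _ => mem_univ _) (fun d _ => ZMod.natCast_zmod_val d)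
      (fun i hi => ZMod.val_cast_of_lt (mem_range.1 hi))
      (fun d _ => by rw [ZMod.natCast_zmod_val])
  have hsplit : ∀ G : ℕ → ℕ, ∑ i ∈ range (2 * n + 1), G i =
      ∑ i ∈ range n, G (i + 1) + ∑ i ∈ range n, G (n + i + 1) + G 0 := fun G => by
    rw [sum_range_succ', two_mul, sum_range_add]
  rw [htot, hsplit (fun i => g (i : ℕ)), Nat.cast_zero, h0] at hrange
  have hrefl : ∑ i ∈ range n, g ((n + i + 1 : ℕ) : ZMod (2 * n + 1)) =
      ∑ i ∈ range n, g ((i + 1 : ℕ) : ZMod (2 * n + 1)) := by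
    rw [← sum_range_reflect]
    refine sum_congr rfl fun i hi => ?_
    have hi := mem_range.1 hi
    have : ((n + (n - 1 - i) + 1 : ℕ) : ZMod (2 * n + 1)) =
        -((i + 1 : ℕ) : ZMod (2 * n + 1)) := by
      rw [eq_neg_iff_add_eq_zero, ← Nat.cast_add,
        show n + (n - 1 - i) + 1 + (i + 1) = 2 * n + 1 by omega, ZMod.natCast_self]
    rw [this]
    exact diffCount_neg T f _
  have := Fin.sum_univ_eq_sum_range (fun i => g ((i + 1 : ℕ) : ZMod (2 * n + 1))) n
  simp only [g] at *
  omega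

/-- Labellings of a family of trees with small total deviation from the mean. -/
lemma exists_labellings_small_deviation {n : ℕ} (hn : 0 < n) {ι : Type*} [Fintype ι]
    (rep : ι → SimpleGraph (Fin (2 * n + 1))) (hrep : ∀ q, (rep q).IsTree) :
    ∃ F : ι → Fin (2 * n + 1) ≃ ZMod (2 * n + 1),
      ((∑ j : Fin n, (∑ q, ((diffCount (rep q) (F q) ((j + 1 : ℕ) : ZMod (2 * n + 1)) : ℤ) - 2)) ^ 2 :
        ℤ) : ℝ) ≤ 2 * n ^ 2 * (n - 1) := by
  classical
  let e : Fin (2 * n + 1) ≃ ZMod (2 * n + 1) := Fintype.equivOfCardEq (by simp [ZMod.card])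
  have : Nonempty (Fin (2 * n + 1) ≃ ZMod (2 * n + 1)) := ⟨e⟩
  let c : ι → (Fin (2 * n + 1) ≃ ZMod (2 * n + 1)) → Fin n → ℝ := fun q f j =>
    (diffCount (rep q) f ((j + 1 : ℕ) : ZMod (2 * n + 1)) : ℝ)
  have hc : ∀ q f, ∑ j, c q f j = 2 * n := fun q f => by
    have := congrArg (Nat.cast : ℕ → ℝ) (sum_diffCount_succ (hrep q) f)
    rw [Nat.cast_sum] at this
    simpa [c] using this
  have hc0 : ∀ q f j, 0 ≤ c q f j := fun q f j => Nat.cast_nonneg _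
  have hcsq : ∀ q f, ∑ j, c q f j ^ 2 ≤ (2 * n) ^ 2 := fun q f => by
    rw [sq (2 * (n : ℝ)), ← hc q f, sum_mul]
    refine sum_le_sum fun j _ => ?_
    rw [sq]
    exact mul_le_mul_of_nonneg_left (single_le_sum (fun j _ => hc0 q f j) (mem_univ j)) (hc0 q f j)
  obtain ⟨F, h⟩ := exists_small_sum hn (fun q f => WithLp.toLp 2 fun j => c q f j - 2)
    (B := 8 * n ^ 2) (fun q f => by simp [sum_sub_distrib, hc, mul_comm])
    (fun q => by
      ext j
      have hd : ((j + 1 : ℕ) : ZMod (2 * n + 1)) ≠ 0 := by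
        rw [Ne, ZMod.natCast_eq_zero_iff]
        exact Nat.not_dvd_of_pos_of_lt (by omega) (by omega)
      have := sum_diffCount (by simp; omega) (hrep q) e hd
      simp only [WithLp.ofLp_sum, Finset.sum_apply, sum_sub_distrib, sum_const, card_univ, c]
      rw [← Nat.cast_sum, this]
      simp [mul_comm]) (by positivity)
    (fun q f q' f' => by
      rw [EuclideanSpace.norm_sq_eq]
      have : ∀ j ∈ univ, ‖(WithLp.toLp 2 (fun j => c q f j - 2) -
          WithLp.toLp 2 fun j => c q' f' j - 2 : EuclideanSpace ℝ (Fin n)) j‖ ^ 2 ≤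
            c q f j ^ 2 + c q' f' j ^ 2 := fun j _ => by
        simp only [PiLp.sub_apply, Real.norm_eq_abs, sq_abs]
        nlinarith [mul_nonneg (hc0 q f j) (hc0 q' f' j)]
      refine (sum_le_sum this).trans ?_
      rw [sum_add_distrib]
      linarith [hcsq q f, hcsq q' f'])
  refine ⟨F, le_trans (le_of_eq ?_) (h.trans (le_of_eq (by ring)))⟩
  rw [EuclideanSpace.norm_sq_eq]
  simp [c]

variable {n K : ℕ}

/-- Enough pairwise non-isomorphic trees that can transfer one unit between any two difference
classes allow balancing all tree classes simultaneously. -/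
lemma exists_balanced_labellings (hn : 0 < n)
    (hK : (n : ℤ) ^ 3 * (n - 1) < 2 * (K + 1) ^ 2)
    (U : Fin K → SimpleGraph (Fin (2 * n + 1)))
    (huniv : ∀ i, ∀ a b : Fin n, ∃ f : Fin (2 * n + 1) ≃ ZMod (2 * n + 1), ∀ j : Fin n,
      diffCount (U i) f ((j + 1 : ℕ) : ZMod (2 * n + 1)) + (if j = a then 1 else 0) =
        2 + if j = b then 1 else 0)
    {Q : Type*} [Fintype Q] (rep : Q → SimpleGraph (Fin (2 * n + 1)))
    (hrep : ∀ q, (rep q).IsTree) (u : Fin K → Q) (hu : Function.Injective u)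
    (hiso : ∀ i, Nonempty (rep (u i) ≃g U i)) :
    ∃ F : Q → Fin (2 * n + 1) ≃ ZMod (2 * n + 1),
      ∀ d ≠ 0, ∑ q, diffCount (rep q) (F q) d = 2 * Fintype.card Q := by
  classical
  let c : Q → (Fin (2 * n + 1) ≃ ZMod (2 * n + 1)) → Fin n → ℤ := fun q f j =>
    (diffCount (rep q) f ((j + 1 : ℕ) : ZMod (2 * n + 1)) : ℤ) - 2
  have hcsum : ∀ q f, ∑ j, c q f j = 0 := fun q f => by
    have := sum_diffCount_succ (hrep q) f
    simp only [c, sum_sub_distrib]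
    rw [← Nat.cast_sum, this]
    simp [mul_comm]
  obtain ⟨F₀, hF₀⟩ := exists_labellings_small_deviation hn
    (fun q : {q : Q // q ∉ Set.range u} => rep q.1) (fun q => hrep q.1)
  have hF₀sum : ∑ j, ∑ q, c (Subtype.val q) (F₀ q) j = 0 := by
    rw [sum_comm]
    exact sum_eq_zero fun q _ => hcsum _ _
  obtain ⟨a, b, hab⟩ := exists_transfers hn K _ hF₀sum (sum_toNat_le _ hF₀sum hF₀ hK)
  have hF : ∀ q : Q, ∃ f, (∀ h, f = F₀ ⟨q, h⟩) ∧ ∀ i, u i = q → ∀ j,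
      c q f j = (if j = b i then 1 else 0) - (if j = a i then 1 else 0) := by
    intro q
    by_cases h : q ∈ Set.range u
    · obtain ⟨i, rfl⟩ := h
      obtain ⟨φ⟩ := hiso i
      obtain ⟨f, hf⟩ := huniv i (a i) (b i)
      refine ⟨φ.toEquiv.trans f, fun h => (h ⟨i, rfl⟩).elim, fun i' hi' j => ?_⟩
      obtain rfl := hu hi'
      simp only [c]
      rw [diffCount_iso φ f]
      have h3 := congrArg (Nat.cast : ℕ → ℤ) (hf j)
      simp only [Nat.cast_add (R := ℤ) (diffCount _ _ _), Nat.cast_add (R := ℤ) 2, Nat.cast_ite,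
        Nat.cast_one, Nat.cast_zero, Nat.cast_ofNat] at h3
      linarith
    · exact ⟨F₀ ⟨q, h⟩, fun _ => rfl, fun i hi => (h ⟨i, hi⟩).elim⟩
  choose F hF₁ hF₂ using hF
  have hzero : ∀ j, ∑ q, c q (F q) j = 0 := by
    intro j
    rw [← Fintype.sum_subtype_add_sum_subtype (fun q => q ∈ Set.range u), ← hab j, add_comm]
    congr 1
    · exact Fintype.sum_congr _ _ fun q => by rw [hF₁ q.1 q.2]
    · convert (Fintype.sum_equiv (Equiv.ofInjective u hu)
        (fun i => (if j = b i then 1 else 0) - (if j = a i then 1 else 0))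
        (fun q => c q.1 (F q.1) j) fun i => (hF₂ _ i rfl j).symm).symm
  have key : ∀ j : Fin n, ∑ q, diffCount (rep q) (F q) ((j + 1 : ℕ) : ZMod (2 * n + 1)) =
      2 * Fintype.card Q := by
    intro j
    have := hzero j
    simp only [c, sum_sub_distrib] at this
    rw [← Nat.cast_sum] at this
    simp only [sum_const, card_univ, nsmul_eq_mul] at this
    omega
  refine ⟨F, fun d hd => ?_⟩
  obtain ⟨j, rfl | rfl⟩ := ZMod.exists_eq_or_eq_neg_of_ne_zero hd
  · exact key j
  · simpa only [diffCount_neg] using key j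

theorem exists_decomposition_of_universal (hn : 0 < n)
    (hK : (n : ℤ) ^ 3 * (n - 1) < 2 * (K + 1) ^ 2)
    (U : Fin K → SimpleGraph (Fin (2 * n + 1))) (hU : ∀ i, (U i).IsTree)
    (hinj : ∀ i i', Nonempty (U i ≃g U i') → i = i')
    (huniv : ∀ i, ∀ a b : Fin n, ∃ f : Fin (2 * n + 1) ≃ ZMod (2 * n + 1), ∀ j : Fin n,
      diffCount (U i) f ((j + 1 : ℕ) : ZMod (2 * n + 1)) + (if j = a then 1 else 0) =
        2 + if j = b then 1 else 0) :
    ∃ M : Multiset (SimpleGraph (Fin (2 * n + 1))),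
      (∀ G ∈ M, G.IsTree) ∧
      (∀ T : SimpleGraph (Fin (2 * n + 1)), T.IsTree →
        countP' (fun G => Nonempty (G ≃g T)) M = 2 * n + 1) ∧
      (∀ a b : Fin (2 * n + 1), a ≠ b →
        countP' (fun G => G.Adj a b) M = 2 * tau (2 * n + 1)) := by
  classical
  let Tr := {T : SimpleGraph (Fin (2 * n + 1)) // T.IsTree}
  let r : Tr → Tr → Prop := fun G H => Nonempty (G.1 ≃g H.1)
  have hr : Equivalence r :=
    ⟨fun G => ⟨SimpleGraph.Iso.refl⟩, fun ⟨φ⟩ => ⟨φ.symm⟩, fun ⟨φ⟩ ⟨ψ⟩ => ⟨φ.trans ψ⟩⟩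
  have hexact : ∀ G H : Tr, Quot.mk r G = Quot.mk r H → r G H := fun G H h =>
    hr.eqvGen_iff.1 (Quot.eqvGen_exact h)
  have : Fintype (Quot r) := Fintype.ofFinite _
  have htau : tau (2 * n + 1) = Fintype.card (Quot r) := Nat.card_eq_fintype_card
  have hmk : ∀ T : Tr, r (Quot.mk r T).out T := fun T => hexact _ _ (Quot.out_eq _)
  obtain ⟨F, hF⟩ := exists_balanced_labellings hn hK U huniv (fun q : Quot r => q.out.1)
    (fun q => q.out.2) (fun i => Quot.mk r ⟨U i, hU i⟩)
    (fun i i' h => hinj i i' (hexact _ _ h)) (fun i => hmk ⟨U i, hU i⟩)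
  obtain ⟨M, h1, h2, h3⟩ := exists_decomposition_of_labellings
    (Fintype.equivOfCardEq (by simp [ZMod.card])) _ (fun q : Quot r => q.out.2)
    (fun T hT => ⟨Quot.mk r ⟨T, hT⟩, hmk ⟨T, hT⟩⟩)
    (fun q q' (h : r q.out q'.out) => by
      rw [← Quot.out_eq q, ← Quot.out_eq q']
      exact Quot.sound h) F hF
  refine ⟨M, h1, fun T hT => ?_, fun x y hxy => ?_⟩
  · rw [h2 T hT, ZMod.card]
  · rw [h3 x y hxy, htau]

end Absorption

section ParentTree

open Finset

variable {k : ℕ} {par : Fin (k + 1) → Fin (k + 1)}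

/-- The graph on `Fin (k + 1)` in which every `v ≠ 0` is joined to `par v`. -/
def parentTree (par : Fin (k + 1) → Fin (k + 1)) : SimpleGraph (Fin (k + 1)) :=
  SimpleGraph.fromRel fun u v => v ≠ 0 ∧ par v = u

lemma parentTree_adj (hpar : ∀ v ≠ 0, par v < v) {u v : Fin (k + 1)} :
    (parentTree par).Adj u v ↔ (v ≠ 0 ∧ par v = u) ∨ (u ≠ 0 ∧ par u = v) := by
  rw [parentTree, SimpleGraph.fromRel_adj, and_iff_right_iff_imp]
  rintro (⟨h, rfl⟩ | ⟨h, rfl⟩)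
  exacts [(hpar _ h).ne, (hpar _ h).ne']

lemma isTree_parentTree (hpar : ∀ v ≠ 0, par v < v) : (parentTree par).IsTree := by
  classical
  have hreach : ∀ v, (parentTree par).Reachable v 0 := by
    intro v
    induction v using WellFoundedLT.induction with
    | _ v ih =>
      by_cases hv : v = 0
      · rw [hv]
      · exact ((parentTree_adj hpar).2 (.inr ⟨hv, rfl⟩)).reachable.trans (ih _ (hpar v hv))
  have hconn : (parentTree par).Connected := ⟨fun u v => (hreach u).trans (hreach v).symm⟩
  refine SimpleGraph.isTree_iff_connected_and_card.2 ⟨hconn, le_antisymm ?_ ?_⟩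
  · have hsub : (parentTree par).edgeFinset ⊆ (univ.erase 0).image fun v => s(v, par v) := by
      intro e
      induction e with
      | _ u v =>
        rw [SimpleGraph.mem_edgeFinset, SimpleGraph.mem_edgeSet, parentTree_adj hpar, mem_image]
        rintro (⟨h, rfl⟩ | ⟨h, rfl⟩)
        · exact ⟨v, by simpa using h, Sym2.eq_swap⟩
        · exact ⟨u, by simpa using h, rfl⟩
    rw [Nat.card_eq_fintype_card, ← SimpleGraph.edgeFinset_card, Nat.card_eq_fintype_card,
      Fintype.card_fin]
    have := (card_le_card hsub).trans card_image_le
    rw [card_erase_of_mem (mem_univ _), card_univ, Fintype.card_fin] at this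
    omega
  · exact hconn.card_vert_le_card_edgeSet_add_one

lemma parentTree_indicator (hpar : ∀ v ≠ 0, par v < v) (u v : Fin (k + 1)) (p : Prop)
    [Decidable p] [Decidable ((parentTree par).Adj u v ∧ p)] :
    (if (parentTree par).Adj u v ∧ p then 1 else 0) =
      (if par v = u then (if v ≠ 0 ∧ p then 1 else 0) else 0) +
        if par u = v then (if u ≠ 0 ∧ p then 1 else 0) else 0 := by
  have h := parentTree_adj hpar (u := u) (v := v)
  have hu := hpar u
  have hv := hpar v
  by_cases h1 : par v = u <;> by_cases h2 : par u = v <;> by_cases h3 : v = 0 <;>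
    by_cases h4 : u = 0 <;> by_cases hp : p <;> simp_all
  exact lt_asymm hu hv

lemma diffCount_parentTree {A : Type*} [AddCommGroup A] [DecidableEq A]
    (hpar : ∀ v ≠ 0, par v < v) (f : Fin (k + 1) ≃ A) (d : A) :
    diffCount (parentTree par) f d = ∑ v : Fin (k + 1), if v ≠ 0 then
      ((if f v - f (par v) = d then 1 else 0) + if -(f v - f (par v)) = d then 1 else 0) else 0 := by
  classical
  unfold diffCount
  rw [card_filter, Fintype.sum_prod_type]
  simp only [parentTree_indicator hpar, sum_add_distrib]
  rw [sum_comm]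
  simp only [sum_ite_eq, mem_univ, if_true, ← sum_add_distrib]
  refine sum_congr rfl fun v _ => ?_
  by_cases hv : v = 0 <;> simp [hv, add_comm]

lemma card_adj_parentTree (hpar : ∀ v ≠ 0, par v < v) (v : Fin (k + 1))
    [DecidablePred ((parentTree par).Adj v)] :
    #{u | (parentTree par).Adj v u} = #{u | u ≠ 0 ∧ par u = v} + if v = 0 then 0 else 1 := by
  classical
  rw [card_filter, card_filter]
  have h : ∀ u, (if (parentTree par).Adj v u then 1 else 0) =
      if (parentTree par).Adj v u ∧ True then 1 else 0 := fun u => by simp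
  simp only [h, parentTree_indicator hpar, sum_add_distrib]
  congr 1
  · exact sum_congr rfl fun u _ => by by_cases h0 : u = 0 <;> simp [h0]
  · rw [sum_ite_eq]
    by_cases hv : v = 0 <;> simp [hv]

/-- An isomorphism invariant encoding the degree sequence. -/
noncomputable def degreeCode {V : Type*} [Fintype V] (T : SimpleGraph V) : ℕ :=
  open Classical in ∑ v, 32 ^ #{u | T.Adj v u}

lemma degreeCode_congr {V : Type*} [Fintype V] {T T' : SimpleGraph V} (φ : T ≃g T') :
    degreeCode T = degreeCode T' := by
  classical
  unfold degreeCode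
  refine Fintype.sum_equiv φ.toEquiv _ _ fun v => ?_
  congr 1
  refine card_equiv φ.toEquiv fun u => ?_
  simpa using φ.map_adj_iff.symm

end ParentTree

section Certificate

open Finset

/-- The distance from `y` to `0` in the cyclic group of order `m`. -/
def cyclicNorm (m y : ℕ) : ℕ := min y (m - y)

lemma cyclicNorm_indicator {n y z j : ℕ} (hy : y < 2 * n + 1) (hz : z < 2 * n + 1) (hj : j < n) :
    ((if (y : ZMod (2 * n + 1)) - z = (j + 1 : ℕ) then 1 else 0) +
      if -((y : ZMod (2 * n + 1)) - z) = (j + 1 : ℕ) then 1 else 0) =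
      if cyclicNorm (2 * n + 1) (Nat.dist y z) = j + 1 then 1 else 0 := by
  have key : ∀ {y z : ℕ}, y < 2 * n + 1 → z < 2 * n + 1 →
      ((y : ZMod (2 * n + 1)) - z = (j + 1 : ℕ) ↔ y = z + (j + 1) ∨ y + (2 * n + 1) = z + (j + 1)) := by
    intro y z hy hz
    rw [sub_eq_iff_eq_add, ← Nat.cast_add, ZMod.natCast_eq_natCast_iff', Nat.mod_eq_of_lt hy]
    rcases lt_or_ge (j + 1 + z) (2 * n + 1) with h | h
    · rw [Nat.mod_eq_of_lt h]
      omega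
    · rw [Nat.mod_eq_sub_mod h, Nat.mod_eq_of_lt (by omega)]
      omega
  rw [neg_sub]
  have h : cyclicNorm (2 * n + 1) (Nat.dist y z) = j + 1 ↔
      (y = z + (j + 1) ∨ y + (2 * n + 1) = z + (j + 1)) ∨
        (z = y + (j + 1) ∨ z + (2 * n + 1) = y + (j + 1)) := by
    simp only [cyclicNorm, Nat.dist]
    omega
  simp only [key hy hz, key hz hy, h]
  have h' : ¬ ((y = z + (j + 1) ∨ y + (2 * n + 1) = z + (j + 1)) ∧
      (z = y + (j + 1) ∨ z + (2 * n + 1) = y + (j + 1))) := by omega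
  by_cases hp : y = z + (j + 1) ∨ y + (2 * n + 1) = z + (j + 1)
  · rw [if_neg (fun hq => h' ⟨hp, hq⟩), if_pos hp, if_pos (.inl hp)]
  · simp only [hp, if_false, false_or, zero_add]

/-- The parents of `0, …, 2 * n` in the tree with core `ps`: the root `0` has the leaf path
`0, 1, 2`, the vertices `3 + i` have the parents listed in `ps`, and the others hang from `0`. -/
def fullParents (n : ℕ) (ps : List ℕ) : List ℕ :=
  0 :: 0 :: 1 :: (ps ++ List.replicate (2 * n - 2 - ps.length) 0)

/-- The tree of order `2 * n + 1` with core `ps`. -/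
def coreTree (n : ℕ) (ps : List ℕ) : SimpleGraph (Fin (2 * n + 1)) :=
  parentTree fun v => Fin.ofNat (2 * n + 1) ((fullParents n ps).getD v 0)

/-- `ps` lists the parents of the vertices `3, 4, …` of a rooted forest. -/
def IsCore (n : ℕ) (ps : List ℕ) : Prop :=
  ps.length + 3 ≤ 2 * n + 1 ∧
    ∀ i ∈ List.range ps.length, ps.getD i 0 < i + 3 ∧ (ps.getD i 0 = 0 ∨ 3 ≤ ps.getD i 0)

instance (n : ℕ) (ps : List ℕ) : Decidable (IsCore n ps) := by
  unfold IsCore; infer_instance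

/-- The labels `ls ⊆ W` of the core are distinct, and replacing parent edges by edges to the
root does not change the multiset of edge lengths. -/
def IsBalanced (n : ℕ) (ps W ls : List ℕ) : Prop :=
  (∀ l ∈ ls, l ∈ W ∧ 0 < l ∧ l < 2 * n + 1) ∧ ls.length = ps.length ∧ ls.Nodup ∧
    ((List.range ps.length).map fun i => cyclicNorm (2 * n + 1)
      (Nat.dist (ls.getD i 0) ((0 :: 0 :: 0 :: ls).getD (ps.getD i 0) 0))).Perm
    ((List.range ps.length).map fun i => cyclicNorm (2 * n + 1) (ls.getD i 0))

instance (n : ℕ) (ps W ls : List ℕ) : Decidable (IsBalanced n ps W ls) := by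
  unfold IsBalanced; infer_instance

/-- `q` and `x` avoid `W`, and `x`, `x - q` have lengths `a + 1` and `b + 1`. -/
def IsPath (n a b : ℕ) (W : List ℕ) (x q : ℕ) : Prop :=
  0 < q ∧ q < 2 * n + 1 ∧ x < 2 * n + 1 ∧ cyclicNorm (2 * n + 1) x = a + 1 ∧
    cyclicNorm (2 * n + 1) (Nat.dist x q) = b + 1 ∧ x ∉ W ∧ q ∉ W

instance (n a b : ℕ) (W : List ℕ) (x q : ℕ) : Decidable (IsPath n a b W x q) := by
  unfold IsPath; infer_instance

/-- Every pair of lengths is realised by a path avoiding some member of `Ws`. -/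
def IsCovering (n : ℕ) (Ws : List (List ℕ)) : Prop :=
  ∀ a ∈ List.range n, ∀ b ∈ List.range n, ∃ W ∈ Ws, ∃ x ∈ [a + 1, 2 * n - a],
    ∃ q ∈ [(x + b + 1) % (2 * n + 1), (x + 2 * n - b) % (2 * n + 1)], IsPath n a b W x q

instance (n : ℕ) (Ws : List (List ℕ)) : Decidable (IsCovering n Ws) := by
  unfold IsCovering; infer_instance

/-- The value of `degreeCode` on `coreTree n ps`. -/
def coreCode (n : ℕ) (ps : List ℕ) : ℕ :=
  ((List.range (2 * n + 1)).map fun v =>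
    32 ^ ((fullParents n ps).tail.count v + if v = 0 then 0 else 1)).sum

/-- A list of cores with balanced labellings certifying that the trees are universal. -/
def IsCertificate (n : ℕ) (Ws : List (List (List ℕ)))
    (cores : List (List ℕ × List (List ℕ))) : Prop :=
  (∀ W ∈ Ws, IsCovering n W) ∧
  (∀ c ∈ cores, IsCore n c.1 ∧ ∃ W ∈ Ws, ∀ w ∈ W, ∃ ls ∈ c.2, IsBalanced n c.1 w ls) ∧
  (cores.map fun c => coreCode n c.1).IsChain (· < ·)

instance (n : ℕ) (Ws : List (List (List ℕ))) (cores : List (List ℕ × List (List ℕ))) :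
    Decidable (IsCertificate n Ws cores) := by
  unfold IsCertificate; infer_instance

variable {n : ℕ} {ps : List ℕ}

lemma length_fullParents (h : IsCore n ps) : (fullParents n ps).length = 2 * n + 1 := by
  have := h.1
  simp [fullParents]
  omega

lemma getD_fullParents_add_three (i : ℕ) : (fullParents n ps).getD (i + 3) 0 = ps.getD i 0 := by
  simp only [fullParents, List.getD_cons_succ]
  rcases lt_or_ge i ps.length with hi | hi
  · rw [List.getD_append _ _ _ _ hi]
  · rw [List.getD_append_right _ _ _ _ hi, List.getD_eq_default _ _ hi]
    simp [List.getD_eq_getElem?_getD, List.getElem?_replicate]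
    split_ifs <;> rfl

lemma getD_fullParents_lt (h : IsCore n ps) : ∀ v ≠ 0, (fullParents n ps).getD v 0 < v
  | 0, hv => (hv rfl).elim
  | 1, _ => by simp [fullParents]
  | 2, _ => by simp [fullParents]
  | i + 3, _ => by
    rw [getD_fullParents_add_three]
    rcases lt_or_ge i ps.length with hi | hi
    · exact (h.2 i (List.mem_range.2 hi)).1
    · rw [List.getD_eq_default _ _ hi]
      omega

lemma val_ofNat_getD_fullParents (h : IsCore n ps) (v : Fin (2 * n + 1)) :
    (Fin.ofNat (2 * n + 1) ((fullParents n ps).getD v 0)).val = (fullParents n ps).getD v 0 := by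
  refine Nat.mod_eq_of_lt ?_
  by_cases hv : v.1 = 0
  · simp [hv, fullParents]
  · exact (getD_fullParents_lt h v hv).trans v.2

lemma coreTree_par_lt (h : IsCore n ps) (v : Fin (2 * n + 1)) (hv : v ≠ 0) :
    Fin.ofNat (2 * n + 1) ((fullParents n ps).getD v 0) < v := by
  rw [Fin.lt_def, val_ofNat_getD_fullParents h]
  exact getD_fullParents_lt h v (Fin.val_ne_zero_iff.2 hv)

lemma isTree_coreTree (h : IsCore n ps) : (coreTree n ps).IsTree :=
  isTree_parentTree (coreTree_par_lt h)

lemma degreeCode_coreTree (h : IsCore n ps) : degreeCode (coreTree n ps) = coreCode n ps := by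
  classical
  have hlen := length_fullParents h
  have htail : (fullParents n ps).tail =
      (List.range (2 * n)).map fun u => (fullParents n ps).getD (u + 1) 0 := by
    refine List.ext_getElem (by simp [hlen]) fun i hi _ => ?_
    rw [List.length_tail, hlen] at hi
    rw [List.getElem_tail, List.getElem_map, List.getElem_range, List.getD_eq_getElem _ _ (by omega)]
  unfold degreeCode coreTree coreCode
  simp only [card_adj_parentTree (coreTree_par_lt h)]
  change _ = ∑ v ∈ range (2 * n + 1), _
  rw [sum_range]
  refine sum_congr rfl fun v _ => ?_
  have hcount : #{u : Fin (2 * n + 1) | u ≠ 0 ∧ Fin.ofNat (2 * n + 1) ((fullParents n ps).getD u 0) = v} =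
      (fullParents n ps).tail.count v.1 := by
    rw [htail, List.count, List.countP_map, List.countP_eq_length_filter]
    change _ = #((range (2 * n)).filter _)
    rw [card_filter, card_filter, sum_range, Fin.sum_univ_succ, if_neg (by simp), zero_add]
    refine sum_congr rfl fun u _ => if_congr ?_ rfl rfl
    rw [Fin.ext_iff, val_ofNat_getD_fullParents h]
    simp [Fin.succ_ne_zero]
  rw [hcount]
  congr 2
  exact if_congr Fin.val_eq_zero_iff.symm rfl rfl

lemma sum_length_coreTree (h : IsCore n ps) {W ls : List ℕ} (hls : IsBalanced n ps W ls)
    {x q : ℕ} {l : ℕ → ℕ} (hl : ∀ v < ps.length + 3, l v = (0 :: q :: x :: ls).getD v 0)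
    (I : ℕ → ℕ) :
    ∑ v ∈ range (2 * n + 1), I (cyclicNorm (2 * n + 1)
        (Nat.dist (l v) (l ((fullParents n ps).getD v 0)))) + I (cyclicNorm (2 * n + 1) x) =
      ∑ v ∈ range (2 * n + 1), I (cyclicNorm (2 * n + 1) (l v)) +
        I (cyclicNorm (2 * n + 1) (Nat.dist x q)) := by
  obtain ⟨r, hr⟩ := Nat.exists_eq_add_of_le h.1
  have h0 : l 0 = 0 := hl 0 (by omega)
  have h1 : l 1 = q := hl 1 (by omega)
  have h2 : l 2 = x := hl 2 (by omega)
  have h3 : ∀ i < ps.length, l (i + 3) = ls.getD i 0 := fun i hi => hl _ (by omega)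
  have hcore : ∑ i ∈ range ps.length, I (cyclicNorm (2 * n + 1)
        (Nat.dist (l (i + 3)) (l ((fullParents n ps).getD (i + 3) 0)))) =
      ∑ i ∈ range ps.length, I (cyclicNorm (2 * n + 1) (l (i + 3))) := by
    have := (hls.2.2.2.map I).sum_eq
    rw [List.map_map, List.map_map] at this
    change ∑ i ∈ range ps.length, _ = ∑ i ∈ range ps.length, _ at this
    refine Eq.trans (sum_congr rfl fun i hi => ?_) (this.trans (sum_congr rfl fun i hi => ?_))
    · have hi := mem_range.1 hi
      obtain ⟨hlt, hp⟩ := h.2 i (List.mem_range.2 hi)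
      rw [getD_fullParents_add_three, h3 i hi, hl _ (by omega), Function.comp_apply]
      obtain hp | hp := hp
      · rw [hp]
        rfl
      · obtain ⟨p, hp⟩ := Nat.exists_eq_add_of_le' hp
        rw [hp]
        rfl
    · rw [h3 i (mem_range.1 hi), Function.comp_apply]
  have hleaf : ∀ i, (fullParents n ps).getD (ps.length + 3 + i) 0 = 0 := fun i => by
    rw [add_right_comm, getD_fullParents_add_three, List.getD_eq_default _ _ (Nat.le_add_right _ _)]
  have hP1 : (fullParents n ps).getD 1 0 = 0 := rfl
  have hP2 : (fullParents n ps).getD 2 0 = 1 := rfl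
  have hP0 : (fullParents n ps).getD 0 0 = 0 := rfl
  have hd : ∀ y, Nat.dist y 0 = y := Nat.dist_zero_right
  rw [hr, sum_range_add, sum_range_add _ (ps.length + 3) r, ← hr]
  simp only [sum_range_succ', hleaf, hcore, zero_add, Nat.reduceAdd, h0, h1, h2, hP0, hP1, hP2, hd]
  ring

lemma exists_labelling_coreTree (h : IsCore n ps) {W : List ℕ} {ls : List ℕ}
    (hls : IsBalanced n ps W ls) {a b x q : ℕ} (hxq : IsPath n a b W x q) :
    ∃ f : Fin (2 * n + 1) ≃ ZMod (2 * n + 1), ∀ j < n,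
      diffCount (coreTree n ps) f ((j + 1 : ℕ) : ZMod (2 * n + 1)) + (if j = a then 1 else 0) =
        2 + if j = b then 1 else 0 := by
  classical
  obtain ⟨hlW, hlen, hnd, hperm⟩ := hls
  obtain ⟨hq0, hq, hx, hxa, hxb, hxW, hqW⟩ := hxq
  have hps := h.1
  have hx0 : 0 < x := Nat.pos_of_ne_zero fun h0 => by simp [h0, cyclicNorm] at hxa
  have hxq : x ≠ q := fun h0 => by simp [h0, cyclicNorm] at hxb
  set L : List ℕ := 0 :: q :: x :: ls with hL
  have hLnd : L.Nodup := by
    simp only [hL, List.nodup_cons, List.mem_cons, not_or]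
    exact ⟨⟨hq0.ne, hx0.ne, fun h0 => (hlW 0 h0).2.1.ne rfl⟩,
      ⟨hxq.symm, fun h0 => hqW (hlW q h0).1⟩, fun h0 => hxW (hlW x h0).1, hnd⟩
  have hLlt : ∀ l ∈ L, l < 2 * n + 1 := by
    simp only [hL, List.mem_cons]
    rintro l (rfl | rfl | rfl | hl)
    exacts [by omega, hq, hx, (hlW l hl).2.2]
  have hLlen : L.length = ps.length + 3 := by simp [hL, hlen]
  have hget : ∀ v, L.getD v 0 < 2 * n + 1 := fun v => by
    rcases lt_or_ge v L.length with hv | hv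
    · rw [List.getD_eq_getElem _ _ hv]
      exact hLlt _ (List.getElem_mem hv)
    · rw [List.getD_eq_default _ _ hv]
      omega
  have hinj : Set.InjOn (fun v : Fin (2 * n + 1) => ((L.getD v 0 : ℕ) : ZMod (2 * n + 1)))
      {v | v.1 < L.length} := by
    intro u hu v hv huv
    simp only [ZMod.natCast_eq_natCast_iff', Nat.mod_eq_of_lt (hget _)] at huv
    rw [List.getD_eq_getElem _ _ hu, List.getD_eq_getElem _ _ hv] at huv
    exact Fin.ext ((hLnd.getElem_inj_iff).1 huv)
  obtain ⟨g, hg⟩ := Finset.exists_equiv_extend_of_card_eq (t := (univ : Finset (ZMod (2 * n + 1))))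
    (by simp [ZMod.card]) (s := univ.filter fun v : Fin (2 * n + 1) => v.1 < L.length) (subset_univ _)
    (by simpa using hinj)
  let f : Fin (2 * n + 1) ≃ ZMod (2 * n + 1) := g.trans (Equiv.subtypeUnivEquiv mem_univ)
  have hf : ∀ v : Fin (2 * n + 1), v.1 < L.length → f v = (L.getD v 0 : ℕ) := fun v hv =>
    hg v (by simpa using hv)
  let l : ℕ → ℕ := fun v => (f (Fin.ofNat (2 * n + 1) v)).val
  have hlf : ∀ v : Fin (2 * n + 1), ((l v : ℕ) : ZMod (2 * n + 1)) = f v := fun v => by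
    simp only [l, Fin.ofNat_val_eq_self, ZMod.natCast_zmod_val]
  have hllt : ∀ v, l v < 2 * n + 1 := fun v => ZMod.val_lt _
  have hl : ∀ v < ps.length + 3, l v = L.getD v 0 := fun v hv => by
    have hv' : (Fin.ofNat (2 * n + 1) v).val = v := Nat.mod_eq_of_lt (by omega)
    simp only [l]
    rw [hf _ (by omega), hv', ZMod.val_cast_of_lt (hget v)]
  refine ⟨f, fun j hj => ?_⟩
  have key := sum_length_coreTree h ⟨hlW, hlen, hnd, hperm⟩ hl fun c => if c = j + 1 then 1 else 0
  have hj0 : ((j + 1 : ℕ) : ZMod (2 * n + 1)) ≠ 0 := by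
    rw [Ne, ZMod.natCast_eq_zero_iff]
    exact fun hdvd => absurd (Nat.le_of_dvd (by omega) hdvd) (by omega)
  have hsum : ∑ v ∈ range (2 * n + 1),
      (if cyclicNorm (2 * n + 1) (l v) = j + 1 then 1 else 0) = 2 := by
    have hv : ∀ v : Fin (2 * n + 1), (if cyclicNorm (2 * n + 1) (l v) = j + 1 then 1 else 0) =
        (if f v = (j + 1 : ℕ) then 1 else 0) + if f v = -(j + 1 : ℕ) then 1 else 0 := fun v => by
      have := cyclicNorm_indicator (hllt v) (Nat.succ_pos _ : 0 < 2 * n + 1) hj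
      rw [Nat.dist_zero_right, Nat.cast_zero, sub_zero, hlf] at this
      simp only [← this, neg_eq_iff_eq_neg]
    rw [sum_range, sum_congr rfl fun v _ => hv v, sum_add_distrib,
      f.sum_comp fun y => if y = (j + 1 : ℕ) then 1 else 0,
      f.sum_comp fun y => if y = -(j + 1 : ℕ) then 1 else 0]
    simp
  have hdiff : diffCount (coreTree n ps) f (j + 1 : ℕ) = ∑ v ∈ range (2 * n + 1),
      (if cyclicNorm (2 * n + 1) (Nat.dist (l v) (l ((fullParents n ps).getD v 0))) = j + 1
        then 1 else 0) := by
    rw [coreTree, diffCount_parentTree (coreTree_par_lt h), sum_range]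
    refine sum_congr rfl fun v _ => ?_
    rw [← cyclicNorm_indicator (hllt _) (hllt _) hj, hlf]
    have hlp := hlf (Fin.ofNat (2 * n + 1) ((fullParents n ps).getD v 0))
    rw [val_ofNat_getD_fullParents h] at hlp
    rw [hlp]
    by_cases hv : v = 0
    · subst hv
      rw [if_neg (by simp), show Fin.ofNat (2 * n + 1)
        ((fullParents n ps).getD (0 : Fin (2 * n + 1)).val 0) = 0 from rfl]
      rw [sub_self, neg_zero, if_neg hj0.symm]
    · rw [if_pos hv]
  rw [hsum, hxa, hxb] at key
  rw [hdiff]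
  simpa only [Nat.add_right_cancel_iff, eq_comm (a := a), eq_comm (a := b)] using key

theorem IsCertificate.exists_decomposition (hn : 0 < n) {Ws : List (List (List ℕ))}
    {cores : List (List ℕ × List (List ℕ))} (h : IsCertificate n Ws cores)
    (hK : (n : ℤ) ^ 3 * (n - 1) < 2 * (cores.length + 1) ^ 2) :
    ∃ M : Multiset (SimpleGraph (Fin (2 * n + 1))),
      (∀ G ∈ M, G.IsTree) ∧
      (∀ T : SimpleGraph (Fin (2 * n + 1)), T.IsTree →
        countP' (fun G => Nonempty (G ≃g T)) M = 2 * n + 1) ∧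
      (∀ a b : Fin (2 * n + 1), a ≠ b →
        countP' (fun G => G.Adj a b) M = 2 * tau (2 * n + 1)) := by
  obtain ⟨hWs, hcores, hchain⟩ := h
  have hcore : ∀ i : Fin cores.length, IsCore n (cores[i]).1 := fun i =>
    (hcores _ (List.getElem_mem i.2)).1
  refine exists_decomposition_of_universal hn hK (fun i => coreTree n (cores[i]).1)
    (fun i => isTree_coreTree (hcore i)) ?_ ?_
  · rintro i i' ⟨φ⟩
    have hcode := degreeCode_congr φ
    rw [degreeCode_coreTree (hcore i), degreeCode_coreTree (hcore i')] at hcode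
    have hnd : (cores.map fun c => coreCode n c.1).Nodup := hchain.pairwise.imp Nat.ne_of_lt
    refine Fin.ext (hnd.getElem_inj_iff (hi := by simp) (hj := by simp) |>.1 ?_)
    simpa using hcode
  · intro i a b
    obtain ⟨W, hW, hbal⟩ := (hcores _ (List.getElem_mem i.2)).2
    obtain ⟨w, hw, x, -, q, -, hpath⟩ :=
      hWs W hW a (List.mem_range.2 a.2) b (List.mem_range.2 b.2)
    obtain ⟨ls, -, hls⟩ := hbal w hw
    obtain ⟨f, hf⟩ := exists_labelling_coreTree (hcore i) hls hpath
    refine ⟨f, fun j => ?_⟩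
    simpa only [Fin.ext_iff] using hf j j.2

end Certificate

section Data

/-- Families of label sets for the trees in `cores1`. -/
def labelSets1 : List (List (List ℕ)) :=
  []

/-- Cores of universal trees of order `3` with balanced labellings. -/
def cores1 : List (List ℕ × List (List ℕ)) := [
]

set_option maxRecDepth 100000 in
lemma isCertificate1 : IsCertificate 1 labelSets1 cores1 := by decide +kernel

/-- Families of label sets for the trees in `cores2`. -/
def labelSets2 : List (List (List ℕ)) :=
  [[[]], [[3, 4], [2, 4]]]

/-- Cores of universal trees of order `5` with balanced labellings. -/
def cores2 : List (List ℕ × List (List ℕ)) := [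
  ([0, 3], [[3, 4], [4, 2]]),
  ([], [[]])]

set_option maxRecDepth 100000 in
lemma isCertificate2 : IsCertificate 2 labelSets2 cores2 := by decide +kernel

/-- Families of label sets for the trees in `cores3`. -/
def labelSets3 : List (List (List ℕ)) :=
  [[[]], [[5, 6], [3, 6]], [[4, 5, 6], [2, 4, 6], [2, 4, 5]], [[3, 5, 6], [4, 5, 6], [3, 4, 6]],
  [[3, 4, 5, 6], [2, 4, 5, 6], [2, 3, 5, 6], [2, 3, 4, 6], [1, 4, 5, 6], [1, 3, 5, 6]]]

/-- Cores of universal trees of order `7` with balanced labellings. -/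
def cores3 : List (List ℕ × List (List ℕ)) := [
  ([0, 3, 4, 5], [[3, 6, 4, 5], [6, 4, 2, 5], [2, 6, 5, 3], [3, 4, 6, 2], [6, 1, 5, 4], [1, 3, 6,
  5]]),
  ([0, 3, 4], [[3, 5, 6], [4, 6, 5], [4, 3, 6]]),
  ([0, 3, 3], [[4, 5, 6], [6, 4, 2], [2, 5, 4]]),
  ([0, 3], [[5, 6], [6, 3]]),
  ([], [[]])]

set_option maxRecDepth 100000 in
lemma isCertificate3 : IsCertificate 3 labelSets3 cores3 := by decide +kernel

/-- Families of label sets for the trees in `cores4`. -/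
def labelSets4 : List (List (List ℕ)) :=
  [[[]], [[7, 8]], [[6, 7, 8], [4, 5, 8]], [[5, 7, 8], [6, 7, 8]], [[5, 6, 7, 8], [3, 4, 7, 8], [2,
  5, 7, 8]], [[5, 6, 7, 8], [3, 4, 7, 8], [4, 5, 7, 8]], [[3, 5, 6, 7, 8], [2, 4, 5, 7, 8], [1, 3,
  4, 7, 8], [3, 4, 6, 7, 8]]]

/-- Cores of universal trees of order `9` with balanced labellings. -/
def cores4 : List (List ℕ × List (List ℕ)) := [
  ([0, 3, 3, 4, 6], [[3, 6, 8, 5, 7], [7, 5, 2, 4, 8], [1, 4, 3, 8, 7], [6, 4, 3, 8, 7]]),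
  ([0, 3, 3, 4, 4], [[3, 7, 6, 8, 5], [5, 4, 7, 2, 8], [8, 7, 1, 3, 4], [3, 6, 8, 4, 7]]),
  ([0, 3, 4, 5], [[5, 8, 6, 7], [7, 4, 3, 8], [4, 8, 7, 5]]),
  ([0, 3, 3, 4], [[5, 7, 8, 6], [7, 8, 4, 3], [5, 4, 7, 8]]),
  ([0, 3, 3, 3], [[5, 8, 6, 7], [7, 8, 3, 4], [7, 2, 5, 8]]),
  ([0, 3, 4], [[5, 7, 8], [6, 8, 7]]),
  ([0, 3, 3], [[6, 8, 7], [4, 8, 5]]),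
  ([0, 3], [[7, 8]]),
  ([], [[]])]

set_option maxRecDepth 100000 in
lemma isCertificate4 : IsCertificate 4 labelSets4 cores4 := by decide +kernel

/-- Families of label sets for the trees in `cores5`. -/
def labelSets5 : List (List (List ℕ)) :=
  [[[1, 3, 4, 5, 6, 8], [1, 2, 3, 4, 5, 6, 7, 8, 9, 10], [1, 2, 5, 6, 7, 9, 10], [1, 2, 3, 4, 7,
  9]], [[2, 4, 5, 8, 9, 10], [1, 4, 5, 6, 7, 8], [1, 3, 5, 8, 9, 10]]]

/-- Cores of universal trees of order `11` with balanced labellings. -/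
def cores5 : List (List ℕ × List (List ℕ)) := [
  ([0, 3, 4, 5, 5, 6], [[5, 8, 4, 1, 3, 6], [4, 2, 1, 9, 3, 10], [2, 1, 6, 7, 10, 9], [4, 2, 1, 3,
  9, 7]]),
  ([0, 3, 3, 4, 4, 5], [[3, 6, 8, 5, 1, 4], [6, 9, 8, 2, 7, 4], [7, 5, 2, 10, 6, 1], [9, 7, 2, 3,
  4, 1]]),
  ([0, 3, 3, 3, 4, 4], [[6, 1, 5, 3, 8, 4], [10, 5, 7, 3, 4, 1], [9, 7, 2, 10, 1, 6], [7, 3, 9, 4,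
  1, 2]]),
  ([0, 3, 4, 0, 6, 7], [[5, 8, 4, 1, 6, 3], [2, 1, 6, 9, 10, 5], [9, 10, 5, 2, 1, 6], [4, 2, 1, 3,
  7, 9]]),
  ([0, 3, 3, 5, 6], [[6, 1, 5, 8, 4], [10, 6, 4, 2, 1], [2, 6, 7, 9, 10], [4, 1, 3, 7, 9]]),
  ([0, 3, 3, 4, 4], [[6, 1, 5, 4, 8], [3, 10, 4, 9, 1], [1, 5, 7, 10, 6], [1, 9, 3, 2, 7]]),
  ([0, 3, 3, 3, 0, 7], [[6, 1, 5, 3, 8, 4], [3, 2, 1, 7, 10, 5], [9, 10, 2, 7, 1, 6], [4, 1, 2, 3,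
  7, 9]]),
  ([0, 3, 3, 3, 3], [[2, 4, 9, 8, 5], [1, 7, 8, 5, 4], [8, 9, 10, 3, 5]]),
  ([0, 3, 0, 5, 6], [[5, 8, 1, 6, 3], [6, 3, 7, 9, 10], [7, 9, 2, 1, 6], [4, 2, 3, 7, 9]]),
  ([0, 3, 3, 4], [[3, 8, 6, 4], [6, 7, 10, 9], [4, 3, 1, 7]]),
  ([0, 3, 3, 3], [[5, 1, 8, 4], [6, 7, 3, 10], [10, 1, 9, 5], [3, 2, 1, 7]]),
  ([0, 3, 4], [[1, 6, 3], [9, 10, 5], [3, 7, 9]]),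
  ([0, 3, 3], [[6, 1, 5], [7, 3, 4], [6, 10, 7], [7, 4, 3]]),
  ([0, 3], [[8, 4], [10, 5], [7, 9], [3, 7]]),
  ([], [[]])]

set_option maxRecDepth 100000 in
lemma isCertificate5 : IsCertificate 5 labelSets5 cores5 := by decide +kernel

/-- Families of label sets for the trees in `cores6`. -/
def labelSets6 : List (List (List ℕ)) :=
  [[[1, 2, 3, 4, 5, 7, 8], [2, 3, 4, 6, 8, 10, 11, 12], [1, 3, 4, 5, 6, 7, 10, 12], [1, 2, 4, 5, 6,
  9, 11, 12]], [[1, 2, 3, 4, 5, 6, 7, 8, 9, 10, 11, 12], [1, 2, 3, 5, 6, 7, 8], [1, 3, 4, 7, 8, 9,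
  10, 12], [2, 3, 4, 6, 8, 11, 12]]]

/-- Cores of universal trees of order `13` with balanced labellings. -/
def cores6 : List (List ℕ × List (List ℕ)) := [
  ([0, 3, 4, 4, 5, 7, 7], [[8, 4, 1, 3, 7, 5, 2], [4, 2, 3, 12, 8, 11, 10], [12, 6, 1, 5, 7, 3, 4],
  [12, 6, 2, 4, 1, 5, 9]]),
  ([0, 3, 3, 5, 5, 7, 7], [[2, 7, 8, 3, 5, 4, 1], [10, 12, 11, 3, 8, 6, 2], [3, 4, 12, 5, 7, 1, 6],
  [4, 5, 12, 1, 11, 9, 2]]),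
  ([0, 3, 4, 4, 4, 7, 7], [[4, 2, 3, 1, 12, 5, 7], [2, 1, 6, 7, 8, 3, 5], [1, 7, 3, 10, 4, 8, 9],
  [8, 4, 6, 11, 2, 3, 12]]),
  ([0, 3, 3, 3, 5, 5, 5], [[2, 7, 8, 1, 4, 5, 3], [11, 8, 12, 3, 10, 2, 6], [6, 3, 1, 5, 4, 7, 10],
  [4, 5, 12, 2, 11, 1, 6]]),
  ([0, 3, 3, 5, 5, 5, 5], [[8, 1, 7, 2, 5, 3, 4], [11, 8, 3, 10, 4, 6, 12], [10, 4, 6, 12, 5, 1,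
  7], [1, 12, 2, 9, 4, 11, 6]]),
  ([0, 3, 4, 4, 0, 7, 8], [[1, 7, 2, 5, 3, 8, 4], [11, 12, 10, 2, 3, 8, 4], [6, 3, 12, 4, 1, 7,
  10], [9, 11, 5, 6, 4, 2, 1]]),
  ([0, 3, 3, 0, 6, 4, 4], [[7, 5, 2, 3, 8, 4, 1], [12, 2, 10, 3, 8, 11, 4], [5, 4, 1, 6, 3, 10, 7],
  [2, 6, 9, 11, 12, 5, 1]]),
  ([0, 3, 4, 0, 6, 6, 6], [[2, 1, 7, 8, 3, 4, 5], [12, 6, 3, 8, 10, 11, 4], [12, 6, 3, 1, 7, 10,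
  4], [4, 2, 1, 5, 12, 6, 9]]),
  ([0, 3, 3, 0, 6, 6, 6], [[5, 3, 2, 8, 4, 1, 7], [6, 4, 2, 11, 8, 3, 12], [1, 4, 10, 12, 5, 7, 6],
  [9, 4, 5, 12, 6, 11, 1]]),
  ([0, 3, 3, 3, 3, 6], [[5, 4, 3, 1, 2, 7], [10, 12, 2, 8, 11, 4], [4, 7, 3, 10, 1, 5], [11, 9, 6,
  2, 5, 1]]),
  ([0, 3, 3, 3, 3, 3], [[8, 1, 5, 4, 7, 3], [3, 4, 8, 10, 12, 6], [6, 12, 1, 7, 5, 3], [2, 9, 6,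
  11, 1, 4]]),
  ([0, 3, 4, 0, 6, 5], [[3, 8, 4, 1, 7, 2], [3, 8, 4, 11, 12, 2], [1, 7, 10, 12, 6, 5], [9, 11, 12,
  4, 2, 6]]),
  ([0, 3, 4, 5, 5], [[2, 1, 7, 3, 4], [6, 3, 8, 11, 10], [7, 10, 5, 1, 4], [11, 12, 6, 2, 4]]),
  ([0, 3, 3, 5, 5], [[8, 5, 3, 2, 1], [12, 10, 2, 4, 11], [10, 6, 4, 12, 5], [12, 1, 11, 5, 6]]),
  ([0, 3, 4, 4, 4], [[3, 8, 7, 1, 4], [6, 3, 12, 8, 4], [1, 7, 4, 10, 3], [9, 11, 5, 12, 6]]),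
  ([0, 3, 3, 3, 3], [[8, 3, 7, 5, 1], [8, 2, 6, 11, 10], [7, 4, 1, 3, 6], [1, 9, 2, 12, 5]]),
  ([0, 3, 0, 5, 4], [[8, 4, 1, 7, 2], [8, 4, 11, 12, 2], [7, 10, 6, 3, 5], [9, 11, 4, 2, 12]]),
  ([0, 3, 3, 5], [[3, 2, 1, 7], [3, 12, 4, 2], [5, 4, 1, 7], [4, 12, 5, 9]]),
  ([0, 3, 3, 3], [[8, 3, 4, 5], [8, 2, 6, 4], [6, 3, 1, 5], [9, 4, 5, 11]]),
  ([0, 3, 4], [[2, 1, 7], [12, 6, 3], [4, 2, 1]]),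
  ([0, 3, 3], [[2, 7, 8], [11, 8, 3], [6, 7, 12], [2, 6, 9]]),
  ([0, 3], [[4, 2], [6, 3], [12, 6]]),
  ([], [[]])]

set_option maxRecDepth 100000 in
lemma isCertificate6 : IsCertificate 6 labelSets6 cores6 := by decide +kernel

/-- Families of label sets for the trees in `cores7`. -/
def labelSets7 : List (List (List ℕ)) :=
  [[[2, 5, 7, 8, 9, 10, 11, 12, 13], [1, 2, 3, 4, 6, 8, 9, 12], [1, 2, 4, 5, 6, 7, 10, 12, 14]],
  [[1, 2, 3, 4, 8, 9, 11, 12], [1, 3, 5, 6, 7, 9, 10, 11, 14], [2, 5, 7, 8, 9, 10, 13, 14]], [[1,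
  2, 3, 4, 5, 6, 9, 13], [1, 2, 4, 5, 7, 8, 10, 12], [1, 3, 4, 7, 8, 9, 12, 13, 14]], [[1, 3, 5, 6,
  7, 8, 9, 10, 11, 13], [3, 4, 5, 7, 10, 11, 13, 14], [1, 2, 3, 4, 6, 8, 9, 13]]]

/-- Cores of universal trees of order `15` with balanced labellings. -/
def cores7 : List (List ℕ × List (List ℕ)) := [
  ([0, 3, 3, 4, 4, 6, 7, 7], [[9, 11, 13, 1, 10, 8, 3, 7], [4, 5, 14, 7, 13, 11, 3, 10], [9, 3, 6,
  1, 2, 8, 4, 13]]),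
  ([0, 3, 3, 5, 5, 7, 7, 7], [[11, 9, 2, 12, 5, 7, 10, 13], [3, 12, 6, 4, 2, 9, 1, 8], [5, 6, 14,
  10, 4, 7, 2, 12]]),
  ([0, 3, 3, 3, 6, 5, 5, 5], [[6, 4, 3, 2, 1, 9, 13, 5], [2, 7, 1, 10, 5, 12, 4, 8], [13, 4, 9, 14,
  7, 1, 8, 12]]),
  ([0, 3, 3, 3, 3, 5, 5, 8], [[9, 13, 2, 7, 11, 5, 12, 10], [9, 3, 1, 6, 8, 4, 12, 2], [1, 4, 12,
  2, 14, 5, 7, 10]]),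
  ([0, 3, 3, 3, 3, 3, 7, 7], [[7, 9, 13, 11, 10, 12, 2, 8], [12, 4, 6, 8, 3, 9, 2, 1], [4, 2, 12,
  14, 7, 5, 6, 1]]),
  ([0, 3, 3, 5, 5, 0, 8, 7], [[2, 9, 8, 13, 10, 7, 11, 5], [6, 2, 4, 3, 1, 9, 12, 8], [6, 4, 2, 12,
  5, 14, 7, 10]]),
  ([0, 3, 3, 4, 4, 0, 8, 8], [[8, 12, 11, 2, 10, 5, 7, 13], [3, 6, 12, 2, 4, 9, 1, 8], [10, 4, 6,
  7, 12, 1, 2, 14]]),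
  ([0, 3, 0, 5, 5, 5, 8, 9], [[5, 10, 9, 2, 12, 7, 11, 13], [3, 9, 12, 6, 8, 4, 2, 1], [12, 6, 14,
  10, 7, 4, 2, 1]]),
  ([0, 3, 4, 4, 6, 6, 6], [[10, 5, 11, 9, 12, 7, 2], [12, 6, 4, 2, 8, 1, 9], [12, 6, 4, 2, 10, 1,
  7]]),
  ([0, 3, 3, 3, 0, 7, 7, 7], [[5, 10, 8, 12, 11, 13, 9, 2], [12, 4, 8, 6, 3, 9, 2, 1], [2, 1, 12,
  5, 14, 7, 10, 4]]),
  ([0, 3, 0, 5, 5, 5, 5, 9], [[4, 2, 12, 9, 11, 3, 1, 8], [14, 7, 1, 10, 5, 11, 6, 3], [13, 14, 2,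
  9, 7, 8, 10, 5]]),
  ([0, 3, 3, 3, 3, 5, 5], [[5, 11, 9, 8, 12, 2, 7], [9, 3, 1, 8, 6, 4, 12], [7, 6, 1, 5, 2, 4,
  12]]),
  ([0, 3, 3, 3, 3, 3, 5], [[7, 12, 10, 9, 13, 11, 5], [3, 12, 1, 2, 6, 9, 8], [4, 2, 12, 5, 14, 7,
  6]]),
  ([0, 3, 3, 3, 3, 3, 3], [[12, 8, 3, 4, 1, 9, 11], [1, 5, 10, 7, 9, 6, 11], [7, 5, 9, 14, 2, 8,
  13]]),
  ([0, 3, 3, 4, 0, 7, 5], [[2, 7, 10, 11, 9, 12, 5], [1, 4, 12, 2, 3, 9, 6], [14, 12, 2, 6, 5, 10,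
  1]]),
  ([0, 3, 4, 4, 6, 6], [[5, 10, 2, 8, 12, 11], [3, 9, 8, 1, 12, 4], [5, 10, 6, 4, 12, 7]]),
  ([0, 3, 3, 3, 0, 7, 0, 9], [[9, 12, 7, 2, 11, 13, 10, 5], [3, 6, 12, 9, 4, 2, 1, 8], [14, 7, 10,
  4, 2, 1, 12, 6]]),
  ([0, 3, 3, 4, 4, 4], [[12, 5, 7, 11, 9, 10], [12, 4, 8, 3, 1, 2], [14, 2, 12, 7, 1, 10]]),
  ([0, 3, 3, 3, 3, 0, 8], [[13, 11, 2, 8, 5, 9, 12], [3, 1, 2, 6, 12, 8, 4], [1, 12, 2, 14, 4, 5,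
  10]]),
  ([0, 3, 3, 3, 3, 3], [[9, 2, 11, 13, 7, 12], [9, 8, 1, 6, 3, 12], [4, 14, 2, 5, 7, 12]]),
  ([0, 3, 0, 5, 6, 0, 8], [[5, 10, 7, 11, 13, 9, 12], [3, 9, 4, 2, 1, 12, 6], [10, 5, 4, 2, 1, 14,
  7]]),
  ([0, 3, 3, 5, 0, 7], [[12, 2, 10, 5, 7, 11], [4, 3, 1, 8, 9, 12], [4, 7, 12, 6, 5, 10]]),
  ([0, 3, 3, 5, 5], [[10, 13, 12, 5, 7], [1, 4, 12, 9, 3], [7, 1, 6, 4, 2]]),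
  ([0, 3, 4, 4, 4], [[7, 11, 13, 2, 9], [3, 9, 8, 12, 1], [4, 2, 1, 7, 10]]),
  ([0, 3, 3, 3, 3], [[13, 8, 5, 2, 11], [6, 9, 12, 2, 4], [7, 10, 5, 12, 2]]),
  ([0, 3, 0, 5, 4], [[7, 11, 9, 12, 13], [6, 3, 1, 8, 9], [4, 2, 12, 6, 1]]),
  ([0, 3, 4, 4], [[11, 13, 5, 8], [3, 9, 8, 1], [12, 6, 2, 4]]),
  ([0, 3, 3, 3], [[9, 12, 11, 13], [8, 6, 4, 2], [2, 1, 10, 7]]),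
  ([0, 3, 0, 5], [[11, 13, 9, 12], [2, 1, 9, 12], [10, 5, 12, 6]]),
  ([0, 3, 3], [[2, 7, 10], [12, 3, 9], [6, 4, 2]]),
  ([0, 3], [[10, 5], [4, 2], [14, 7]]),
  ([], [[]])]

set_option maxRecDepth 100000 in
lemma isCertificate7 : IsCertificate 7 labelSets7 cores7 := by decide +kernel

/-- Families of label sets for the trees in `cores8`. -/
def labelSets8 : List (List (List ℕ)) :=
  [[[3, 7, 8, 9, 10, 11, 13, 14, 15, 16], [1, 3, 4, 5, 6, 8, 11, 14, 15, 16], [2, 5, 6, 8, 10, 12,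
  13, 15, 16]], [[3, 5, 6, 7, 8, 10, 12, 13, 15, 16], [2, 3, 4, 6, 8, 9, 10, 13, 14], [1, 2, 3, 6,
  9, 10, 11, 13, 16]]]

/-- Cores of universal trees of order `17` with balanced labellings. -/
def cores8 : List (List ℕ × List (List ℕ)) := [
  ([0, 3, 3, 4, 4, 5, 5, 9, 9], [[15, 8, 7, 9, 16, 11, 13, 3, 10], [16, 11, 5, 8, 3, 1, 4, 6, 15],
  [15, 5, 10, 6, 16, 2, 8, 13, 12]]),
  ([0, 3, 4, 4, 5, 5, 5, 5, 5], [[11, 14, 16, 15, 3, 9, 13, 7, 8], [6, 3, 15, 5, 1, 14, 11, 4, 16],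
  [12, 6, 15, 8, 13, 10, 2, 16, 5]]),
  ([0, 3, 4, 4, 6, 6, 7, 7], [[15, 16, 9, 7, 13, 11, 3, 10], [11, 14, 8, 6, 1, 5, 3, 15], [15, 16,
  6, 10, 8, 2, 12, 13]]),
  ([0, 3, 4, 4, 0, 7, 6, 6, 6], [[11, 14, 15, 16, 3, 10, 8, 7, 9], [6, 3, 4, 16, 5, 11, 1, 15, 8],
  [12, 6, 8, 15, 10, 5, 13, 16, 2]]),
  ([0, 3, 3, 5, 5, 5, 0, 9, 9], [[3, 11, 9, 10, 16, 13, 15, 8, 7], [11, 5, 6, 15, 8, 3, 1, 14, 4],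
  [6, 8, 15, 13, 16, 2, 5, 12, 10]]),
  ([0, 3, 3, 3, 0, 7, 7, 7, 10], [[11, 8, 3, 14, 9, 16, 10, 13, 15], [5, 11, 4, 1, 6, 3, 8, 15,
  16], [10, 2, 8, 5, 12, 16, 6, 13, 15]]),
  ([0, 3, 0, 5, 4, 7, 7, 7, 7], [[11, 14, 3, 10, 7, 9, 15, 16, 8], [16, 8, 5, 11, 4, 6, 3, 1, 15],
  [15, 16, 10, 5, 8, 12, 6, 13, 2]]),
  ([0, 3, 4, 4, 4, 4, 0, 9, 9], [[9, 13, 3, 10, 14, 16, 15, 8, 7], [11, 14, 15, 6, 8, 16, 5, 4, 1],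
  [16, 8, 2, 13, 6, 12, 15, 5, 10]]),
  ([0, 3, 3, 3, 3, 0, 8, 8, 8], [[8, 10, 9, 16, 15, 14, 7, 3, 11], [5, 16, 4, 1, 6, 11, 3, 14, 8],
  [8, 2, 12, 6, 13, 15, 10, 5, 16]]),
  ([0, 3, 0, 5, 5, 5, 5, 5, 9], [[16, 8, 3, 7, 9, 11, 13, 10, 15], [6, 3, 16, 1, 15, 5, 11, 8, 14],
  [12, 6, 15, 13, 10, 5, 16, 2, 8]]),
  ([0, 3, 3, 3, 3, 3, 8, 8], [[9, 16, 15, 10, 13, 11, 3, 8], [6, 15, 8, 3, 5, 1, 4, 14], [12, 10,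
  6, 16, 2, 13, 8, 5]]),
  ([0, 3, 4, 4, 4, 4, 4, 4], [[14, 7, 11, 9, 15, 8, 13, 16], [8, 4, 3, 15, 16, 5, 6, 1], [16, 8, 2,
  10, 6, 13, 12, 15]]),
  ([0, 3, 3, 3, 3, 3, 3, 3], [[15, 10, 3, 5, 8, 16, 7, 12], [6, 3, 4, 2, 14, 13, 10, 9], [2, 3, 9,
  6, 1, 16, 10, 13]]),
  ([0, 3, 4, 5, 6, 6, 0, 9], [[13, 15, 16, 8, 11, 14, 3, 10], [15, 16, 8, 4, 3, 1, 5, 11], [13, 15,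
  16, 8, 6, 2, 10, 5]]),
  ([0, 3, 4, 4, 0, 7, 7, 5], [[15, 16, 9, 7, 14, 11, 3, 13], [6, 3, 15, 5, 1, 4, 14, 16], [16, 8,
  10, 15, 2, 13, 6, 5]]),
  ([0, 3, 3, 5, 5, 0, 8, 8], [[14, 3, 11, 13, 15, 8, 16, 9], [16, 15, 1, 4, 14, 8, 3, 5], [6, 8,
  15, 2, 13, 5, 10, 12]]),
  ([0, 3, 4, 0, 6, 0, 8, 8, 8], [[15, 16, 8, 14, 7, 3, 10, 9, 11], [16, 8, 4, 11, 14, 6, 3, 1, 5],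
  [13, 15, 16, 12, 6, 10, 5, 2, 8]]),
  ([0, 3, 0, 5, 5, 4, 4, 4], [[11, 14, 13, 3, 10, 7, 15, 16], [16, 8, 1, 15, 3, 11, 14, 4], [13,
  15, 8, 2, 6, 10, 16, 5]]),
  ([0, 3, 3, 3, 6, 6, 6], [[16, 7, 8, 9, 15, 13, 11], [15, 4, 16, 11, 8, 3, 14], [16, 8, 6, 10, 15,
  12, 5]]),
  ([0, 3, 0, 5, 0, 7, 7, 7, 7], [[13, 15, 3, 10, 8, 11, 16, 9, 14], [5, 11, 16, 8, 4, 3, 1, 15, 6],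
  [16, 8, 12, 6, 15, 5, 13, 2, 10]]),
  ([0, 3, 3, 3, 3, 7, 7], [[3, 11, 7, 13, 9, 10, 16], [3, 4, 16, 14, 6, 1, 5], [10, 12, 8, 15, 2,
  6, 13]]),
  ([0, 3, 3, 3, 3, 3, 8], [[9, 13, 15, 16, 10, 11, 14], [6, 15, 5, 3, 1, 8, 4], [10, 5, 2, 8, 15,
  12, 6]]),
  ([0, 3, 3, 3, 3, 3, 3], [[10, 11, 16, 14, 3, 7, 13], [5, 4, 16, 14, 6, 8, 1], [8, 13, 6, 10, 15,
  2, 12]]),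
  ([0, 3, 4, 5, 0, 7, 0, 9], [[9, 13, 15, 16, 11, 14, 3, 10], [15, 16, 8, 4, 5, 11, 6, 3], [13, 15,
  16, 8, 12, 6, 10, 5]]),
  ([0, 3, 3, 0, 6, 7, 0, 9], [[11, 3, 8, 9, 13, 15, 14, 7], [6, 1, 5, 16, 8, 4, 11, 14], [2, 6, 13,
  15, 16, 8, 10, 5]]),
  ([0, 3, 0, 5, 5, 7, 7], [[11, 14, 9, 16, 10, 3, 7], [6, 3, 16, 11, 5, 14, 8], [16, 8, 12, 10, 2,
  6, 13]]),
  ([0, 3, 4, 5, 5, 5], [[9, 13, 15, 7, 16, 8], [15, 16, 8, 5, 4, 3], [13, 15, 16, 6, 10, 8]]),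
  ([0, 3, 3, 4, 4, 4], [[7, 9, 15, 10, 13, 16], [4, 5, 16, 11, 14, 8], [2, 13, 6, 8, 15, 5]]),
  ([0, 3, 3, 3, 3, 6], [[11, 3, 8, 15, 13, 16], [4, 16, 15, 5, 6, 11], [12, 13, 2, 10, 16, 5]]),
  ([0, 3, 3, 3, 3, 3], [[11, 8, 13, 15, 3, 14], [8, 14, 11, 5, 3, 4], [10, 8, 12, 15, 2, 5]]),
  ([0, 3, 4, 5, 0, 7], [[13, 15, 16, 8, 3, 10], [15, 16, 8, 4, 11, 14], [13, 15, 16, 8, 10, 5]]),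
  ([0, 3, 4, 5, 5], [[11, 14, 7, 16, 8], [15, 16, 8, 3, 5], [15, 16, 8, 12, 13]]),
  ([0, 3, 3, 5, 5], [[10, 3, 7, 11, 13], [4, 6, 15, 1, 14], [6, 13, 10, 2, 8]]),
  ([0, 3, 4, 4, 4], [[11, 14, 15, 16, 7], [5, 11, 14, 8, 3], [13, 15, 16, 5, 10]]),
  ([0, 3, 3, 3, 3], [[11, 8, 15, 3, 13], [14, 3, 15, 16, 11], [15, 2, 13, 10, 5]]),
  ([0, 3, 4, 0, 6], [[11, 14, 7, 16, 8], [15, 16, 8, 11, 14], [15, 16, 8, 12, 6]]),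
  ([0, 3, 3, 0, 6], [[3, 7, 13, 11, 14], [5, 4, 1, 6, 3], [8, 6, 2, 13, 15]]),
  ([0, 3, 3, 3], [[13, 3, 15, 10], [16, 15, 8, 1], [16, 6, 10, 8]]),
  ([0, 3, 4], [[15, 16, 8], [5, 11, 14]]),
  ([0, 3, 3], [[11, 3, 8], [8, 11, 14], [6, 15, 8]]),
  ([0, 3], [[14, 7], [16, 8], [13, 15]]),
  ([], [[]])]

set_option maxRecDepth 100000 in
lemma isCertificate8 : IsCertificate 8 labelSets8 cores8 := by decide +kernel

/-- Families of label sets for the trees in `cores9`. -/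
def labelSets9 : List (List (List ℕ)) :=
  [[[1, 2, 3, 5, 6, 8, 9, 11, 14, 15, 18], [1, 2, 3, 5, 7, 9, 12, 13, 15, 17], [1, 2, 3, 4, 5, 6,
  8, 10, 11, 13, 16]], [[3, 5, 7, 8, 9, 10, 11, 14, 15, 17], [1, 2, 3, 6, 7, 9, 10, 11, 13, 14,
  18], [2, 3, 4, 6, 7, 8, 13, 15, 17, 18]]]

/-- Cores of universal trees of order `19` with balanced labellings. -/
def cores9 : List (List ℕ × List (List ℕ)) := [
  ([0, 3, 4, 4, 6, 6, 5, 5, 10, 10], [[18, 9, 8, 1, 15, 5, 2, 6, 14, 11], [2, 1, 15, 5, 17, 7, 12,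
  3, 9, 13], [3, 11, 6, 5, 8, 16, 2, 4, 10, 13]]),
  ([0, 3, 3, 3, 4, 4, 4, 4, 4, 4], [[2, 1, 18, 3, 11, 9, 5, 14, 6, 15], [2, 1, 12, 9, 13, 5, 15, 3,
  17, 7], [13, 11, 2, 16, 6, 5, 10, 3, 8, 1]]),
  ([0, 3, 4, 4, 5, 5, 7, 0, 10, 10], [[2, 1, 15, 5, 9, 6, 14, 11, 3, 8], [5, 12, 9, 3, 2, 7, 1, 13,
  17, 15], [4, 2, 8, 13, 3, 5, 11, 16, 10, 6]]),
  ([0, 3, 3, 4, 4, 0, 8, 8, 5, 5], [[5, 3, 2, 14, 8, 1, 11, 9, 6, 15], [2, 12, 9, 7, 5, 1, 17, 3,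
  13, 15], [13, 10, 3, 8, 2, 5, 4, 1, 6, 16]]),
  ([0, 3, 3, 4, 5, 5, 5, 7, 7], [[15, 9, 6, 14, 1, 5, 3, 18, 2], [3, 15, 7, 17, 13, 2, 5, 12, 1],
  [10, 4, 6, 2, 5, 1, 3, 13, 11]]),
  ([0, 3, 3, 5, 5, 5, 7, 7, 7], [[5, 18, 6, 14, 11, 3, 9, 2, 15], [3, 15, 7, 13, 2, 5, 9, 1, 12],
  [13, 3, 10, 2, 8, 5, 11, 4, 16]]),
  ([0, 3, 3, 5, 4, 7, 7, 7, 7], [[8, 2, 6, 3, 1, 15, 9, 5, 11], [9, 2, 7, 13, 1, 17, 15, 3, 5],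
  [10, 4, 6, 3, 2, 8, 13, 16, 5]]),
  ([0, 3, 3, 0, 6, 6, 6, 6, 9, 9], [[9, 8, 1, 5, 2, 18, 6, 3, 11, 14], [13, 17, 15, 12, 7, 9, 3, 5,
  1, 2], [4, 1, 3, 16, 11, 6, 10, 5, 8, 2]]),
  ([0, 3, 3, 3, 4, 4, 4, 4, 9], [[6, 1, 3, 5, 11, 2, 9, 18, 14], [2, 1, 12, 9, 7, 13, 15, 5, 17],
  [8, 3, 4, 5, 2, 6, 1, 16, 10]]),
  ([0, 3, 3, 3, 3, 6, 6, 6, 6], [[8, 18, 2, 6, 9, 1, 5, 11, 14], [1, 7, 13, 17, 3, 12, 15, 2, 5],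
  [8, 3, 6, 5, 2, 11, 13, 1, 4]]),
  ([0, 3, 3, 3, 3, 3, 8, 8, 9], [[11, 3, 6, 5, 15, 8, 9, 18, 14], [5, 17, 7, 9, 12, 15, 2, 13, 1],
  [13, 2, 8, 16, 11, 5, 1, 4, 10]]),
  ([0, 3, 3, 3, 3, 3, 3, 0, 10, 10], [[8, 9, 3, 6, 18, 5, 2, 15, 14, 1], [3, 7, 1, 2, 15, 9, 13,
  17, 12, 5], [8, 11, 3, 2, 5, 6, 16, 4, 10, 13]]),
  ([0, 3, 3, 3, 3, 3, 3, 3, 3], [[1, 14, 15, 18, 6, 5, 2, 11, 9], [3, 15, 17, 9, 2, 7, 13, 1, 5],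
  [5, 1, 8, 3, 4, 11, 16, 13, 2]]),
  ([0, 3, 4, 4, 0, 7, 7, 0, 10, 6], [[11, 15, 6, 9, 8, 3, 5, 2, 1, 14], [2, 1, 5, 15, 12, 3, 9, 7,
  13, 17], [10, 5, 11, 13, 3, 1, 2, 8, 4, 16]]),
  ([0, 3, 3, 5, 4, 4, 0, 9, 9], [[1, 2, 18, 9, 6, 15, 11, 8, 3], [9, 13, 15, 17, 12, 1, 7, 2, 5],
  [4, 10, 13, 16, 8, 2, 6, 1, 5]]),
  ([0, 3, 3, 3, 4, 0, 8, 7, 7], [[11, 6, 5, 15, 3, 2, 1, 14, 8], [5, 2, 12, 3, 1, 15, 17, 13, 7],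
  [2, 13, 8, 1, 16, 6, 3, 5, 11]]),
  ([0, 3, 3, 5, 5, 5, 4, 4], [[15, 9, 6, 14, 11, 3, 8, 1], [5, 9, 15, 12, 3, 17, 7, 2], [8, 5, 3,
  11, 16, 6, 1, 4]]),
  ([0, 3, 0, 5, 5, 5, 7, 7, 7], [[18, 9, 3, 1, 11, 2, 6, 5, 15], [15, 17, 7, 13, 2, 5, 9, 12, 1],
  [1, 10, 13, 16, 8, 5, 2, 6, 4]]),
  ([0, 3, 3, 3, 3, 6, 0, 9, 0, 11], [[14, 3, 6, 11, 8, 15, 2, 1, 18, 9], [3, 9, 13, 15, 7, 17, 5,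
  12, 2, 1], [8, 5, 2, 3, 6, 11, 1, 10, 13, 16]]),
  ([0, 3, 3, 0, 6, 5, 5, 5, 5], [[1, 6, 14, 3, 11, 5, 15, 18, 9], [12, 9, 3, 2, 1, 15, 17, 5, 7],
  [11, 8, 3, 10, 5, 2, 16, 6, 1]]),
  ([0, 3, 3, 3, 3, 0, 8, 8, 8], [[14, 15, 6, 18, 8, 3, 1, 2, 11], [12, 3, 7, 5, 9, 15, 2, 17, 13],
  [4, 10, 13, 3, 1, 16, 8, 5, 11]]),
  ([0, 3, 3, 3, 3, 3, 0, 9, 7], [[6, 5, 14, 1, 11, 3, 18, 9, 15], [5, 9, 15, 12, 2, 3, 7, 13, 1],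
  [10, 5, 4, 2, 6, 8, 13, 16, 3]]),
  ([0, 3, 3, 5, 5, 5, 5, 5], [[18, 15, 3, 14, 1, 11, 2, 8], [1, 5, 15, 13, 2, 3, 12, 17], [1, 4,
  16, 13, 10, 3, 8, 6]]),
  ([0, 3, 3, 3, 3, 3, 3, 8], [[1, 5, 18, 2, 15, 9, 11, 14], [1, 3, 7, 15, 13, 5, 17, 12], [5, 4, 1,
  2, 3, 13, 11, 16]]),
  ([0, 3, 3, 3, 3, 3, 3, 3], [[11, 8, 3, 5, 15, 9, 6, 2], [5, 15, 9, 3, 12, 17, 2, 7], [16, 6, 10,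
  13, 11, 3, 5, 8]]),
  ([0, 3, 0, 5, 5, 7, 6, 0, 10], [[2, 1, 5, 6, 18, 9, 3, 11, 15], [5, 12, 3, 15, 7, 13, 17, 2, 1],
  [4, 2, 13, 10, 3, 11, 5, 16, 8]]),
  ([0, 3, 4, 4, 5, 0, 8, 8], [[3, 11, 9, 2, 14, 6, 1, 5], [2, 1, 15, 5, 17, 3, 9, 13], [1, 10, 8,
  2, 4, 3, 16, 6]]),
  ([0, 3, 3, 4, 4, 0, 8, 8], [[9, 6, 3, 5, 1, 14, 15, 18], [5, 17, 7, 15, 2, 3, 9, 13], [3, 6, 16,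
  1, 5, 2, 8, 13]]),
  ([0, 3, 3, 3, 6, 0, 8, 0, 10], [[11, 15, 5, 6, 3, 2, 1, 18, 9], [5, 12, 3, 2, 1, 15, 17, 7, 13],
  [4, 13, 2, 10, 5, 3, 11, 16, 8]]),
  ([0, 3, 3, 5, 5, 5, 7], [[1, 2, 18, 9, 3, 15, 11], [3, 7, 15, 17, 2, 13, 1], [13, 3, 10, 5, 4, 6,
  2]]),
  ([0, 3, 3, 3, 0, 7, 7, 7], [[6, 3, 1, 5, 11, 2, 9, 15], [15, 17, 12, 3, 7, 5, 2, 13], [2, 13, 8,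
  1, 10, 6, 5, 4]]),
  ([0, 3, 3, 3, 3, 4, 0, 9], [[14, 18, 8, 6, 15, 9, 3, 11], [12, 7, 9, 3, 5, 13, 2, 1], [11, 8, 6,
  5, 3, 4, 1, 10]]),
  ([0, 3, 3, 3, 3, 0, 8, 8], [[9, 3, 8, 6, 1, 14, 15, 18], [17, 15, 2, 12, 5, 3, 13, 9], [6, 5, 1,
  4, 2, 13, 3, 10]]),
  ([0, 3, 3, 3, 3, 3, 0, 9], [[2, 18, 15, 6, 1, 3, 9, 14], [5, 12, 15, 17, 9, 7, 2, 1], [2, 11, 1,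
  10, 16, 5, 6, 3]]),
  ([0, 3, 3, 3, 3, 3, 3], [[8, 2, 5, 3, 9, 18, 6], [3, 7, 1, 15, 2, 5, 17], [10, 6, 13, 2, 16, 4,
  8]]),
  ([0, 3, 4, 0, 6, 0, 8, 9], [[9, 14, 7, 10, 5, 11, 15, 17], [9, 14, 7, 6, 3, 2, 1, 10], [15, 17,
  18, 6, 3, 8, 4, 2]]),
  ([0, 3, 0, 5, 5, 6, 7], [[2, 1, 15, 6, 9, 3, 14], [15, 17, 9, 7, 2, 13, 1], [10, 5, 2, 13, 8, 16,
  4]]),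
  ([0, 3, 3, 0, 6, 7, 7], [[18, 15, 3, 2, 1, 14, 6], [13, 17, 15, 5, 12, 9, 3], [1, 4, 16, 10, 5,
  2, 3]]),
  ([0, 3, 3, 3, 5, 0, 8], [[6, 14, 11, 3, 15, 18, 9], [7, 13, 5, 2, 12, 15, 17], [2, 11, 10, 1, 5,
  13, 16]]),
  ([0, 3, 3, 3, 4, 4], [[3, 8, 14, 11, 18, 9], [15, 2, 13, 17, 9, 12], [8, 6, 2, 4, 1, 5]]),
  ([0, 3, 4, 4, 4, 4], [[11, 15, 1, 9, 14, 6], [2, 1, 17, 7, 3, 13], [8, 4, 10, 13, 3, 1]]),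
  ([0, 3, 3, 3, 3, 3], [[6, 1, 5, 11, 3, 14], [7, 5, 9, 13, 17, 2], [4, 2, 10, 13, 1, 3]]),
  ([0, 3, 0, 5, 0, 7, 8], [[3, 11, 15, 17, 9, 14, 7], [6, 3, 9, 14, 2, 1, 10], [8, 4, 6, 3, 15, 17,
  18]]),
  ([0, 3, 0, 5, 6, 6], [[18, 9, 11, 15, 14, 1], [15, 17, 2, 1, 7, 13], [3, 11, 2, 1, 16, 4]]),
  ([0, 3, 3, 0, 6, 6], [[3, 1, 2, 6, 11, 14], [3, 17, 5, 15, 2, 13], [16, 6, 10, 5, 1, 4]]),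
  ([0, 3, 0, 5, 5, 5], [[3, 11, 9, 14, 1, 8], [15, 17, 5, 2, 3, 12], [16, 8, 4, 13, 2, 10]]),
  ([0, 3, 3, 3, 3], [[15, 14, 1, 6, 9], [13, 12, 17, 1, 15], [2, 11, 13, 8, 10]]),
  ([0, 3, 0, 5, 0, 7], [[3, 11, 18, 9, 2, 1], [2, 1, 5, 12, 7, 13], [13, 16, 4, 2, 10, 5]]),
  ([0, 3, 0, 5, 5], [[3, 11, 14, 15, 18], [7, 13, 2, 12, 9], [10, 5, 6, 2, 4]]),
  ([0, 3, 3, 3], [[9, 8, 14, 1], [15, 12, 3, 17], [16, 10, 8, 6]]),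
  ([0, 3, 0, 5], [[6, 3, 18, 9], [5, 12, 15, 17], [4, 2, 16, 8]]),
  ([0, 3, 3], [[15, 14, 1], [5, 3, 2], [3, 6, 16]]),
  ([0, 3], [[3, 11], [7, 13], [1, 10]]),
  ([], [[]])]

set_option maxRecDepth 100000 in
lemma isCertificate9 : IsCertificate 9 labelSets9 cores9 := by decide +kernel

/-- Families of label sets for the trees in `cores10`. -/
def labelSets10 : List (List (List ℕ)) :=
  [[[2, 3, 5, 8, 9, 10, 12, 15, 16, 18, 19], [1, 4, 5, 7, 8, 9, 10, 11, 13, 16, 17, 18], [1, 2, 4,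
  6, 7, 8, 9, 10, 14, 15, 20]]]

/-- Cores of universal trees of order `21` with balanced labellings. -/
def cores10 : List (List ℕ × List (List ℕ)) := [
  ([0, 3, 3, 4, 6, 6, 5, 5, 7, 7], [[19, 10, 9, 5, 3, 2, 18, 12, 16, 8], [18, 13, 5, 17, 8, 9, 10,
  16, 1, 7], [6, 2, 4, 1, 8, 14, 10, 15, 20, 9]]),
  ([0, 3, 3, 3, 5, 5, 8, 0, 10, 10, 11], [[3, 5, 19, 12, 10, 9, 15, 18, 16, 2, 8], [18, 5, 9, 13,
  1, 8, 4, 7, 11, 17, 16], [9, 20, 15, 10, 8, 7, 14, 6, 2, 4, 1]]),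
  ([0, 3, 3, 4, 4, 0, 8, 8, 10, 10, 10], [[2, 18, 5, 10, 8, 19, 16, 3, 12, 9, 15], [13, 4, 9, 7,
  18, 17, 1, 16, 5, 8, 11], [20, 14, 6, 4, 10, 9, 7, 2, 15, 8, 1]]),
  ([0, 3, 3, 5, 5, 5, 8, 0, 10, 10, 10], [[16, 19, 18, 9, 15, 3, 12, 10, 8, 5, 2], [4, 7, 18, 9, 5,
  13, 17, 11, 16, 1, 10], [9, 7, 2, 15, 1, 8, 4, 20, 14, 6, 10]]),
  ([0, 3, 3, 0, 6, 6, 7, 5, 5, 5, 5], [[9, 12, 18, 8, 10, 19, 5, 16, 3, 2, 15], [7, 11, 17, 18, 10,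
  8, 5, 13, 16, 1, 4], [9, 20, 10, 15, 14, 1, 7, 6, 2, 4, 8]]),
  ([0, 3, 3, 3, 5, 5, 4, 4, 4, 4], [[15, 18, 3, 12, 5, 19, 16, 10, 8, 2], [13, 5, 8, 17, 11, 18, 1,
  4, 10, 16], [9, 15, 10, 20, 6, 4, 1, 8, 14, 7]]),
  ([0, 3, 3, 3, 3, 0, 8, 4, 4, 4, 4], [[12, 3, 9, 10, 2, 15, 18, 8, 16, 5, 19], [18, 5, 7, 13, 11,
  16, 8, 4, 17, 1, 9], [14, 15, 20, 10, 4, 2, 1, 6, 7, 9, 8]]),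
  ([0, 3, 3, 4, 4, 4, 4, 4, 0, 11, 11], [[5, 18, 8, 15, 3, 2, 9, 16, 10, 12, 19], [18, 8, 10, 4,
  13, 16, 1, 7, 5, 9, 17], [10, 8, 2, 9, 14, 20, 4, 15, 7, 6, 1]]),
  ([0, 3, 3, 3, 3, 3, 5, 0, 10, 10, 10], [[18, 2, 9, 10, 16, 8, 15, 3, 12, 19, 5], [8, 7, 11, 1, 4,
  18, 16, 5, 17, 9, 13], [9, 15, 8, 7, 1, 2, 4, 20, 6, 10, 14]]),
  ([0, 3, 3, 3, 3, 3, 3, 4, 4, 4], [[18, 10, 3, 16, 2, 8, 15, 19, 5, 12], [17, 8, 16, 10, 1, 7, 9,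
  18, 4, 11], [9, 8, 20, 7, 2, 10, 1, 15, 14, 4]]),
  ([0, 3, 0, 5, 4, 4, 6, 6, 9, 7], [[3, 12, 16, 8, 18, 15, 10, 19, 5, 9], [10, 5, 13, 17, 18, 8, 1,
  16, 11, 9], [20, 10, 7, 14, 9, 1, 8, 6, 4, 15]]),
  ([0, 3, 4, 4, 5, 5, 6, 7, 7], [[3, 12, 15, 18, 10, 5, 9, 2, 8], [10, 5, 8, 18, 7, 1, 9, 17, 11],
  [7, 14, 15, 20, 6, 9, 10, 4, 2]]),
  ([0, 3, 3, 4, 4, 0, 8, 8, 7, 7], [[3, 5, 19, 16, 10, 12, 18, 15, 2, 8], [13, 9, 4, 8, 1, 18, 11,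
  7, 5, 17], [1, 20, 2, 6, 14, 15, 7, 8, 10, 4]]),
  ([0, 3, 3, 3, 5, 7, 7, 0, 10, 6], [[18, 2, 9, 16, 15, 10, 5, 3, 12, 8], [8, 4, 18, 11, 9, 13, 17,
  10, 5, 16], [8, 15, 14, 4, 7, 1, 6, 20, 10, 2]]),
  ([0, 3, 3, 3, 6, 6, 8, 7, 7], [[3, 5, 12, 19, 10, 9, 15, 8, 2], [11, 1, 16, 10, 13, 18, 9, 8, 5],
  [14, 7, 8, 6, 4, 2, 1, 10, 15]]),
  ([0, 3, 3, 4, 4, 4, 8, 8, 8], [[5, 16, 10, 8, 19, 18, 9, 15, 3], [1, 13, 9, 17, 18, 16, 8, 5,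
  11], [14, 8, 6, 7, 1, 4, 2, 15, 10]]),
  ([0, 3, 3, 3, 3, 0, 8, 6, 7, 7], [[19, 9, 16, 3, 10, 15, 18, 12, 8, 2], [13, 5, 18, 8, 16, 1, 11,
  4, 7, 9], [1, 7, 14, 8, 15, 20, 10, 4, 9, 6]]),
  ([0, 3, 3, 3, 3, 0, 8, 8, 9, 9], [[3, 19, 16, 8, 5, 9, 12, 18, 2, 10], [16, 7, 5, 9, 11, 1, 18,
  4, 10, 8], [15, 1, 7, 14, 8, 9, 10, 20, 4, 6]]),
  ([0, 3, 3, 3, 4, 7, 7, 7, 7], [[18, 9, 16, 2, 15, 3, 5, 10, 12], [10, 13, 18, 5, 17, 8, 1, 16,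
  9], [9, 7, 15, 2, 14, 8, 10, 6, 4]]),
  ([0, 3, 3, 3, 3, 0, 8, 8, 8, 8], [[5, 3, 18, 2, 8, 10, 16, 12, 15, 19], [16, 5, 11, 7, 9, 18, 10,
  8, 17, 1], [8, 2, 7, 1, 6, 14, 4, 20, 10, 15]]),
  ([0, 3, 4, 4, 5, 5, 5, 5, 5], [[10, 5, 18, 8, 9, 3, 2, 16, 15], [10, 5, 8, 18, 4, 13, 1, 16, 7],
  [9, 15, 14, 1, 4, 7, 6, 10, 8]]),
  ([0, 3, 3, 3, 3, 3, 4, 4, 4], [[10, 15, 2, 5, 16, 8, 12, 3, 18], [13, 16, 4, 9, 17, 18, 11, 5,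
  8], [8, 4, 7, 1, 20, 9, 10, 15, 2]]),
  ([0, 3, 3, 5, 5, 5, 5, 5, 5], [[9, 12, 18, 10, 3, 15, 8, 2, 16], [18, 13, 5, 10, 1, 9, 4, 16,
  17], [10, 2, 8, 1, 9, 15, 20, 7, 14]]),
  ([0, 3, 3, 3, 3, 3, 3, 3, 9], [[18, 3, 15, 2, 9, 8, 10, 16, 5], [8, 11, 7, 4, 1, 18, 13, 16, 17],
  [8, 9, 6, 15, 4, 14, 2, 20, 1]]),
  ([0, 3, 0, 5, 6, 0, 8, 8, 10, 9], [[10, 5, 9, 15, 18, 19, 3, 16, 8, 12], [1, 11, 16, 8, 4, 7, 18,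
  10, 5, 9], [7, 14, 4, 2, 1, 8, 9, 20, 10, 15]]),
  ([0, 3, 3, 5, 6, 0, 8, 8, 4], [[10, 16, 15, 18, 9, 3, 19, 5, 8], [9, 8, 1, 11, 16, 18, 5, 13, 4],
  [1, 14, 8, 4, 2, 9, 10, 20, 7]]),
  ([0, 3, 3, 4, 6, 6, 0, 9, 9], [[19, 10, 9, 5, 2, 3, 12, 18, 15], [5, 8, 18, 4, 9, 16, 11, 10, 1],
  [1, 8, 14, 4, 15, 10, 6, 20, 7]]),
  ([0, 3, 3, 3, 4, 7, 0, 9, 0, 11], [[16, 18, 8, 19, 9, 15, 3, 12, 10, 5], [11, 16, 1, 10, 8, 4,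
  18, 9, 13, 17], [9, 8, 1, 15, 4, 2, 7, 14, 20, 10]]),
  ([0, 3, 0, 5, 5, 0, 8, 8, 8, 7], [[16, 8, 3, 9, 15, 10, 19, 12, 5, 18], [16, 8, 7, 10, 18, 1, 11,
  5, 17, 9], [14, 7, 8, 6, 2, 9, 15, 10, 20, 1]]),
  ([0, 3, 3, 5, 5, 5, 0, 9, 9], [[2, 8, 15, 18, 5, 10, 12, 9, 3], [17, 9, 8, 13, 4, 16, 11, 1, 10],
  [9, 1, 8, 6, 4, 2, 14, 15, 20]]),
  ([0, 3, 4, 4, 4, 5, 5, 5], [[15, 18, 10, 9, 8, 19, 12, 5], [10, 5, 13, 8, 18, 17, 4, 9], [4, 2,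
  9, 14, 1, 10, 20, 15]]),
  ([0, 3, 3, 3, 3, 7, 0, 9, 5], [[12, 15, 10, 2, 18, 9, 16, 8, 5], [8, 7, 18, 1, 11, 16, 5, 13, 9],
  [8, 6, 2, 20, 9, 15, 14, 7, 1]]),
  ([0, 3, 3, 5, 6, 6, 6, 6], [[19, 9, 10, 5, 3, 2, 8, 18], [18, 8, 10, 5, 4, 9, 17, 1], [6, 4, 2,
  1, 14, 15, 8, 7]]),
  ([0, 3, 3, 3, 4, 4, 4, 4], [[3, 12, 19, 5, 2, 15, 18, 10], [5, 4, 13, 1, 17, 8, 9, 16], [20, 10,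
  6, 14, 9, 8, 2, 1]]),
  ([0, 3, 0, 5, 5, 5, 5, 5, 4], [[9, 15, 10, 19, 12, 5, 8, 2, 18], [10, 5, 8, 7, 4, 11, 1, 18, 13],
  [4, 2, 14, 15, 8, 20, 6, 7, 1]]),
  ([0, 3, 3, 0, 6, 6, 6, 6, 6], [[3, 5, 19, 18, 8, 10, 2, 9, 16], [9, 17, 13, 8, 7, 11, 18, 1, 4],
  [10, 1, 9, 14, 8, 20, 7, 15, 6]]),
  ([0, 3, 0, 5, 5, 5, 5, 5, 5], [[16, 8, 12, 10, 2, 3, 15, 18, 9], [18, 9, 17, 7, 1, 16, 4, 13,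
  10], [7, 14, 10, 2, 8, 1, 9, 6, 4]]),
  ([0, 3, 3, 3, 3, 3, 3, 3], [[3, 9, 16, 8, 5, 15, 12, 19], [5, 10, 18, 8, 17, 16, 9, 13], [14, 10,
  8, 6, 7, 4, 15, 20]]),
  ([0, 3, 4, 4, 5, 0, 8, 0, 10], [[16, 8, 10, 19, 5, 3, 12, 18, 9], [5, 13, 18, 16, 9, 8, 4, 1,
  11], [9, 15, 14, 1, 7, 4, 2, 20, 10]]),
  ([0, 3, 4, 4, 5, 5, 8], [[15, 18, 8, 10, 5, 3, 12], [8, 4, 7, 18, 17, 11, 16], [7, 14, 6, 8, 4,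
  2, 1]]),
  ([0, 3, 3, 0, 6, 6, 7, 7], [[2, 5, 18, 15, 3, 12, 8, 16], [8, 11, 18, 10, 9, 1, 5, 4], [2, 8, 15,
  14, 10, 4, 9, 1]]),
  ([0, 3, 0, 5, 6, 6, 6, 0, 10], [[16, 8, 9, 15, 12, 18, 3, 10, 5], [18, 9, 1, 11, 4, 16, 7, 10,
  5], [20, 10, 4, 2, 15, 1, 8, 14, 7]]),
  ([0, 3, 3, 3, 0, 7, 0, 9, 9], [[18, 9, 2, 16, 10, 5, 15, 12, 3], [8, 7, 4, 1, 11, 16, 10, 18,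
  13], [8, 1, 7, 4, 20, 10, 2, 14, 9]]),
  ([0, 3, 3, 3, 6, 6, 6], [[10, 16, 5, 15, 3, 12, 18], [13, 5, 17, 8, 7, 1, 4], [14, 6, 7, 8, 9, 4,
  20]]),
  ([0, 3, 0, 5, 0, 7, 7, 7, 7], [[10, 5, 16, 8, 12, 9, 18, 3, 15], [18, 9, 16, 8, 11, 7, 10, 1, 4],
  [7, 14, 9, 15, 10, 8, 6, 4, 2]]),
  ([0, 3, 3, 0, 6, 6, 6, 6], [[12, 15, 18, 8, 5, 19, 3, 10], [16, 11, 5, 17, 10, 8, 9, 7], [15, 1,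
  14, 6, 7, 20, 4, 2]]),
  ([0, 3, 3, 3, 3, 3, 0, 9], [[3, 16, 9, 15, 12, 8, 10, 5], [8, 7, 18, 4, 1, 11, 5, 13], [7, 1, 20,
  14, 8, 6, 4, 2]]),
  ([0, 3, 3, 3, 3, 3, 3], [[12, 15, 18, 10, 9, 2, 3], [8, 11, 7, 16, 18, 1, 13], [8, 15, 6, 9, 2,
  14, 20]]),
  ([0, 3, 0, 5, 0, 7, 6, 0, 10], [[3, 12, 9, 15, 10, 5, 18, 16, 8], [13, 17, 11, 16, 10, 5, 8, 18,
  9], [14, 7, 8, 4, 9, 15, 2, 20, 10]]),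
  ([0, 3, 0, 5, 6, 6, 0, 9], [[9, 15, 3, 12, 10, 2, 16, 8], [1, 11, 18, 9, 13, 17, 10, 5], [20, 10,
  7, 14, 6, 8, 2, 1]]),
  ([0, 3, 3, 5, 0, 7, 7], [[3, 9, 15, 18, 10, 12, 19], [5, 4, 1, 11, 8, 16, 13], [7, 8, 20, 10, 15,
  1, 14]]),
  ([0, 3, 3, 3, 4, 0, 8], [[18, 3, 9, 15, 12, 10, 5], [5, 13, 1, 4, 17, 16, 8], [8, 20, 9, 4, 10,
  7, 14]]),
  ([0, 3, 3, 5, 5, 5], [[12, 15, 18, 8, 10, 9], [4, 7, 18, 9, 5, 13], [1, 8, 14, 15, 20, 7]]),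
  ([0, 3, 4, 4, 4, 4], [[9, 15, 10, 5, 12, 3], [5, 13, 4, 16, 9, 18], [4, 2, 9, 14, 15, 8]]),
  ([0, 3, 3, 3, 3, 3], [[18, 9, 8, 3, 15, 10], [5, 18, 8, 10, 16, 13], [9, 20, 10, 2, 7, 15]]),
  ([0, 3, 4, 0, 6, 0, 8], [[9, 15, 18, 16, 8, 10, 5], [1, 11, 16, 10, 5, 13, 17], [4, 2, 1, 20, 10,
  9, 15]]),
  ([0, 3, 4, 5, 5], [[18, 9, 15, 3, 12], [16, 8, 4, 7, 18], [4, 2, 1, 8, 14]]),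
  ([0, 3, 3, 0, 6, 6], [[15, 3, 12, 10, 8, 2], [1, 18, 4, 5, 10, 16], [2, 14, 9, 15, 7, 8]]),
  ([0, 3, 0, 5, 5, 5], [[3, 12, 15, 10, 5, 18], [10, 5, 1, 9, 13, 11], [20, 10, 2, 15, 1, 8]]),
  ([0, 3, 3, 3, 3], [[8, 3, 19, 10, 5], [10, 18, 9, 13, 1], [1, 14, 8, 7, 15]]),
  ([0, 3, 4, 0, 6], [[15, 18, 9, 3, 12], [11, 16, 8, 13, 17], [8, 4, 2, 20, 10]]),
  ([0, 3, 0, 5, 5], [[10, 5, 16, 19, 18], [1, 11, 18, 8, 10], [4, 2, 7, 1, 6]]),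
  ([0, 3, 3, 3], [[9, 12, 15, 18], [11, 10, 1, 16], [9, 7, 2, 15]]),
  ([0, 3, 0, 5], [[3, 12, 15, 18], [10, 5, 13, 17], [8, 4, 7, 14]]),
  ([0, 3, 3], [[15, 3, 12], [9, 4, 5], [2, 14, 9]]),
  ([0, 3], [[3, 12], [18, 9], [14, 7]]),
  ([], [[]])]

set_option maxRecDepth 100000 in
lemma isCertificate10 : IsCertificate 10 labelSets10 cores10 := by decide +kernel

/-- Families of label sets for the trees in `cores11`. -/
def labelSets11 : List (List (List ℕ)) :=
  [[[3, 4, 5, 7, 8, 9, 11, 13, 14, 18, 19, 20], [1, 2, 4, 6, 7, 8, 11, 15, 16, 17, 18, 19], [1, 3,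
  6, 8, 9, 10, 11, 12, 13, 16, 18, 21, 22]]]

/-- Cores of universal trees of order `23` with balanced labellings. -/
def cores11 : List (List ℕ × List (List ℕ)) := [
  ([0, 3, 3, 5, 5, 5, 4, 4, 0, 11, 11], [[5, 20, 8, 13, 18, 4, 9, 11, 3, 7, 19], [17, 2, 15, 4, 19,
  11, 7, 18, 1, 16, 8], [11, 13, 21, 9, 12, 22, 10, 3, 1, 16, 8]]),
  ([0, 3, 3, 3, 4, 4, 4, 0, 10, 11, 11], [[5, 14, 8, 20, 7, 11, 3, 18, 9, 19, 13], [15, 8, 19, 7,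
  6, 2, 4, 11, 17, 16, 1], [12, 9, 6, 3, 1, 8, 16, 22, 11, 21, 13]]),
  ([0, 3, 3, 3, 4, 4, 4, 0, 10, 10, 10], [[14, 18, 7, 19, 13, 9, 5, 8, 11, 4, 20], [15, 8, 7, 19,
  2, 6, 4, 11, 16, 18, 17], [9, 16, 21, 11, 13, 3, 8, 1, 18, 12, 6]]),
  ([0, 3, 4, 5, 6, 6, 7, 7, 7, 7], [[3, 13, 18, 9, 4, 5, 7, 8, 19, 20], [16, 8, 4, 2, 7, 18, 1, 11,
  19, 6], [3, 13, 18, 9, 11, 21, 22, 12, 1, 10]]),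
  ([0, 3, 4, 4, 5, 5, 5, 5, 9, 9], [[13, 18, 14, 4, 9, 11, 3, 5, 7, 19], [4, 2, 7, 18, 11, 6, 1,
  19, 16, 8], [6, 3, 10, 16, 1, 9, 11, 22, 13, 21]]),
  ([0, 3, 3, 3, 4, 7, 0, 9, 9, 9, 9], [[14, 3, 7, 11, 13, 18, 5, 20, 19, 9, 8], [11, 7, 17, 4, 15,
  19, 1, 6, 8, 16, 18], [1, 18, 6, 12, 9, 16, 11, 8, 3, 13, 21]]),
  ([0, 3, 3, 3, 0, 7, 7, 9, 9, 9, 9], [[13, 9, 18, 4, 3, 7, 19, 8, 14, 11, 5], [8, 15, 4, 16, 2,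
  18, 7, 11, 1, 19, 6], [16, 8, 3, 13, 6, 18, 11, 22, 10, 12, 1]]),
  ([0, 3, 0, 5, 5, 5, 5, 7, 7, 7, 7], [[3, 13, 11, 14, 4, 20, 7, 19, 8, 18, 9], [8, 4, 17, 15, 2,
  1, 16, 18, 7, 6, 19], [3, 13, 22, 10, 6, 12, 16, 18, 21, 11, 8]]),
  ([0, 3, 3, 4, 4, 4, 4, 4, 0, 11, 0, 13], [[11, 14, 20, 19, 9, 7, 18, 5, 8, 4, 3, 13], [6, 11, 18,
  17, 19, 4, 7, 15, 2, 1, 16, 8], [1, 21, 3, 22, 8, 10, 13, 11, 12, 6, 9, 16]]),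
  ([0, 3, 3, 5, 5, 4, 4, 4, 4, 4], [[3, 18, 8, 20, 11, 5, 9, 4, 13, 14], [19, 11, 8, 6, 2, 4, 18,
  17, 7, 16], [22, 13, 9, 21, 11, 12, 1, 3, 10, 18]]),
  ([0, 3, 3, 3, 6, 4, 4, 4, 4, 4], [[5, 14, 20, 8, 4, 11, 3, 18, 19, 7], [4, 2, 11, 16, 8, 18, 1,
  19, 6, 7], [21, 18, 3, 22, 11, 10, 12, 8, 9, 6]]),
  ([0, 3, 3, 3, 3, 0, 8, 8, 8, 8, 8], [[9, 14, 13, 19, 18, 8, 3, 4, 11, 20, 5], [18, 2, 1, 17, 16,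
  15, 7, 11, 8, 4, 19], [18, 6, 12, 8, 10, 22, 21, 13, 1, 9, 11]]),
  ([0, 3, 3, 0, 6, 0, 8, 8, 8, 8, 8, 8], [[20, 13, 7, 8, 4, 14, 19, 5, 3, 18, 11, 9], [11, 19, 15,
  4, 2, 1, 7, 17, 8, 16, 6, 18], [3, 18, 8, 9, 16, 11, 21, 1, 22, 10, 12, 13]]),
  ([0, 3, 3, 3, 3, 3, 3, 0, 10, 10, 10], [[11, 7, 14, 8, 20, 3, 4, 18, 9, 13, 5], [11, 4, 18, 15,
  16, 7, 19, 2, 17, 8, 1], [8, 13, 9, 22, 18, 10, 21, 12, 6, 11, 1]]),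
  ([0, 3, 3, 3, 3, 3, 3, 3, 8, 0, 12], [[8, 13, 20, 3, 11, 18, 5, 4, 9, 14, 7], [11, 15, 19, 17, 7,
  16, 4, 18, 8, 2, 1], [9, 8, 16, 10, 3, 22, 1, 6, 11, 13, 18]]),
  ([0, 3, 3, 4, 4, 4, 4, 4, 4, 4], [[4, 14, 13, 5, 11, 7, 3, 9, 19, 18], [19, 8, 11, 6, 15, 1, 4,
  2, 7, 16], [22, 1, 21, 12, 11, 8, 13, 6, 18, 16]]),
  ([0, 3, 4, 5, 0, 7, 8, 9, 9, 0, 12], [[3, 13, 18, 9, 5, 14, 7, 11, 19, 8, 4], [16, 8, 4, 2, 7,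
  15, 19, 18, 1, 11, 17], [18, 9, 16, 8, 21, 22, 11, 10, 1, 12, 6]]),
  ([0, 3, 4, 4, 5, 0, 8, 0, 10, 11, 11], [[5, 14, 3, 11, 13, 18, 9, 8, 4, 7, 20], [8, 4, 11, 16,
  17, 7, 15, 2, 1, 6, 18], [21, 22, 16, 6, 8, 18, 9, 3, 13, 12, 1]]),
  ([0, 3, 3, 0, 6, 6, 7, 0, 10, 9, 9], [[14, 3, 11, 13, 8, 5, 4, 18, 9, 20, 7], [1, 6, 18, 2, 8,
  17, 4, 15, 19, 11, 16], [1, 16, 8, 21, 12, 9, 6, 3, 13, 11, 18]]),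
  ([0, 3, 3, 4, 4, 0, 8, 8, 6, 6], [[9, 19, 13, 5, 14, 18, 11, 7, 8, 20], [2, 7, 18, 19, 11, 17,
  16, 1, 4, 15], [18, 12, 6, 3, 9, 22, 1, 21, 10, 16]]),
  ([0, 3, 4, 5, 0, 7, 8, 0, 10, 10, 10], [[3, 13, 18, 9, 5, 14, 7, 8, 4, 20, 11], [8, 4, 2, 1, 7,
  15, 19, 11, 18, 16, 17], [13, 18, 9, 16, 1, 12, 6, 21, 10, 22, 11]]),
  ([0, 3, 3, 3, 0, 7, 5, 8, 4, 4], [[5, 19, 14, 9, 3, 13, 7, 18, 11, 8], [2, 1, 8, 17, 7, 15, 4,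
  19, 18, 6], [18, 9, 6, 12, 21, 22, 3, 11, 1, 8]]),
  ([0, 3, 4, 4, 6, 6, 6, 8, 8], [[13, 18, 4, 14, 5, 7, 9, 19, 11], [8, 4, 16, 11, 15, 19, 17, 1,
  18], [13, 18, 12, 6, 21, 8, 3, 22, 9]]),
  ([0, 3, 3, 3, 4, 4, 4, 6, 0, 11], [[8, 3, 4, 5, 19, 13, 7, 14, 18, 9], [4, 2, 16, 11, 1, 7, 18,
  17, 15, 19], [12, 6, 22, 13, 3, 21, 8, 18, 9, 16]]),
  ([0, 3, 3, 3, 0, 7, 7, 7, 10, 10], [[14, 7, 3, 11, 13, 9, 18, 4, 8, 19], [11, 18, 17, 16, 2, 6,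
  1, 19, 15, 4], [3, 13, 8, 18, 9, 21, 11, 16, 10, 6]]),
  ([0, 3, 4, 5, 0, 7, 7, 7, 7, 11], [[3, 13, 18, 9, 19, 5, 8, 11, 14, 7], [16, 8, 4, 2, 7, 6, 19,
  1, 11, 17], [1, 12, 6, 3, 8, 10, 22, 21, 9, 16]]),
  ([0, 3, 4, 5, 5, 5, 5, 8, 8], [[3, 13, 18, 7, 14, 4, 11, 8, 19], [4, 2, 1, 18, 17, 7, 6, 19, 11],
  [1, 12, 6, 13, 18, 11, 16, 8, 3]]),
  ([0, 3, 3, 4, 4, 6, 6, 6, 6], [[18, 4, 14, 8, 19, 11, 20, 5, 3], [15, 4, 11, 19, 8, 2, 1, 17,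
  18], [8, 22, 9, 1, 21, 18, 13, 11, 6]]),
  ([0, 3, 3, 3, 3, 0, 8, 8, 8, 9], [[7, 11, 3, 4, 19, 13, 5, 18, 8, 14], [8, 6, 1, 7, 2, 15, 11, 4,
  19, 17], [22, 12, 21, 1, 10, 6, 16, 13, 3, 8]]),
  ([0, 3, 3, 3, 3, 4, 4, 4, 4], [[4, 8, 7, 20, 19, 5, 3, 13, 18], [2, 19, 8, 17, 6, 18, 15, 4, 1],
  [8, 10, 18, 21, 13, 22, 1, 11, 9]]),
  ([0, 3, 4, 0, 6, 0, 8, 8, 8, 8, 8], [[13, 18, 9, 14, 7, 8, 3, 4, 20, 5, 11], [16, 8, 4, 11, 17,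
  2, 7, 19, 6, 18, 1], [12, 6, 3, 13, 18, 9, 11, 1, 16, 21, 8]]),
  ([0, 3, 0, 5, 5, 7, 7, 7, 7, 7], [[8, 4, 11, 20, 14, 19, 7, 9, 18, 5], [2, 1, 6, 18, 11, 19, 7,
  4, 15, 17], [13, 18, 22, 10, 12, 9, 11, 6, 3, 1]]),
  ([0, 3, 3, 3, 3, 3, 0, 9, 9, 9], [[8, 11, 18, 20, 4, 13, 5, 14, 9, 19], [2, 17, 7, 18, 8, 1, 15,
  19, 11, 4], [9, 22, 16, 3, 10, 6, 1, 12, 11, 13]]),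
  ([0, 3, 0, 5, 5, 5, 5, 5, 5, 0, 12], [[5, 14, 4, 8, 7, 9, 18, 20, 19, 3, 13], [4, 2, 1, 17, 16,
  18, 6, 7, 8, 15, 19], [6, 3, 10, 9, 21, 11, 12, 22, 1, 13, 18]]),
  ([0, 3, 3, 3, 3, 3, 3, 0, 10, 10], [[9, 18, 13, 14, 5, 4, 19, 8, 11, 20], [18, 2, 7, 11, 16, 17,
  1, 19, 4, 15], [22, 10, 12, 6, 9, 13, 16, 21, 18, 3]]),
  ([0, 3, 3, 3, 3, 3, 3, 3, 0, 11], [[8, 18, 4, 3, 13, 5, 11, 20, 14, 7], [11, 7, 18, 4, 19, 15,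
  16, 17, 2, 1], [9, 1, 22, 21, 16, 11, 10, 8, 3, 13]]),
  ([0, 3, 3, 3, 3, 3, 3, 3, 3], [[4, 20, 18, 19, 9, 13, 7, 14, 8], [19, 11, 1, 2, 18, 17, 4, 8,
  15], [22, 10, 21, 13, 1, 9, 6, 16, 12]]),
  ([0, 3, 0, 5, 4, 6, 7, 0, 10, 10], [[3, 13, 5, 14, 18, 7, 9, 4, 8, 19], [8, 4, 7, 15, 2, 19, 1,
  11, 16, 18], [18, 9, 21, 22, 16, 11, 8, 13, 12, 1]]),
  ([0, 3, 3, 5, 4, 6, 6, 9], [[8, 3, 5, 14, 13, 19, 18, 9], [18, 7, 11, 17, 15, 1, 16, 8], [21, 3,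
  18, 9, 13, 8, 1, 12]]),
  ([0, 3, 3, 0, 6, 0, 8, 8, 10, 10], [[18, 5, 13, 8, 4, 14, 11, 3, 19, 7], [11, 4, 7, 15, 19, 18,
  17, 1, 8, 16], [3, 18, 8, 21, 22, 16, 6, 10, 1, 9]]),
  ([0, 3, 3, 3, 4, 7, 0, 9, 0, 11], [[3, 13, 19, 7, 18, 9, 5, 14, 8, 4], [2, 7, 18, 1, 15, 19, 11,
  17, 16, 8], [9, 3, 6, 16, 13, 18, 21, 22, 1, 12]]),
  ([0, 3, 4, 4, 0, 7, 5, 5, 5], [[8, 4, 14, 13, 18, 9, 11, 3, 7], [7, 15, 11, 4, 2, 1, 17, 18, 16],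
  [22, 11, 16, 18, 12, 6, 3, 13, 8]]),
  ([0, 3, 3, 3, 0, 7, 7, 0, 10, 10], [[8, 18, 4, 13, 19, 5, 14, 20, 9, 11], [11, 17, 18, 16, 2, 6,
  19, 15, 7, 8], [3, 13, 16, 10, 12, 1, 11, 8, 9, 22]]),
  ([0, 3, 3, 3, 5, 5, 5, 0, 10], [[5, 19, 14, 9, 3, 7, 11, 13, 18], [7, 15, 11, 19, 16, 18, 17, 8,
  4], [13, 1, 18, 12, 9, 8, 10, 21, 22]]),
  ([0, 3, 0, 5, 6, 6, 6, 6, 7], [[8, 4, 5, 14, 3, 18, 19, 11, 13], [7, 15, 2, 1, 8, 16, 18, 6, 4],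
  [9, 16, 12, 6, 21, 11, 8, 18, 22]]),
  ([0, 3, 3, 3, 3, 4, 4, 7], [[4, 13, 18, 9, 14, 5, 8, 7], [11, 4, 18, 16, 7, 8, 19, 15], [10, 9,
  12, 1, 21, 3, 6, 22]]),
  ([0, 3, 3, 3, 3, 0, 8, 8, 8], [[9, 14, 19, 18, 13, 8, 4, 5, 3], [11, 16, 15, 18, 19, 8, 4, 2, 6],
  [13, 10, 12, 3, 1, 16, 18, 8, 21]]),
  ([0, 3, 4, 5, 5, 5, 5, 5], [[3, 13, 18, 7, 4, 9, 11, 14], [8, 4, 2, 18, 6, 7, 1, 19], [3, 13, 18,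
  10, 6, 12, 8, 9]]),
  ([0, 3, 3, 3, 3, 3, 5, 5], [[18, 14, 4, 9, 13, 5, 19, 8], [2, 17, 8, 18, 1, 7, 16, 15], [6, 11,
  21, 18, 3, 8, 9, 12]]),
  ([0, 3, 3, 3, 3, 3, 3, 9], [[11, 8, 14, 4, 20, 7, 3, 13], [19, 11, 15, 8, 1, 18, 4, 2], [6, 21,
  16, 11, 13, 8, 18, 9]]),
  ([0, 3, 3, 3, 3, 3, 3, 3], [[18, 7, 4, 5, 14, 11, 9, 13], [8, 4, 7, 1, 15, 2, 16, 6], [12, 3, 11,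
  1, 6, 9, 22, 13]]),
  ([0, 3, 4, 0, 6, 7, 5, 0, 10], [[3, 13, 18, 5, 14, 7, 9, 8, 4], [8, 4, 2, 7, 15, 19, 1, 11, 17],
  [13, 18, 9, 1, 12, 6, 16, 21, 22]]),
  ([0, 3, 0, 5, 4, 4, 6, 0, 10], [[5, 14, 13, 18, 11, 3, 9, 8, 4], [11, 17, 8, 4, 1, 16, 2, 7, 15],
  [18, 9, 1, 12, 10, 22, 6, 3, 13]]),
  ([0, 3, 3, 0, 6, 0, 8, 8, 0, 11], [[7, 19, 11, 8, 4, 9, 18, 14, 3, 13], [1, 6, 18, 8, 4, 19, 17,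
  2, 7, 15], [18, 10, 8, 21, 22, 6, 16, 13, 1, 12]]),
  ([0, 3, 3, 4, 4, 6, 6], [[13, 9, 4, 14, 18, 11, 3], [2, 17, 8, 11, 6, 19, 15], [9, 21, 11, 18, 3,
  10, 8]]),
  ([0, 3, 4, 5, 5, 5, 7], [[3, 13, 18, 9, 14, 4, 7], [8, 4, 2, 1, 7, 18, 15], [13, 18, 9, 10, 16,
  22, 8]]),
  ([0, 3, 3, 3, 4, 0, 8, 8], [[3, 13, 19, 7, 18, 5, 20, 8], [7, 11, 15, 19, 17, 6, 2, 4], [22, 9,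
  13, 11, 16, 18, 10, 8]]),
  ([0, 3, 3, 3, 6, 6, 6], [[8, 3, 4, 5, 14, 19, 9], [4, 16, 2, 11, 15, 17, 19], [21, 12, 22, 9, 16,
  3, 6]]),
  ([0, 3, 4, 4, 4, 4, 8], [[5, 14, 19, 3, 11, 18, 9], [15, 19, 1, 8, 18, 11, 17], [9, 16, 18, 10,
  21, 6, 3]]),
  ([0, 3, 3, 5, 5, 5, 5], [[14, 19, 18, 5, 11, 7, 13], [18, 1, 17, 15, 11, 2, 6], [18, 6, 12, 13,
  11, 22, 1]]),
  ([0, 3, 4, 4, 4, 4, 4], [[5, 14, 19, 7, 11, 18, 3], [16, 8, 4, 2, 6, 1, 7], [12, 6, 3, 16, 13,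
  18, 11]]),
  ([0, 3, 3, 3, 3, 3, 3], [[11, 20, 14, 7, 8, 4, 3], [11, 19, 16, 15, 18, 7, 4], [8, 9, 18, 21, 13,
  22, 10]]),
  ([0, 3, 4, 0, 6, 0, 8, 5], [[3, 13, 18, 8, 4, 14, 7, 9], [16, 8, 4, 7, 15, 11, 17, 2], [6, 3, 13,
  9, 16, 22, 11, 18]]),
  ([0, 3, 0, 5, 4, 4, 0, 9], [[8, 4, 18, 9, 7, 20, 5, 14], [2, 1, 16, 8, 7, 17, 15, 19], [12, 6,
  22, 11, 21, 8, 18, 9]]),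
  ([0, 3, 0, 5, 5, 4, 4], [[8, 4, 19, 5, 14, 20, 7], [16, 8, 2, 6, 19, 7, 1], [16, 8, 6, 18, 11,
  10, 21]]),
  ([0, 3, 0, 5, 0, 7, 7, 7], [[18, 9, 14, 7, 8, 5, 3, 4], [15, 19, 4, 2, 11, 18, 16, 17], [6, 3,
  18, 9, 22, 21, 1, 11]]),
  ([0, 3, 3, 3, 4, 4], [[18, 4, 9, 14, 7, 20], [11, 17, 16, 18, 2, 15], [13, 18, 3, 10, 12, 6]]),
  ([0, 3, 3, 3, 3, 0, 8], [[11, 7, 20, 14, 4, 3, 13], [19, 8, 1, 11, 18, 4, 2], [6, 21, 18, 11, 8,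
  3, 13]]),
  ([0, 3, 3, 3, 3, 3], [[3, 13, 8, 18, 19, 7], [8, 6, 7, 2, 4, 1], [9, 1, 3, 16, 8, 6]]),
  ([0, 3, 0, 5, 0, 7, 6], [[18, 9, 5, 14, 8, 4, 7], [15, 19, 4, 2, 16, 8, 1], [12, 6, 9, 16, 21,
  22, 8]]),
  ([0, 3, 4, 5, 5], [[13, 18, 9, 5, 4], [8, 4, 2, 19, 6], [21, 22, 11, 8, 3]]),
  ([0, 3, 3, 5, 5], [[11, 3, 8, 18, 13], [6, 4, 2, 8, 17], [13, 10, 3, 8, 18]]),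
  ([0, 3, 0, 5, 5, 5], [[14, 7, 18, 9, 5, 13], [15, 19, 11, 4, 7, 17], [12, 6, 18, 8, 9, 10]]),
  ([0, 3, 3, 3, 3], [[11, 14, 4, 7, 20], [1, 18, 7, 6, 17], [11, 13, 21, 8, 3]]),
  ([0, 3, 4, 5], [[3, 13, 18, 9], [8, 4, 2, 1], [6, 3, 13, 18]]),
  ([0, 3, 4, 4], [[8, 4, 18, 9], [15, 19, 11, 8], [21, 22, 6, 16]]),
  ([0, 3, 3, 3], [[3, 19, 13, 7], [2, 6, 19, 1], [18, 9, 6, 12]]),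
  ([0, 3, 0, 5], [[5, 14, 3, 13], [15, 19, 4, 2], [1, 12, 18, 9]]),
  ([0, 3, 3], [[3, 8, 18], [17, 15, 2], [18, 10, 8]]),
  ([0, 3], [[18, 9], [2, 1], [16, 8]]),
  ([], [[]])]

set_option maxRecDepth 100000 in
lemma isCertificate11 : IsCertificate 11 labelSets11 cores11 := by decide +kernel

/-- Families of label sets for the trees in `cores12`. -/
def labelSets12 : List (List (List ℕ)) :=
  [[[1, 2, 5, 7, 8, 9, 10, 11, 13, 15, 16, 18, 19, 20, 22], [1, 2, 3, 5, 6, 8, 9, 10, 11, 13, 17,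
  20, 21, 23, 24], [4, 7, 8, 10, 11, 12, 18, 19, 21, 22, 23, 24]]]

/-- Cores of universal trees of order `25` with balanced labellings. -/
def cores12 : List (List ℕ × List (List ℕ)) := [
  ([0, 3, 4, 5, 5, 5, 5, 7, 7, 7, 7], [[15, 20, 10, 1, 13, 9, 22, 11, 8, 5, 2], [20, 10, 5, 2, 9,
  3, 21, 11, 1, 8, 23], [22, 11, 18, 24, 19, 8, 10, 23, 12, 7, 21]]),
  ([0, 3, 3, 3, 3, 4, 4, 8, 8, 8, 8], [[15, 13, 7, 8, 2, 20, 18, 11, 1, 9, 19], [8, 23, 24, 9, 10,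
  3, 20, 11, 1, 17, 2], [12, 19, 4, 18, 8, 21, 23, 10, 11, 22, 24]]),
  ([0, 3, 3, 3, 3, 3, 7, 7, 5, 5, 11], [[5, 11, 10, 20, 15, 19, 8, 7, 1, 9, 13], [21, 11, 23, 8,
  10, 13, 9, 1, 6, 17, 3], [8, 10, 21, 4, 12, 23, 18, 19, 22, 24, 11]]),
  ([0, 3, 3, 3, 5, 5, 7, 7, 7, 7, 7], [[10, 22, 13, 5, 2, 11, 19, 8, 1, 7, 20], [10, 11, 5, 24, 9,
  21, 6, 1, 3, 8, 17], [19, 23, 21, 22, 11, 10, 7, 4, 18, 12, 24]]),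
  ([0, 3, 4, 4, 4, 4, 7, 7, 7, 7, 7], [[5, 15, 8, 7, 22, 18, 13, 2, 11, 20, 9], [10, 5, 2, 3, 17,
  13, 21, 9, 8, 6, 11], [8, 4, 11, 10, 19, 18, 7, 12, 21, 22, 23]]),
  ([0, 3, 3, 3, 3, 3, 6, 6, 6, 6, 6], [[18, 9, 2, 16, 5, 13, 22, 19, 1, 15, 8], [21, 10, 23, 1, 20,
  11, 17, 13, 2, 24, 9], [19, 23, 22, 11, 8, 21, 4, 12, 7, 18, 24]]),
  ([0, 3, 0, 5, 6, 6, 6, 6, 6, 6, 12, 12], [[10, 5, 1, 13, 16, 2, 11, 20, 18, 22, 15, 7], [2, 1, 6,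
  3, 8, 23, 11, 5, 17, 20, 21, 24], [24, 12, 8, 4, 7, 18, 10, 11, 22, 19, 21, 23]]),
  ([0, 3, 3, 5, 5, 5, 5, 5, 5, 9, 9], [[13, 18, 20, 9, 19, 1, 15, 11, 5, 7, 8], [1, 17, 9, 3, 6,
  10, 23, 24, 11, 2, 21], [7, 24, 8, 21, 23, 10, 12, 11, 22, 19, 18]]),
  ([0, 3, 3, 3, 3, 3, 3, 0, 10, 9, 9, 9], [[15, 7, 22, 13, 8, 18, 2, 20, 10, 16, 1, 11], [11, 3, 8,
  13, 1, 10, 23, 9, 17, 24, 2, 21], [4, 18, 11, 21, 10, 8, 19, 23, 24, 7, 22, 12]]),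
  ([0, 3, 4, 0, 6, 6, 6, 6, 6, 6, 6, 6], [[15, 20, 10, 2, 22, 16, 19, 8, 5, 18, 9, 11], [20, 10, 5,
  9, 21, 3, 8, 23, 6, 13, 11, 1], [23, 24, 12, 4, 8, 11, 7, 22, 10, 18, 19, 21]]),
  ([0, 3, 3, 3, 3, 3, 3, 3, 3, 10, 10], [[15, 5, 2, 18, 7, 22, 13, 10, 8, 1, 9], [1, 23, 24, 5, 21,
  2, 9, 17, 3, 6, 11], [4, 18, 19, 21, 7, 22, 10, 11, 8, 24, 12]]),
  ([0, 3, 3, 5, 4, 6, 6, 9, 0, 11, 8], [[20, 18, 2, 1, 9, 19, 7, 16, 5, 15, 22], [11, 9, 2, 1, 17,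
  6, 20, 10, 21, 23, 3], [7, 21, 11, 18, 23, 19, 24, 12, 8, 4, 22]]),
  ([0, 3, 3, 5, 4, 0, 8, 8, 10, 0, 12, 12], [[16, 15, 1, 13, 20, 2, 5, 22, 11, 19, 9, 10], [8, 2,
  6, 3, 1, 13, 17, 21, 23, 20, 11, 9], [18, 21, 22, 11, 23, 7, 8, 24, 12, 4, 10, 19]]),
  ([0, 3, 0, 5, 5, 0, 8, 8, 9, 9, 7, 7], [[11, 18, 22, 2, 20, 1, 19, 7, 10, 9, 15, 5], [9, 17, 3,
  20, 8, 6, 1, 5, 24, 2, 23, 10], [23, 24, 7, 10, 22, 19, 8, 11, 12, 21, 18, 4]]),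
  ([0, 3, 4, 0, 6, 7, 7, 7, 9, 9, 10], [[2, 1, 13, 22, 11, 16, 20, 18, 5, 15, 9], [17, 21, 23, 20,
  10, 8, 5, 2, 6, 24, 1], [21, 23, 24, 19, 22, 10, 12, 11, 8, 4, 18]]),
  ([0, 3, 4, 4, 5, 5, 0, 9, 9, 9, 0, 13], [[18, 9, 2, 7, 19, 8, 1, 13, 16, 10, 5, 15], [2, 1, 21,
  5, 13, 8, 9, 11, 17, 23, 20, 10], [8, 4, 19, 10, 12, 7, 21, 22, 24, 23, 11, 18]]),
  ([0, 3, 3, 5, 5, 5, 7, 7, 0, 11, 11], [[20, 1, 19, 22, 11, 8, 9, 2, 18, 5, 13], [2, 10, 17, 9, 8,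
  21, 20, 13, 11, 5, 6], [8, 10, 23, 24, 11, 12, 7, 4, 18, 21, 22]]),
  ([0, 3, 3, 3, 0, 7, 4, 4, 4, 8, 8], [[13, 2, 19, 11, 10, 5, 9, 18, 1, 22, 8], [6, 10, 21, 3, 23,
  24, 8, 5, 2, 13, 11], [23, 19, 4, 24, 11, 18, 22, 7, 12, 8, 10]]),
  ([0, 3, 3, 3, 5, 5, 5, 7, 7, 7], [[20, 19, 10, 1, 22, 13, 5, 15, 7, 11], [20, 3, 10, 17, 1, 5, 9,
  13, 2, 24], [21, 11, 23, 10, 19, 24, 4, 22, 7, 12]]),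
  ([0, 3, 3, 3, 3, 5, 4, 0, 10, 10, 0, 13], [[8, 1, 15, 7, 18, 20, 13, 11, 2, 9, 19, 22], [3, 1,
  20, 2, 8, 10, 13, 11, 6, 5, 9, 17], [7, 22, 8, 10, 24, 4, 11, 12, 18, 19, 21, 23]]),
  ([0, 3, 3, 5, 5, 4, 4, 4, 4, 0, 12], [[15, 10, 5, 19, 11, 1, 22, 9, 13, 7, 16], [13, 10, 3, 11,
  17, 9, 1, 2, 8, 21, 23], [22, 4, 18, 7, 11, 21, 8, 19, 10, 24, 12]]),
  ([0, 3, 4, 0, 6, 6, 6, 8, 8, 8, 8], [[5, 15, 20, 13, 2, 19, 11, 9, 10, 18, 1], [20, 10, 5, 21,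
  13, 8, 23, 24, 2, 9, 6], [23, 24, 12, 11, 4, 18, 7, 22, 21, 10, 8]]),
  ([0, 3, 3, 5, 5, 5, 8, 8, 8, 8], [[8, 7, 1, 15, 11, 13, 22, 16, 18, 20], [23, 17, 6, 3, 10, 21,
  1, 8, 13, 20], [23, 12, 11, 18, 4, 7, 24, 8, 22, 10]]),
  ([0, 3, 3, 3, 3, 6, 6, 6, 6, 10], [[15, 5, 7, 10, 8, 16, 19, 1, 9, 13], [21, 10, 13, 11, 8, 9, 5,
  2, 6, 1], [4, 22, 10, 19, 7, 8, 11, 23, 21, 24]]),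
  ([0, 3, 3, 4, 6, 0, 8, 8, 8, 8, 8], [[15, 13, 2, 19, 22, 11, 20, 16, 10, 1, 18], [20, 17, 3, 21,
  23, 10, 11, 5, 9, 24, 1], [18, 19, 24, 22, 11, 8, 10, 23, 21, 4, 12]]),
  ([0, 3, 3, 3, 3, 3, 0, 9, 9, 8, 8], [[16, 5, 19, 22, 11, 8, 9, 2, 7, 13, 20], [1, 13, 2, 6, 24,
  20, 9, 11, 23, 3, 17], [23, 12, 19, 24, 11, 4, 18, 10, 8, 22, 7]]),
  ([0, 3, 3, 3, 4, 4, 4, 4, 4, 0, 12], [[13, 19, 18, 20, 10, 9, 11, 8, 22, 5, 15], [1, 23, 13, 3,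
  2, 21, 6, 17, 24, 10, 5], [19, 11, 8, 22, 18, 24, 4, 7, 12, 21, 23]]),
  ([0, 3, 3, 3, 3, 3, 0, 9, 9, 9, 9], [[16, 1, 5, 8, 15, 11, 7, 19, 13, 22, 10], [21, 13, 23, 11,
  10, 8, 1, 24, 2, 17, 9], [21, 24, 22, 23, 10, 11, 12, 18, 19, 4, 8]]),
  ([0, 3, 4, 5, 0, 7, 7, 7, 7, 7, 7], [[2, 1, 13, 19, 15, 8, 5, 18, 22, 10, 7], [9, 17, 21, 23, 11,
  10, 3, 5, 6, 1, 8], [21, 23, 24, 12, 4, 7, 11, 22, 18, 10, 19]]),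
  ([0, 3, 0, 5, 5, 5, 5, 5, 5, 6, 6], [[19, 22, 18, 16, 10, 13, 5, 2, 8, 7, 9], [1, 13, 11, 2, 6,
  5, 8, 3, 9, 10, 17], [21, 23, 4, 7, 10, 19, 11, 22, 18, 24, 8]]),
  ([0, 3, 3, 3, 3, 3, 3, 7, 7, 7], [[10, 9, 13, 8, 22, 2, 1, 7, 15, 11], [11, 2, 13, 10, 23, 1, 9,
  24, 17, 6], [4, 8, 18, 11, 21, 10, 19, 23, 22, 24]]),
  ([0, 3, 3, 3, 3, 3, 3, 3, 8, 8], [[18, 5, 8, 10, 11, 9, 7, 13, 19, 15], [23, 10, 17, 24, 6, 3,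
  13, 20, 1, 2], [8, 4, 21, 11, 22, 12, 23, 10, 18, 19]]),
  ([0, 3, 0, 5, 5, 5, 5, 5, 5, 5, 5], [[22, 11, 9, 15, 8, 2, 19, 7, 16, 1, 18], [9, 17, 11, 10, 6,
  13, 8, 5, 3, 1, 23], [24, 12, 4, 21, 11, 22, 8, 10, 18, 19, 7]]),
  ([0, 3, 0, 5, 6, 4, 4, 0, 10, 7, 11], [[7, 16, 20, 10, 5, 19, 22, 11, 18, 15, 9], [1, 13, 9, 17,
  21, 11, 2, 20, 10, 23, 5], [8, 4, 21, 23, 24, 19, 10, 22, 11, 12, 18]]),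
  ([0, 3, 0, 5, 0, 7, 8, 8, 4, 4, 6], [[2, 1, 11, 18, 19, 22, 15, 7, 16, 10, 9], [17, 21, 20, 10,
  2, 1, 3, 23, 8, 13, 5], [8, 4, 21, 23, 19, 22, 10, 12, 18, 11, 24]]),
  ([0, 3, 4, 4, 6, 6, 8, 8, 9], [[15, 20, 7, 13, 2, 11, 10, 1, 5], [21, 23, 10, 13, 2, 11, 6, 5,
  3], [11, 18, 8, 10, 12, 23, 19, 4, 22]]),
  ([0, 3, 3, 0, 6, 6, 8, 8, 10, 10], [[16, 1, 15, 22, 20, 2, 9, 18, 13, 5], [17, 8, 9, 11, 13, 23,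
  2, 21, 20, 1], [10, 23, 12, 21, 24, 22, 4, 18, 7, 11]]),
  ([0, 3, 3, 4, 4, 4, 0, 9, 5, 6], [[13, 18, 20, 2, 16, 9, 5, 15, 10, 1], [10, 9, 1, 17, 3, 6, 23,
  24, 13, 21], [7, 21, 11, 24, 22, 23, 8, 4, 18, 12]]),
  ([0, 3, 3, 3, 5, 5, 7, 7, 0, 11], [[11, 10, 18, 1, 16, 2, 7, 9, 13, 19], [23, 2, 21, 24, 13, 8,
  3, 10, 9, 17], [8, 22, 4, 11, 19, 10, 7, 12, 23, 24]]),
  ([0, 3, 0, 5, 5, 5, 4, 7, 7, 7], [[1, 13, 15, 20, 7, 8, 19, 10, 16, 22], [20, 10, 9, 17, 23, 11,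
  5, 24, 21, 2], [21, 23, 19, 12, 22, 7, 24, 18, 4, 11]]),
  ([0, 3, 3, 3, 5, 5, 6, 6, 6], [[19, 18, 1, 22, 16, 10, 9, 11, 13], [23, 24, 21, 2, 13, 8, 17, 1,
  10], [19, 21, 22, 23, 18, 4, 12, 24, 11]]),
  ([0, 3, 0, 5, 5, 5, 5, 9, 6, 0, 12], [[11, 18, 7, 2, 13, 19, 5, 15, 1, 16, 8], [10, 5, 11, 2, 9,
  13, 23, 24, 1, 6, 3], [21, 23, 18, 19, 11, 7, 24, 12, 22, 8, 4]]),
  ([0, 3, 3, 3, 3, 4, 4, 6, 0, 11], [[19, 9, 8, 10, 11, 18, 16, 5, 2, 1], [9, 3, 6, 23, 11, 1, 2,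
  24, 20, 10], [19, 7, 21, 23, 12, 22, 10, 24, 11, 18]]),
  ([0, 3, 3, 0, 6, 6, 0, 9, 9, 9, 9], [[2, 18, 9, 7, 19, 13, 5, 10, 22, 20, 8], [13, 17, 21, 1, 20,
  6, 11, 8, 2, 3, 9], [23, 19, 4, 11, 24, 12, 18, 22, 8, 10, 21]]),
  ([0, 3, 3, 3, 6, 6, 6, 6, 0, 11], [[2, 5, 22, 1, 7, 10, 16, 19, 11, 18], [1, 13, 6, 20, 17, 11,
  9, 3, 21, 23], [23, 19, 24, 4, 22, 8, 7, 21, 11, 18]]),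
  ([0, 3, 3, 3, 3, 0, 8, 8, 8, 8], [[15, 5, 7, 8, 10, 22, 2, 9, 20, 13], [21, 20, 8, 1, 13, 3, 23,
  5, 17, 11], [8, 21, 23, 10, 12, 18, 7, 11, 24, 19]]),
  ([0, 3, 3, 3, 3, 3, 0, 9, 5, 0, 12], [[16, 9, 11, 5, 7, 8, 13, 19, 18, 2, 1], [21, 8, 23, 11, 10,
  13, 2, 1, 24, 6, 3], [19, 12, 23, 22, 21, 7, 8, 4, 24, 11, 18]]),
  ([0, 3, 3, 4, 0, 7, 7, 7, 7, 7], [[8, 18, 15, 9, 20, 7, 13, 19, 10, 1], [6, 10, 21, 5, 9, 1, 11,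
  17, 8, 23], [18, 8, 10, 4, 19, 7, 12, 23, 22, 21]]),
  ([0, 3, 3, 3, 3, 3, 7, 7, 7], [[15, 8, 20, 2, 13, 7, 16, 22, 19], [20, 9, 11, 24, 10, 21, 8, 5,
  2], [19, 23, 7, 21, 22, 12, 4, 11, 18]]),
  ([0, 3, 3, 3, 3, 3, 3, 7, 0, 11], [[1, 16, 8, 18, 19, 10, 7, 22, 15, 20], [1, 9, 6, 21, 20, 17,
  5, 10, 23, 24], [4, 8, 19, 10, 22, 21, 7, 11, 24, 12]]),
  ([0, 3, 3, 0, 6, 6, 6, 6, 6, 6], [[2, 16, 11, 15, 7, 22, 10, 8, 5, 18], [5, 10, 20, 1, 3, 23, 24,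
  9, 2, 17], [19, 11, 8, 22, 24, 12, 10, 23, 4, 18]]),
  ([0, 3, 3, 3, 3, 3, 3, 3, 10], [[18, 9, 16, 7, 11, 8, 2, 10, 5], [9, 24, 17, 11, 23, 10, 8, 1,
  13], [19, 23, 21, 12, 11, 7, 22, 8, 4]]),
  ([0, 3, 3, 3, 3, 3, 3, 3, 3], [[20, 11, 15, 19, 18, 5, 2, 1, 9], [8, 5, 20, 9, 24, 23, 3, 13,
  10], [18, 19, 11, 21, 8, 22, 7, 10, 24]]),
  ([0, 3, 3, 0, 6, 4, 7, 5, 0, 11], [[8, 1, 7, 22, 11, 13, 18, 16, 20, 10], [23, 17, 6, 2, 1, 21,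
  13, 3, 10, 5], [7, 8, 24, 19, 22, 4, 11, 12, 21, 23]]),
  ([0, 3, 4, 4, 0, 7, 6, 6, 0, 11], [[10, 5, 8, 22, 15, 20, 13, 9, 11, 18], [20, 10, 24, 11, 2, 1,
  13, 23, 9, 17], [11, 18, 21, 22, 8, 4, 10, 12, 23, 24]]),
  ([0, 3, 3, 0, 6, 6, 8, 9, 9], [[15, 5, 10, 13, 22, 16, 8, 7, 1], [23, 10, 13, 3, 11, 17, 21, 1,
  20], [19, 21, 23, 18, 10, 8, 4, 22, 7]]),
  ([0, 3, 0, 5, 6, 6, 6, 4, 10], [[10, 5, 19, 22, 11, 9, 13, 15, 20], [17, 21, 20, 10, 5, 2, 8, 23,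
  24], [21, 23, 22, 11, 4, 18, 7, 24, 12]]),
  ([0, 3, 3, 5, 5, 5, 0, 9, 6], [[15, 2, 13, 16, 22, 19, 20, 10, 8], [2, 10, 17, 21, 9, 8, 1, 13,
  23], [18, 24, 19, 22, 7, 12, 8, 4, 11]]),
  ([0, 3, 3, 0, 6, 6, 0, 9, 9, 9], [[2, 7, 20, 19, 8, 11, 1, 16, 10, 13], [17, 11, 6, 1, 24, 2, 21,
  23, 8, 13], [11, 4, 7, 12, 19, 18, 21, 22, 24, 23]]),
  ([0, 3, 4, 4, 4, 0, 8, 8, 8], [[7, 16, 8, 15, 1, 22, 11, 2, 20], [21, 23, 3, 24, 20, 2, 17, 1,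
  10], [19, 22, 23, 24, 11, 8, 21, 4, 12]]),
  ([0, 3, 0, 5, 4, 0, 8, 8, 8, 8], [[15, 20, 7, 16, 10, 2, 8, 5, 19, 22], [20, 10, 1, 13, 5, 8, 24,
  6, 9, 2], [23, 24, 11, 18, 12, 4, 8, 19, 10, 21]]),
  ([0, 3, 3, 3, 3, 7, 7, 8], [[7, 13, 2, 5, 19, 18, 1, 9], [13, 2, 21, 17, 11, 6, 5, 3], [7, 21,
  10, 11, 22, 24, 23, 12]]),
  ([0, 3, 3, 3, 0, 7, 7, 7, 7], [[16, 1, 15, 8, 22, 2, 9, 20, 13], [23, 6, 24, 17, 10, 2, 9, 1, 8],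
  [23, 24, 4, 19, 18, 7, 11, 21, 22]]),
  ([0, 3, 4, 4, 4, 4, 4, 8], [[5, 15, 2, 13, 20, 18, 22, 9], [17, 21, 23, 8, 13, 20, 1, 10], [21,
  23, 24, 4, 12, 11, 19, 18]]),
  ([0, 3, 3, 0, 6, 6, 6, 6, 6], [[15, 8, 7, 13, 20, 11, 2, 19, 18], [24, 21, 3, 1, 13, 9, 20, 6,
  17], [7, 22, 10, 23, 24, 19, 12, 11, 4]]),
  ([0, 3, 3, 3, 3, 3, 3, 0, 10], [[19, 11, 8, 1, 9, 18, 10, 5, 15], [10, 24, 11, 2, 1, 8, 9, 6, 3],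
  [18, 7, 21, 11, 24, 22, 19, 8, 4]]),
  ([0, 3, 3, 3, 3, 3, 3, 3], [[19, 1, 10, 11, 9, 18, 8, 22], [9, 13, 11, 23, 17, 10, 24, 21], [19,
  8, 21, 12, 7, 23, 22, 11]]),
  ([0, 3, 4, 5, 0, 7, 8, 0, 10], [[2, 1, 13, 19, 10, 5, 15, 22, 11], [9, 17, 21, 23, 2, 1, 13, 20,
  10], [19, 22, 11, 18, 23, 24, 12, 8, 4]]),
  ([0, 3, 3, 4, 0, 7, 0, 9, 10], [[2, 11, 16, 18, 15, 20, 13, 19, 22], [13, 2, 11, 1, 10, 5, 9, 17,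
  21], [4, 21, 8, 23, 24, 12, 22, 11, 18]]),
  ([0, 3, 3, 4, 0, 7, 8, 8], [[2, 5, 22, 15, 16, 8, 13, 20], [5, 9, 21, 17, 20, 10, 2, 8], [7, 21,
  11, 23, 19, 22, 4, 18]]),
  ([0, 3, 3, 0, 6, 6, 0, 9, 9], [[8, 20, 13, 2, 16, 11, 22, 7, 15], [21, 13, 8, 3, 1, 2, 6, 20,
  11], [11, 7, 4, 21, 22, 24, 8, 23, 10]]),
  ([0, 3, 4, 4, 4, 6, 0, 9], [[7, 16, 11, 5, 8, 15, 13, 19], [2, 1, 13, 6, 20, 3, 17, 21], [19, 22,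
  12, 11, 10, 18, 23, 24]]),
  ([0, 3, 3, 4, 5, 5, 5], [[8, 20, 13, 10, 19, 22, 16], [21, 1, 20, 13, 9, 10, 11], [7, 11, 21, 18,
  24, 22, 23]]),
  ([0, 3, 3, 3, 0, 7, 7, 7], [[20, 1, 19, 10, 11, 2, 18, 9], [6, 5, 3, 1, 20, 11, 10, 9], [19, 12,
  7, 22, 8, 23, 10, 4]]),
  ([0, 3, 3, 3, 3, 5, 0, 9], [[10, 20, 1, 15, 9, 13, 7, 16], [21, 11, 10, 20, 1, 5, 23, 24], [4,
  11, 19, 10, 18, 22, 21, 23]]),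
  ([0, 3, 3, 3, 3, 5, 5], [[8, 20, 18, 13, 15, 11, 7], [23, 13, 2, 21, 10, 24, 3], [11, 4, 7, 12,
  24, 22, 10]]),
  ([0, 3, 0, 5, 5, 5, 5, 5], [[20, 10, 5, 15, 19, 11, 8, 22], [6, 3, 9, 10, 8, 24, 1, 17], [8, 4,
  21, 23, 24, 11, 10, 22]]),
  ([0, 3, 3, 3, 3, 3, 3], [[2, 20, 5, 11, 7, 22, 16], [1, 9, 20, 17, 24, 2, 6], [18, 24, 8, 19, 7,
  10, 11]]),
  ([0, 3, 0, 5, 6, 4, 8], [[20, 10, 1, 13, 19, 5, 15], [9, 17, 20, 10, 5, 21, 23], [21, 23, 19, 22,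
  11, 24, 12]]),
  ([0, 3, 0, 5, 5, 0, 8, 9], [[1, 13, 10, 16, 19, 11, 18, 9], [2, 1, 23, 13, 10, 9, 17, 21], [11,
  18, 22, 12, 10, 21, 23, 24]]),
  ([0, 3, 4, 4, 6, 6], [[16, 8, 22, 11, 10, 1], [9, 17, 6, 11, 13, 23], [8, 4, 10, 19, 23, 21]]),
  ([0, 3, 3, 3, 0, 7, 0, 9], [[2, 20, 1, 7, 18, 9, 10, 5], [23, 20, 3, 24, 2, 1, 10, 5], [8, 12, 4,
  21, 23, 24, 11, 18]]),
  ([0, 3, 3, 0, 6, 6, 6], [[8, 11, 22, 15, 20, 10, 5], [23, 10, 13, 17, 9, 8, 21], [12, 19, 18, 21,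
  23, 10, 11]]),
  ([0, 3, 0, 5, 5, 5, 5], [[13, 19, 1, 18, 16, 8, 10], [17, 21, 13, 11, 8, 5, 2], [8, 4, 10, 11,
  23, 24, 12]]),
  ([0, 3, 3, 3, 3, 3], [[1, 15, 11, 10, 13, 16], [1, 5, 9, 13, 17, 21], [22, 12, 10, 11, 24, 23]]),
  ([0, 3, 4, 0, 6, 5], [[10, 5, 15, 22, 11, 20], [17, 21, 23, 10, 5, 24], [19, 22, 11, 8, 4, 18]]),
  ([0, 3, 4, 4, 5], [[13, 19, 11, 8, 18], [21, 23, 20, 3, 10], [21, 23, 11, 12, 18]]),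
  ([0, 3, 3, 4, 4], [[18, 5, 13, 11, 19], [17, 11, 6, 3, 8], [22, 4, 18, 21, 8]]),
  ([0, 3, 0, 5, 5, 5], [[2, 1, 10, 20, 15, 5], [21, 23, 10, 24, 5, 11], [21, 23, 19, 11, 8, 22]]),
  ([0, 3, 3, 3, 3], [[7, 19, 22, 10, 13], [1, 3, 24, 23, 2], [12, 18, 4, 19, 8]]),
  ([0, 3, 4, 0, 6], [[1, 13, 19, 11, 18], [2, 1, 13, 23, 24], [23, 24, 12, 19, 22]]),
  ([0, 3, 3, 5], [[20, 18, 2, 1], [3, 5, 23, 24], [7, 8, 24, 12]]),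
  ([0, 3, 3, 3], [[7, 16, 19, 13], [2, 6, 1, 21], [22, 24, 11, 23]]),
  ([0, 3, 4], [[1, 13, 19], [20, 10, 5], [22, 11, 18]]),
  ([0, 3, 3], [[1, 10, 16], [3, 2, 1], [22, 18, 4]]),
  ([0, 3], [[19, 22], [17, 21]]),
  ([], [[]])]

set_option maxRecDepth 100000 in
lemma isCertificate12 : IsCertificate 12 labelSets12 cores12 := by decide +kernel

/-- Families of label sets for the trees in `cores13`. -/
def labelSets13 : List (List (List ℕ)) :=
  [[[1, 2, 3, 4, 6, 7, 8, 9, 10, 12, 14, 16, 19, 20, 21, 22], [1, 3, 5, 6, 7, 11, 12, 15, 16, 17,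
  19, 21, 22, 23, 25, 26], [2, 3, 4, 5, 7, 9, 10, 13, 14, 15, 16, 23, 26]]]

/-- Cores of universal trees of order `27` with balanced labellings. -/
def cores13 : List (List ℕ × List (List ℕ)) := [
  ([0, 3, 3, 3, 3, 4, 4, 4, 4, 4, 4, 4], [[22, 20, 21, 2, 1, 10, 6, 4, 14, 16, 12, 8], [11, 6, 5,
  15, 23, 3, 21, 26, 12, 7, 16, 17], [16, 14, 13, 3, 2, 10, 7, 9, 26, 4, 15, 5]]),
  ([0, 3, 3, 3, 3, 3, 3, 3, 3, 0, 12, 12, 12], [[3, 2, 14, 9, 20, 16, 1, 10, 21, 12, 6, 4, 8], [6,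
  21, 1, 7, 12, 17, 16, 26, 5, 3, 15, 11, 19], [9, 5, 2, 10, 23, 7, 13, 26, 4, 3, 15, 16, 14]]),
  ([0, 3, 3, 4, 0, 7, 7, 9, 9, 10, 12, 5], [[9, 1, 8, 14, 2, 7, 22, 12, 10, 6, 3, 4], [5, 15, 17,
  21, 26, 25, 1, 12, 16, 6, 3, 22], [2, 3, 26, 15, 23, 9, 14, 10, 4, 5, 16, 13]]),
  ([0, 3, 3, 0, 6, 0, 8, 8, 7, 7, 4, 13, 13], [[3, 8, 22, 2, 1, 7, 14, 20, 19, 9, 4, 21, 10], [23,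
  7, 16, 22, 11, 6, 5, 1, 26, 12, 17, 19, 25], [9, 4, 5, 26, 13, 23, 16, 7, 3, 10, 2, 15, 14]]),
  ([0, 3, 3, 5, 5, 0, 8, 8, 10, 10, 0, 13, 13], [[12, 9, 3, 16, 14, 4, 10, 21, 20, 1, 2, 7, 22],
  [12, 23, 16, 15, 1, 3, 25, 5, 21, 11, 26, 7, 19], [10, 7, 3, 16, 14, 4, 26, 5, 23, 9, 15, 13,
  2]]),
  ([0, 3, 4, 4, 5, 0, 8, 0, 10, 10, 12, 12, 12], [[20, 10, 6, 4, 3, 16, 8, 22, 21, 1, 19, 9, 14],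
  [12, 6, 11, 22, 19, 15, 21, 26, 3, 23, 16, 25, 7], [4, 2, 14, 15, 7, 5, 16, 9, 10, 26, 23, 3,
  13]]),
  ([0, 3, 0, 5, 5, 5, 6, 6, 9, 9, 4, 4], [[2, 1, 6, 21, 12, 3, 14, 7, 10, 4, 19, 9], [25, 26, 22,
  21, 1, 11, 5, 16, 15, 17, 3, 23], [14, 7, 26, 13, 23, 3, 4, 9, 16, 15, 5, 2]]),
  ([0, 3, 3, 3, 0, 7, 4, 9, 9, 11, 11, 11], [[1, 14, 9, 19, 16, 8, 7, 22, 12, 2, 6, 10], [6, 5, 3,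
  1, 25, 26, 16, 21, 22, 7, 15, 11], [10, 14, 5, 23, 26, 13, 7, 3, 4, 16, 15, 2]]),
  ([0, 3, 3, 3, 5, 5, 0, 9, 9, 9, 0, 13, 13], [[1, 21, 14, 7, 22, 19, 12, 8, 6, 4, 9, 16, 20], [19,
  12, 23, 7, 22, 1, 3, 15, 25, 5, 17, 6, 11], [4, 15, 2, 16, 26, 3, 14, 5, 9, 7, 23, 10, 13]]),
  ([0, 3, 3, 3, 5, 5, 5, 8, 8, 8, 12], [[14, 21, 20, 7, 10, 8, 12, 6, 4, 2, 1], [15, 3, 12, 21, 6,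
  7, 5, 23, 17, 11, 19], [26, 23, 3, 13, 16, 14, 15, 10, 7, 4, 2]]),
  ([0, 3, 3, 0, 6, 4, 4, 4, 4, 10, 7, 7], [[10, 8, 2, 6, 3, 16, 19, 1, 7, 14, 9, 21], [17, 5, 12,
  3, 15, 11, 7, 25, 21, 26, 23, 19], [23, 14, 9, 5, 16, 10, 26, 4, 15, 2, 13, 3]]),
  ([0, 3, 3, 0, 6, 6, 8, 8, 5, 5, 5, 5], [[14, 6, 8, 22, 10, 12, 3, 9, 19, 1, 7, 16], [15, 3, 12,
  21, 26, 22, 5, 17, 16, 23, 1, 11], [3, 16, 14, 7, 2, 5, 9, 23, 15, 10, 4, 26]]),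
  ([0, 3, 0, 5, 5, 5, 5, 4, 6, 0, 12, 12, 12], [[12, 6, 21, 20, 1, 7, 14, 3, 10, 8, 4, 19, 16],
  [19, 23, 11, 17, 26, 12, 21, 25, 22, 6, 1, 3, 5], [10, 5, 13, 4, 14, 26, 9, 16, 2, 3, 7, 23,
  15]]),
  ([0, 3, 4, 4, 4, 4, 0, 9, 9, 0, 12, 12, 12], [[20, 10, 8, 16, 2, 21, 7, 22, 12, 6, 14, 19, 3],
  [7, 17, 23, 21, 1, 16, 5, 26, 6, 3, 19, 11, 15], [3, 15, 26, 13, 2, 16, 5, 23, 9, 14, 10, 7, 4]]),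
  ([0, 3, 3, 3, 0, 7, 7, 7, 6, 6, 6, 6], [[20, 4, 16, 10, 1, 14, 19, 9, 8, 3, 2, 7], [5, 26, 6, 16,
  19, 12, 23, 7, 21, 15, 22, 1], [4, 15, 2, 16, 10, 14, 5, 23, 3, 9, 13, 7]]),
  ([0, 3, 4, 5, 5, 5, 5, 7, 7, 7, 7], [[1, 14, 7, 3, 12, 4, 22, 10, 19, 20, 2], [17, 22, 11, 5, 15,
  6, 23, 12, 16, 3, 26], [10, 5, 16, 13, 3, 14, 2, 26, 23, 4, 7]]),
  ([0, 3, 3, 4, 4, 4, 4, 9, 9, 9, 9], [[19, 9, 10, 3, 22, 14, 6, 4, 12, 21, 2], [5, 26, 6, 3, 23,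
  25, 1, 16, 12, 17, 11], [15, 13, 2, 4, 14, 9, 26, 23, 10, 16, 3]]),
  ([0, 3, 4, 4, 5, 0, 8, 8, 8, 8, 8, 13], [[14, 7, 6, 1, 3, 20, 12, 16, 10, 8, 4, 2], [17, 22, 23,
  26, 25, 6, 12, 3, 21, 1, 5, 16], [26, 13, 4, 9, 2, 10, 14, 7, 3, 23, 5, 16]]),
  ([0, 3, 3, 0, 6, 6, 4, 0, 10, 10, 10, 10, 10], [[1, 20, 8, 21, 12, 9, 10, 6, 14, 3, 2, 19, 4],
  [12, 23, 16, 7, 1, 6, 25, 22, 3, 17, 11, 5, 19], [2, 14, 15, 9, 4, 5, 7, 26, 16, 23, 10, 3, 13]]),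
  ([0, 3, 0, 5, 5, 5, 5, 5, 9, 7, 7, 7], [[8, 4, 1, 16, 14, 9, 12, 19, 6, 21, 20, 7], [7, 17, 11,
  15, 23, 19, 12, 26, 6, 1, 25, 22], [5, 16, 14, 10, 26, 15, 4, 7, 2, 3, 23, 13]]),
  ([0, 3, 3, 3, 4, 4, 4, 4, 4, 0, 12, 12], [[1, 12, 16, 14, 19, 8, 20, 4, 6, 9, 7, 2], [23, 17, 6,
  25, 5, 16, 22, 12, 1, 3, 19, 11], [10, 3, 5, 7, 26, 4, 15, 14, 16, 9, 23, 13]]),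
  ([0, 3, 3, 3, 3, 3, 0, 9, 9, 9, 9, 12], [[4, 19, 2, 3, 1, 12, 9, 16, 22, 14, 20, 7], [19, 21, 12,
  23, 25, 7, 11, 16, 22, 6, 5, 3], [3, 23, 15, 7, 16, 14, 9, 4, 10, 26, 5, 13]]),
  ([0, 3, 3, 3, 3, 3, 0, 9, 9, 9, 9, 9], [[1, 6, 19, 9, 22, 14, 20, 12, 16, 4, 8, 10], [15, 16, 25,
  21, 17, 26, 6, 11, 3, 5, 22, 1], [5, 2, 3, 23, 16, 9, 14, 10, 15, 26, 4, 7]]),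
  ([0, 3, 3, 5, 4, 4, 4, 4, 4, 4, 0, 13], [[22, 6, 16, 8, 4, 2, 21, 12, 14, 19, 20, 10], [23, 16,
  7, 17, 11, 5, 15, 21, 22, 1, 12, 6], [14, 9, 5, 16, 10, 7, 13, 26, 2, 23, 3, 15]]),
  ([0, 3, 3, 3, 3, 3, 3, 4, 4, 6, 6], [[21, 12, 1, 20, 2, 9, 19, 4, 8, 14, 6], [21, 5, 22, 26, 25,
  16, 23, 17, 15, 19, 7], [15, 26, 5, 13, 10, 2, 16, 23, 3, 4, 9]]),
  ([0, 3, 3, 3, 0, 7, 7, 7, 7, 7, 7, 0, 14], [[14, 7, 19, 22, 10, 1, 21, 2, 8, 9, 16, 12, 6], [7,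
  17, 1, 6, 15, 19, 3, 12, 16, 23, 26, 22, 11], [4, 5, 26, 2, 23, 14, 10, 13, 7, 9, 16, 3, 15]]),
  ([0, 3, 3, 3, 3, 3, 3, 0, 10, 10, 10, 10], [[10, 6, 7, 2, 8, 3, 4, 21, 9, 1, 12, 20], [15, 12,
  26, 25, 17, 16, 3, 6, 11, 5, 1, 22], [3, 26, 23, 14, 16, 7, 4, 15, 10, 5, 2, 13]]),
  ([0, 3, 3, 3, 3, 3, 3, 3, 7, 9, 0, 13], [[1, 19, 9, 12, 16, 6, 14, 22, 8, 7, 20, 10], [7, 12, 15,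
  17, 19, 1, 6, 22, 23, 3, 25, 26], [3, 7, 16, 23, 4, 14, 26, 15, 2, 13, 10, 5]]),
  ([0, 3, 3, 3, 3, 3, 3, 3, 9, 9, 4], [[1, 6, 9, 7, 21, 14, 22, 19, 10, 12, 3], [6, 3, 17, 5, 16,
  1, 22, 11, 23, 26, 15], [3, 26, 15, 23, 7, 4, 14, 16, 9, 5, 13]]),
  ([0, 3, 3, 3, 3, 3, 3, 3, 3, 0, 12, 12], [[12, 3, 2, 8, 19, 9, 20, 10, 4, 22, 16, 6], [23, 6, 11,
  1, 16, 17, 22, 7, 12, 26, 5, 21], [9, 10, 13, 5, 2, 4, 7, 23, 26, 3, 14, 16]]),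
  ([0, 3, 4, 4, 5, 0, 8, 8, 0, 11, 11, 6], [[16, 8, 2, 6, 1, 12, 19, 20, 14, 4, 10, 3], [19, 23,
  17, 6, 22, 16, 1, 15, 5, 21, 11, 3], [4, 2, 26, 3, 13, 10, 23, 14, 16, 9, 7, 15]]),
  ([0, 3, 3, 5, 5, 6, 6, 4, 0, 11, 11], [[6, 2, 4, 22, 9, 10, 12, 1, 3, 16, 14], [12, 23, 16, 22,
  21, 15, 7, 25, 17, 6, 11], [2, 26, 3, 14, 16, 4, 10, 13, 5, 9, 23]]),
  ([0, 3, 4, 4, 0, 7, 5, 9, 6, 6, 6], [[2, 1, 12, 16, 20, 10, 6, 3, 22, 8, 21], [3, 15, 17, 25, 5,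
  16, 22, 11, 6, 19, 26], [26, 13, 10, 3, 4, 2, 5, 16, 23, 7, 15]]),
  ([0, 3, 4, 5, 5, 0, 8, 8, 8, 6, 6], [[2, 1, 14, 19, 22, 20, 10, 12, 8, 16, 3], [11, 19, 23, 17,
  6, 3, 5, 25, 15, 1, 16], [10, 5, 16, 13, 3, 14, 26, 7, 15, 9, 4]]),
  ([0, 3, 3, 3, 6, 6, 4, 4, 5, 5], [[14, 7, 20, 21, 19, 2, 1, 6, 4, 16], [19, 25, 23, 21, 5, 16, 3,
  22, 6, 17], [10, 14, 5, 23, 7, 16, 15, 26, 3, 2]]),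
  ([0, 3, 3, 3, 6, 6, 6, 0, 10, 8, 4], [[1, 20, 14, 8, 16, 4, 19, 6, 3, 2, 10], [3, 15, 11, 19, 7,
  12, 23, 17, 22, 6, 21], [4, 5, 2, 26, 23, 3, 13, 14, 7, 15, 16]]),
  ([0, 3, 3, 3, 0, 7, 7, 7, 0, 11, 10, 10], [[1, 14, 7, 21, 12, 4, 6, 8, 20, 10, 16, 19], [15, 12,
  21, 3, 5, 25, 16, 7, 19, 23, 6, 1], [5, 23, 16, 9, 3, 26, 4, 15, 14, 7, 2, 13]]),
  ([0, 3, 3, 3, 0, 7, 7, 7, 6, 6, 6], [[8, 4, 21, 14, 20, 19, 10, 1, 12, 7, 2], [5, 26, 16, 6, 17,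
  19, 22, 25, 3, 21, 12], [3, 4, 15, 26, 14, 7, 9, 5, 16, 10, 13]]),
  ([0, 3, 3, 3, 3, 6, 5, 0, 10, 4, 8], [[22, 20, 6, 16, 2, 8, 3, 1, 14, 10, 4], [5, 25, 11, 7, 21,
  17, 19, 3, 15, 26, 22], [13, 3, 4, 10, 9, 5, 2, 14, 7, 15, 16]]),
  ([0, 3, 4, 4, 4, 4, 7, 0, 10, 10, 9], [[6, 3, 21, 9, 1, 2, 14, 16, 4, 12, 7], [6, 3, 19, 23, 7,
  11, 17, 1, 16, 12, 22], [26, 13, 4, 9, 10, 3, 5, 2, 15, 14, 16]]),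
  ([0, 3, 4, 4, 5, 5, 5, 5, 8, 8], [[1, 14, 20, 21, 16, 12, 8, 4, 3, 9], [25, 26, 23, 3, 6, 1, 17,
  22, 21, 7], [4, 2, 15, 14, 10, 26, 5, 16, 3, 23]]),
  ([0, 3, 4, 0, 6, 6, 6, 6, 0, 11, 11, 11], [[1, 14, 7, 21, 12, 9, 2, 19, 20, 10, 16, 4], [6, 3,
  15, 23, 7, 11, 16, 12, 17, 19, 25, 22], [10, 5, 16, 9, 13, 7, 23, 2, 3, 4, 15, 26]]),
  ([0, 3, 3, 3, 3, 7, 7, 0, 10, 10, 10], [[4, 22, 21, 10, 9, 8, 1, 6, 3, 14, 19], [21, 25, 5, 23,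
  16, 17, 26, 6, 11, 22, 3], [13, 26, 3, 10, 14, 5, 9, 4, 2, 15, 16]]),
  ([0, 3, 3, 3, 3, 0, 8, 8, 8, 8, 0, 13], [[14, 20, 19, 22, 21, 16, 12, 4, 9, 7, 6, 3], [23, 16,
  17, 7, 6, 26, 1, 21, 25, 5, 22, 11], [9, 23, 13, 7, 2, 14, 15, 4, 10, 26, 5, 16]]),
  ([0, 3, 0, 5, 6, 6, 6, 6, 6, 7, 7], [[16, 8, 2, 1, 21, 14, 6, 22, 7, 9, 12], [7, 17, 11, 19, 21,
  23, 25, 3, 16, 26, 22], [26, 13, 10, 5, 2, 16, 9, 3, 23, 14, 15]]),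
  ([0, 3, 3, 3, 3, 3, 8, 8, 10, 10], [[12, 20, 6, 8, 4, 19, 9, 10, 16, 21], [15, 25, 3, 12, 17, 21,
  26, 22, 6, 16], [3, 23, 16, 15, 7, 14, 5, 9, 10, 26]]),
  ([0, 3, 0, 5, 5, 5, 5, 5, 0, 11, 11, 11], [[1, 14, 6, 21, 2, 3, 4, 12, 16, 9, 8, 7], [12, 6, 23,
  22, 1, 16, 25, 7, 11, 19, 21, 17], [4, 2, 26, 16, 23, 10, 3, 13, 14, 7, 9, 5]]),
  ([0, 3, 3, 3, 3, 3, 0, 9, 9, 9, 9], [[12, 20, 8, 6, 19, 4, 3, 1, 14, 16, 2], [25, 26, 3, 19, 6,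
  22, 1, 7, 23, 5, 21], [14, 7, 26, 15, 4, 10, 5, 2, 23, 3, 9]]),
  ([0, 3, 3, 3, 3, 3, 3, 0, 10, 0, 12, 9], [[3, 16, 10, 20, 21, 9, 14, 12, 6, 4, 2, 7], [15, 19,
  16, 3, 12, 26, 23, 22, 11, 7, 17, 25], [9, 4, 26, 23, 10, 13, 5, 3, 15, 14, 7, 16]]),
  ([0, 3, 3, 4, 4, 4, 4, 4, 4, 0, 12], [[20, 16, 4, 10, 21, 6, 7, 22, 9, 2, 1], [6, 12, 21, 23, 5,
  22, 17, 7, 16, 11, 19], [9, 2, 7, 3, 16, 13, 14, 15, 26, 10, 5]]),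
  ([0, 3, 3, 3, 3, 3, 3, 6, 6, 6], [[9, 20, 3, 2, 7, 16, 6, 19, 1, 10], [1, 25, 23, 3, 12, 5, 16,
  15, 19, 11], [14, 10, 4, 5, 26, 15, 9, 2, 3, 16]]),
  ([0, 3, 3, 0, 6, 6, 6, 6, 6, 6, 6], [[21, 12, 9, 14, 8, 22, 7, 19, 10, 4, 6], [7, 15, 19, 12, 16,
  1, 23, 11, 6, 17, 22], [2, 16, 13, 14, 5, 15, 26, 10, 4, 7, 9]]),
  ([0, 3, 3, 3, 3, 3, 3, 3, 3, 0, 12], [[10, 1, 8, 4, 9, 21, 6, 2, 16, 14, 7], [1, 3, 25, 12, 6,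
  22, 11, 16, 17, 19, 23], [9, 2, 5, 4, 23, 7, 13, 26, 10, 3, 15]]),
  ([0, 3, 0, 5, 6, 6, 4, 4, 9, 0, 12], [[12, 6, 20, 10, 21, 16, 14, 19, 7, 2, 1], [3, 15, 22, 11,
  21, 17, 23, 19, 25, 12, 6], [3, 15, 10, 5, 23, 9, 26, 16, 13, 4, 2]]),
  ([0, 3, 3, 5, 0, 7, 8, 8, 0, 11, 11], [[2, 21, 8, 4, 20, 10, 3, 7, 9, 22, 14], [19, 21, 25, 26,
  12, 6, 5, 1, 11, 23, 15], [9, 5, 4, 2, 3, 15, 16, 26, 10, 23, 14]]),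
  ([0, 3, 3, 5, 5, 0, 8, 8, 10, 10], [[8, 21, 14, 10, 4, 12, 3, 9, 16, 20], [17, 11, 6, 1, 5, 21,
  26, 22, 15, 7], [23, 14, 9, 4, 5, 2, 16, 13, 3, 10]]),
  ([0, 3, 0, 5, 5, 5, 4, 4, 0, 11, 9], [[8, 4, 2, 22, 1, 7, 12, 19, 20, 10, 6], [19, 23, 6, 3, 12,
  21, 22, 1, 5, 16, 11], [4, 2, 5, 23, 16, 9, 3, 26, 14, 7, 15]]),
  ([0, 3, 3, 4, 4, 4, 0, 9, 9, 8], [[12, 2, 10, 20, 9, 1, 16, 22, 21, 14], [11, 12, 26, 5, 6, 7,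
  25, 22, 3, 17], [14, 10, 4, 5, 7, 3, 9, 23, 13, 15]]),
  ([0, 3, 3, 3, 4, 4, 4, 0, 10, 7], [[14, 20, 7, 21, 16, 4, 10, 6, 3, 8], [15, 23, 19, 21, 25, 1,
  22, 6, 3, 26], [3, 14, 15, 16, 4, 10, 7, 26, 13, 2]]),
  ([0, 3, 3, 3, 4, 4, 5, 5, 5], [[20, 6, 14, 10, 4, 2, 19, 22, 7], [3, 25, 15, 5, 19, 6, 26, 21,
  16], [26, 16, 10, 13, 14, 2, 5, 7, 3]]),
  ([0, 3, 4, 0, 6, 6, 6, 6, 7, 0, 12], [[2, 1, 14, 10, 16, 21, 7, 3, 8, 12, 6], [3, 15, 21, 22, 23,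
  5, 17, 26, 25, 12, 6], [10, 5, 16, 13, 4, 14, 26, 9, 2, 3, 15]]),
  ([0, 3, 3, 5, 6, 6, 6, 6, 7], [[16, 2, 14, 7, 12, 4, 3, 22, 6], [26, 19, 7, 17, 12, 5, 1, 16, 6],
  [9, 4, 5, 16, 3, 14, 2, 13, 15]]),
  ([0, 3, 3, 0, 6, 6, 6, 6, 0, 11, 11], [[12, 4, 8, 16, 6, 10, 9, 7, 14, 20, 21], [5, 11, 21, 15,
  16, 26, 17, 25, 19, 7, 12], [9, 4, 5, 26, 10, 23, 16, 3, 15, 13, 2]]),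
  ([0, 3, 3, 3, 6, 6, 6, 6, 10], [[20, 12, 10, 8, 2, 14, 21, 6, 3], [22, 19, 3, 11, 12, 26, 6, 5,
  16], [3, 16, 15, 14, 5, 9, 10, 4, 2]]),
  ([0, 3, 3, 3, 3, 6, 6, 6, 6], [[7, 6, 1, 3, 4, 8, 10, 22, 20], [22, 26, 23, 15, 7, 3, 17, 25,
  12], [23, 7, 14, 9, 16, 5, 4, 10, 26]]),
  ([0, 3, 3, 3, 3, 3, 6, 5, 0, 11], [[12, 19, 6, 20, 8, 4, 10, 3, 2, 1], [15, 3, 17, 12, 21, 25, 6,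
  22, 11, 19], [3, 7, 4, 26, 15, 23, 13, 2, 5, 16]]),
  ([0, 3, 3, 0, 6, 6, 6, 6, 6, 11], [[14, 2, 12, 16, 8, 9, 7, 10, 6, 3], [17, 25, 19, 22, 11, 16,
  6, 7, 15, 21], [10, 14, 23, 4, 16, 5, 15, 2, 26, 13]]),
  ([0, 3, 3, 3, 5, 5, 5, 5, 5], [[1, 22, 6, 14, 3, 2, 21, 12, 4], [23, 6, 17, 25, 1, 12, 22, 5,
  16], [26, 13, 10, 16, 5, 14, 7, 23, 3]]),
  ([0, 3, 3, 3, 3, 3, 3, 7, 0, 11], [[16, 7, 14, 9, 6, 2, 10, 3, 8, 4], [17, 1, 5, 16, 11, 6, 12,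
  19, 23, 25], [23, 16, 7, 13, 10, 9, 14, 5, 3, 15]]),
  ([0, 3, 3, 0, 6, 6, 6, 6, 6, 6], [[6, 21, 12, 2, 22, 19, 9, 10, 7, 20], [12, 17, 22, 5, 25, 6, 7,
  21, 11, 26], [14, 15, 26, 9, 13, 5, 4, 23, 2, 7]]),
  ([0, 3, 3, 3, 3, 3, 3, 3, 0, 11], [[12, 20, 19, 10, 9, 3, 6, 2, 8, 4], [11, 26, 12, 19, 6, 16,
  22, 5, 7, 17], [3, 7, 16, 23, 4, 26, 14, 15, 10, 5]]),
  ([0, 3, 3, 3, 3, 3, 3, 3, 3], [[3, 8, 2, 20, 10, 9, 21, 1, 22], [17, 23, 11, 12, 25, 21, 6, 5,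
  19], [9, 26, 13, 23, 7, 2, 5, 10, 4]]),
  ([0, 3, 3, 5, 4, 7, 0, 9, 0, 11], [[1, 8, 20, 10, 4, 2, 14, 7, 6, 3], [11, 23, 15, 21, 25, 26, 6,
  3, 7, 17], [9, 10, 26, 13, 5, 16, 3, 15, 4, 2]]),
  ([0, 3, 3, 5, 5, 0, 8, 4, 9], [[20, 1, 19, 12, 7, 8, 4, 14, 2], [26, 11, 15, 12, 3, 7, 17, 19,
  22], [13, 14, 26, 23, 3, 10, 5, 7, 16]]),
  ([0, 3, 3, 5, 5, 7, 7, 4], [[16, 14, 2, 20, 9, 1, 8, 7], [19, 12, 7, 23, 11, 21, 17, 6], [2, 26,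
  3, 16, 14, 4, 10, 13]]),
  ([0, 3, 3, 3, 0, 7, 6, 0, 10, 4], [[16, 4, 8, 12, 20, 10, 6, 1, 14, 2], [7, 22, 17, 12, 15, 21,
  6, 25, 26, 11], [10, 5, 23, 14, 26, 13, 7, 4, 2, 16]]),
  ([0, 3, 3, 5, 0, 7, 7, 7, 6], [[4, 19, 12, 6, 1, 21, 7, 14, 3], [3, 7, 23, 25, 17, 22, 6, 11,
  26], [13, 3, 10, 5, 14, 15, 26, 7, 16]]),
  ([0, 3, 3, 3, 0, 7, 7, 6, 6], [[8, 4, 21, 14, 2, 20, 9, 22, 19], [22, 11, 19, 3, 7, 1, 6, 5, 25],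
  [10, 3, 7, 5, 4, 16, 15, 9, 23]]),
  ([0, 3, 3, 3, 0, 7, 5, 5, 5], [[2, 19, 1, 10, 6, 3, 21, 14, 7], [19, 23, 3, 16, 22, 11, 15, 5,
  25], [10, 3, 5, 7, 4, 2, 16, 9, 23]]),
  ([0, 3, 3, 3, 3, 0, 8, 7, 9], [[10, 21, 2, 16, 8, 1, 14, 4, 7], [11, 15, 17, 21, 23, 12, 6, 25,
  3], [2, 14, 15, 3, 26, 10, 5, 13, 16]]),
  ([0, 3, 0, 5, 5, 0, 8, 8, 8, 8], [[16, 8, 10, 6, 4, 14, 19, 22, 12, 2], [3, 15, 16, 22, 21, 7,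
  23, 1, 11, 6], [5, 16, 10, 3, 7, 13, 4, 14, 9, 26]]),
  ([0, 3, 3, 3, 3, 7, 7, 7], [[16, 7, 9, 14, 2, 21, 1, 8], [3, 7, 23, 5, 25, 19, 6, 26], [4, 5, 15,
  16, 26, 13, 23, 3]]),
  ([0, 3, 0, 5, 5, 5, 5, 5, 8], [[1, 14, 12, 8, 19, 20, 6, 4, 10], [25, 26, 19, 12, 7, 3, 16, 23,
  15], [26, 13, 10, 14, 3, 5, 23, 7, 16]]),
  ([0, 3, 3, 3, 3, 3, 6, 6], [[4, 2, 19, 12, 21, 10, 9, 3], [17, 25, 19, 22, 6, 11, 23, 26], [26,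
  16, 10, 13, 3, 23, 4, 9]]),
  ([0, 3, 4, 4, 4, 4, 4, 4], [[16, 8, 2, 21, 14, 1, 7, 6], [15, 21, 26, 23, 16, 5, 25, 22], [4, 2,
  13, 26, 16, 14, 3, 15]]),
  ([0, 3, 3, 3, 3, 3, 3, 3], [[14, 22, 10, 19, 8, 4, 6, 7], [17, 12, 11, 16, 1, 5, 22, 6], [3, 26,
  14, 7, 23, 15, 16, 4]]),
  ([0, 3, 3, 4, 0, 7, 5, 0, 10], [[9, 20, 16, 10, 12, 6, 8, 1, 14], [12, 7, 5, 17, 25, 26, 16, 6,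
  3], [9, 5, 4, 16, 3, 15, 2, 26, 13]]),
  ([0, 3, 4, 4, 0, 7, 6, 6], [[4, 2, 22, 7, 6, 3, 20, 14], [5, 16, 15, 1, 12, 6, 17, 11], [3, 15,
  10, 5, 4, 2, 23, 9]]),
  ([0, 3, 3, 0, 6, 6, 0, 9, 9], [[22, 8, 14, 10, 6, 4, 1, 7, 21], [25, 22, 3, 26, 11, 15, 17, 23,
  21], [26, 16, 10, 23, 14, 9, 7, 3, 4]]),
  ([0, 3, 3, 3, 0, 7, 0, 9, 10], [[20, 10, 16, 4, 1, 14, 12, 6, 3], [6, 3, 16, 17, 22, 11, 23, 25,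
  26], [14, 15, 7, 26, 4, 2, 10, 5, 16]]),
  ([0, 3, 0, 5, 5, 5, 4, 4], [[14, 7, 20, 10, 16, 4, 22, 12], [7, 17, 5, 26, 6, 16, 23, 21], [14,
  7, 26, 23, 3, 13, 5, 2]]),
  ([0, 3, 3, 3, 6, 6, 6], [[20, 10, 14, 6, 12, 3, 21], [25, 26, 19, 6, 22, 3, 11], [26, 13, 16, 10,
  7, 3, 5]]),
  ([0, 3, 4, 4, 4, 4, 7], [[4, 2, 9, 7, 20, 22, 10], [25, 26, 15, 21, 11, 5, 19], [5, 16, 13, 9, 3,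
  7, 15]]),
  ([0, 3, 3, 3, 3, 7, 7], [[8, 1, 14, 21, 7, 4, 3], [7, 6, 1, 22, 12, 23, 16], [9, 5, 23, 13, 4,
  16, 15]]),
  ([0, 3, 3, 3, 3, 3, 8], [[4, 1, 3, 19, 2, 12, 6], [11, 5, 12, 26, 6, 19, 23], [14, 5, 7, 9, 15,
  26, 13]]),
  ([0, 3, 3, 3, 3, 3, 3], [[21, 20, 2, 19, 9, 1, 12], [11, 12, 5, 6, 15, 23, 26], [9, 26, 13, 23,
  10, 7, 2]]),
  ([0, 3, 4, 4, 0, 7, 0, 9], [[14, 7, 6, 1, 8, 4, 20, 10], [22, 11, 17, 21, 6, 3, 25, 26], [5, 16,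
  13, 3, 14, 7, 4, 2]]),
  ([0, 3, 0, 5, 5, 0, 8, 8], [[16, 8, 6, 2, 4, 7, 14, 20], [12, 6, 3, 25, 5, 16, 21, 22], [4, 2, 5,
  23, 9, 26, 10, 16]]),
  ([0, 3, 4, 0, 6, 6, 6], [[12, 6, 3, 2, 8, 21, 1], [7, 17, 22, 5, 16, 6, 26], [10, 5, 16, 14, 15,
  7, 26]]),
  ([0, 3, 3, 3, 0, 7, 7], [[4, 12, 19, 2, 22, 21, 1], [17, 19, 25, 22, 23, 16, 7], [26, 16, 10, 13,
  5, 3, 2]]),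
  ([0, 3, 3, 3, 3, 4], [[22, 14, 12, 10, 8, 7], [19, 7, 12, 16, 3, 17], [2, 3, 13, 16, 26, 15]]),
  ([0, 3, 3, 3, 3, 3], [[2, 10, 19, 1, 20, 9], [7, 19, 15, 22, 12, 17], [3, 16, 23, 14, 7, 15]]),
  ([0, 3, 0, 5, 6, 0, 8], [[16, 8, 1, 14, 7, 6, 3], [5, 16, 7, 17, 22, 12, 6], [14, 7, 10, 5, 16,
  4, 2]]),
  ([0, 3, 0, 5, 0, 7, 7], [[20, 10, 6, 3, 8, 16, 19], [6, 3, 22, 11, 23, 7, 16], [14, 7, 5, 16, 23,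
  13, 10]]),
  ([0, 3, 3, 0, 6, 6], [[2, 19, 10, 3, 8, 22], [7, 12, 22, 15, 23, 19], [7, 3, 4, 14, 15, 26]]),
  ([0, 3, 0, 5, 5, 5], [[8, 4, 6, 3, 21, 12], [23, 25, 15, 3, 12, 21], [14, 7, 3, 4, 26, 15]]),
  ([0, 3, 3, 3, 3], [[10, 1, 9, 3, 7], [22, 21, 1, 3, 19], [10, 7, 14, 23, 3]]),
  ([0, 3, 4, 0, 6], [[4, 2, 1, 20, 10], [7, 17, 22, 5, 16], [10, 5, 16, 14, 7]]),
  ([0, 3, 4, 4], [[20, 10, 1, 9], [23, 25, 6, 19], [14, 7, 3, 4]]),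
  ([0, 3, 3, 3], [[1, 14, 8, 20], [3, 23, 7, 15], [5, 23, 16, 9]]),
  ([0, 3, 0, 5], [[16, 8, 14, 7], [15, 21, 7, 17], [5, 16, 3, 15]]),
  ([0, 3, 3], [[21, 20, 1], [7, 1, 6], [2, 16, 13]]),
  ([0, 3], [[16, 8], [12, 6], [14, 7]]),
  ([], [[]])]

set_option maxRecDepth 100000 in
lemma isCertificate13 : IsCertificate 13 labelSets13 cores13 := by decide +kernel

end Data

/-- for 1 ≤ n ≤ 13, `K_{2n+1}^{(2·τ(2n+1))}` decomposes into 2n+1 copies of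
the family of all trees of order 2n+1. -/
theorem K_odd_decomposes_into_copies_of_all_trees :
    ∀ n : ℕ, 1 ≤ n → n ≤ 13 →
      ∃ M : Multiset (SimpleGraph (Fin (2 * n + 1))),
        (∀ G ∈ M, G.IsTree) ∧
        (∀ T : SimpleGraph (Fin (2 * n + 1)), T.IsTree →
          countP' (fun G => Nonempty (G ≃g T)) M = 2 * n + 1) ∧
        (∀ a b : Fin (2 * n + 1), a ≠ b →
          countP' (fun G => G.Adj a b) M = 2 * tau (2 * n + 1)) := by
  intro n h1 h13
  interval_cases n
  · exact isCertificate1.exists_decomposition (by norm_num) (by norm_num [cores1])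
  · exact isCertificate2.exists_decomposition (by norm_num) (by norm_num [cores2])
  · exact isCertificate3.exists_decomposition (by norm_num) (by norm_num [cores3])
  · exact isCertificate4.exists_decomposition (by norm_num) (by norm_num [cores4])
  · exact isCertificate5.exists_decomposition (by norm_num) (by norm_num [cores5])
  · exact isCertificate6.exists_decomposition (by norm_num) (by norm_num [cores6])
  · exact isCertificate7.exists_decomposition (by norm_num) (by norm_num [cores7])
  · exact isCertificate8.exists_decomposition (by norm_num) (by norm_num [cores8])
  · exact isCertificate9.exists_decomposition (by norm_num) (by norm_num [cores9])
  · exact isCertificate10.exists_decomposition (by norm_num) (by norm_num [cores10])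
  · exact isCertificate11.exists_decomposition (by norm_num) (by norm_num [cores11])
  · exact isCertificate12.exists_decomposition (by norm_num) (by norm_num [cores12])
  · exact isCertificate13.exists_decomposition (by norm_num) (by norm_num [cores13])
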